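/- There exists a universal constant C > 0 such that the following holds. Let N ≥ 2, k ≥ 2, let U ∈ ℝ^{N×N} be a good orthogonal matrix, and let D_{U,k} be the distribution on {-1,1}^{kN} defined from U. Let F : {-1,1}^{kN} → {0,1} be computed by a decision tree of depth at most d, and suppose that C·d·ln(kN) ≤ N^{2(k-1)/(3k-1)}. Then | E_{z uniform in {-1,1}^{kN}}[F(z)] - E_{z∼D_{U,k}}[F(z)] | ≤ √( (C·d·ln(kN))^{(3k-1)/2} / N^{k-1} ). -/

import Mathlib

open scoped BigOperators
open MeasureTheory


/-- A deterministic decision tree over variables indexed by `α`: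
each internal node queries a variable (the first subtree is followed when the
variable equals `-1`, i.e. `false`, the second when it equals `1`, i.e. `true`),
and each leaf is labeled by `0` or `1` (encoded as a `Bool`). -/
inductive DTree (α : Type) : Type where
  | leaf : Bool → DTree α
  | node : α → DTree α → DTree α → DTree α

namespace DTree

/-- Evaluation of a decision tree on an input in `{-1,1}^α`, encoded as a
function `α → Bool` (`true` stands for `1`, `false` for `-1`); the output
`{0,1}` is given as a real number. -/
def eval {α : Type} : DTree α → (α → Bool) → ℝ
  | leaf b, _ => if b then 1 else 0
  | node i t0 t1, x => if x i then t1.eval x else t0.eval x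

/-- Depth of a decision tree: the maximal number of internal nodes on a
root-to-leaf path. -/
def depth {α : Type} : DTree α → ℕ
  | leaf _ => 0
  | node _ t0 t1 => 1 + max t0.depth t1.depth

end DTree

/-- The Fourier coefficient `f̂(S) = 2^{-n} ∑_{x ∈ {-1,1}^n} f(x) ∏_{i ∈ S} x_i`,
for `f` on `{-1,1}^α` encoded as a function on `α → Bool`. -/
noncomputable def booleanFourierCoeff {α : Type} [Fintype α] [DecidableEq α]
    (f : (α → Bool) → ℝ) (S : Finset α) : ℝ :=
  (∑ x : α → Bool, f x * ∏ i ∈ S, (if x i then (1 : ℝ) else -1)) / 2 ^ Fintype.card α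

/-- The average of `f` over the uniform distribution on `{-1,1}^α`;
for `{0,1}`-valued `f` this is `Pr[f(x) = 1]`. -/
noncomputable def uavg {α : Type} [Fintype α] [DecidableEq α]
    (f : (α → Bool) → ℝ) : ℝ :=
  (∑ x : α → Bool, f x) / 2 ^ Fintype.card α


/-- `U : Fin N → Fin N → ℝ` (viewed as an `N × N` real matrix `U i j`) is
orthogonal: its columns and its rows are orthonormal. -/
def IsOrthogonal {N : ℕ} (U : Fin N → Fin N → ℝ) : Prop :=
  (∀ j₁ j₂ : Fin N, ∑ i, U i j₁ * U i j₂ = if j₁ = j₂ then (1 : ℝ) else 0) ∧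
  (∀ i₁ i₂ : Fin N, ∑ j, U i₁ j * U i₂ j = if i₁ = i₂ then (1 : ℝ) else 0)

/-- The sign function into `{-1,1}`: `sgn t = 1` if `t ≥ 0`, and `-1` otherwise. -/
noncomputable def sgn (t : ℝ) : ℝ := if 0 ≤ t then 1 else -1

/-- The standard Gaussian measure on `ℝ^N`. -/
noncomputable def stdGaussianVec (N : ℕ) : MeasureTheory.Measure (Fin N → ℝ) :=
  MeasureTheory.Measure.pi fun _ => ProbabilityTheory.gaussianReal 0 1

/-- The law of `m` independent standard Gaussian vectors in `ℝ^N`. -/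
noncomputable def stdGaussianFam (N m : ℕ) :
    MeasureTheory.Measure (Fin m → Fin N → ℝ) :=
  MeasureTheory.Measure.pi fun _ => stdGaussianVec N

/-- Given independent standard Gaussian vectors `X^{(1)},…,X^{(k-1)}` in `ℝ^N`
(indexed here by `Fin (k-1)`), with `Y^{(i)} = Uᵀ X^{(i)}`, the vectors
`Z^{(1)} = X^{(1)}`, `Z^{(i)} = Y^{(i-1)} ⊙ X^{(i)}` for `2 ≤ i ≤ k-1`, and
`Z^{(k)} = Y^{(k-1)}` (0-indexed below; out-of-range cases give junk `0`). -/
noncomputable def Zfam (N k : ℕ) (U : Fin N → Fin N → ℝ)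
    (X : Fin (k - 1) → Fin N → ℝ) : Fin k → Fin N → ℝ := fun a j =>
  if a.val = 0 then
    (if h : 0 < k - 1 then X ⟨0, h⟩ j else 0)
  else if a.val = k - 1 then
    (if h : k - 2 < k - 1 then ∑ l, U l j * X ⟨k - 2, h⟩ l else 0)
  else
    (if h : a.val - 1 < k - 1 ∧ a.val < k - 1 then
      (∑ l, U l j * X ⟨a.val - 1, h.1⟩ l) * X ⟨a.val, h.2⟩ j
    else 0)

/-- The operator (spectral) norm of a real matrix `A` (given as a function):
`‖A‖ = sup_{x ≠ 0} ‖Ax‖₂ / ‖x‖₂` (and `0` if the index types are empty). -/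
noncomputable def opNorm {m n : Type} [Fintype m] [Fintype n]
    (A : m → n → ℝ) : ℝ :=
  sSup {r : ℝ | ∃ x : n → ℝ, x ≠ 0 ∧
    r = Real.sqrt (∑ i, (∑ j, A i j * x j) ^ 2) / Real.sqrt (∑ j, x j ^ 2)}

/-- The operator norm of the submatrix `U_{S,T}` of `U` with rows indexed by
`S` and columns indexed by `T`. -/
noncomputable def subOpNorm {N : ℕ} (U : Fin N → Fin N → ℝ)
    (S T : Finset (Fin N)) : ℝ :=
  opNorm (fun (i : {a // a ∈ S}) (j : {a // a ∈ T}) => U i.val j.val)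

/-- An orthogonal matrix `U ∈ ℝ^{N×N}` is *good* if every nonempty submatrix
`U_{S,T}` satisfies `‖U_{S,T}‖ ≤ √(100·(|S|+|T|)·ln N / N)`. -/
def IsGood {N : ℕ} (U : Fin N → Fin N → ℝ) : Prop :=
  ∀ S T : Finset (Fin N), S.Nonempty → T.Nonempty →
    subOpNorm U S T ≤ Real.sqrt (100 * (S.card + T.card) * Real.log N / N)

/-- The Boolean sign of a real number (`true` encodes `1`, i.e. `t ≥ 0`;
`false` encodes `-1`). -/
noncomputable def sgnBool (t : ℝ) : Bool := if 0 ≤ t then true else false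

section
open scoped BigOperators
open MeasureTheory

noncomputable def gPi (ι : Type) [Fintype ι] : Measure (ι → ℝ) :=
  Measure.pi fun _ => ProbabilityTheory.gaussianReal 0 1

instance gPi_prob (ι : Type) [Fintype ι] : IsProbabilityMeasure (gPi ι) := by
  unfold gPi; infer_instance

lemma gPi_charFunDual {ι κ : Type} [Fintype ι] [Fintype κ] [DecidableEq ι] [DecidableEq κ]
    (A : κ → ι → ℝ)
    (L : StrongDual ℝ (κ → ℝ)) :
    charFunDual ((gPi ι).map (fun x k => ∑ i, A k i * x i)) L =
      Complex.exp (-(((∑ k, ∑ l, L (Pi.single k 1) * L (Pi.single l 1) *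
        ∑ i, A k i * A l i : ℝ) : ℂ) / 2)) := by
  have hL : ∀ v : κ → ℝ, L v = ∑ k, v k * L (Pi.single k 1) := by
    intro v
    conv_lhs => rw [pi_eq_sum_univ' v]
    simp [map_sum]
  rw [charFunDual_apply, integral_map (Measurable.aemeasurable (by fun_prop)) (by fun_prop)]
  have h1 : ∀ x : ι → ℝ, Complex.exp (L (fun k => ∑ i, A k i * x i) * Complex.I) =
      ∏ i, Complex.exp ((((∑ k, A k i * L (Pi.single k 1)) : ℝ) : ℂ) * (x i : ℂ) * Complex.I) := by
    intro x
    rw [← Complex.exp_sum, hL]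
    congr 1
    rw [← Finset.sum_mul]
    congr 1
    push_cast
    simp_rw [Finset.sum_mul]
    rw [Finset.sum_comm]
    refine Finset.sum_congr rfl fun i _ => Finset.sum_congr rfl fun k _ => by ring
  simp_rw [h1]
  unfold gPi
  rw [integral_fintype_prod_eq_prod (𝕜 := ℂ) (fun i (y : ℝ) =>
    Complex.exp ((((∑ k, A k i * L (Pi.single k 1)) : ℝ) : ℂ) * (y : ℂ) * Complex.I))]
  have h2 : ∀ i, ∫ y : ℝ, Complex.exp ((((∑ k, A k i * L (Pi.single k 1)) : ℝ) : ℂ) * (y : ℂ) * Complex.I)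
      ∂(ProbabilityTheory.gaussianReal 0 1) =
      Complex.exp (-((((∑ k, A k i * L (Pi.single k 1))^2 : ℝ) : ℂ) / 2)) := by
    intro i
    rw [← charFun_apply_real, ProbabilityTheory.charFun_gaussianReal]
    congr 1
    push_cast
    simp
  simp_rw [h2]
  rw [← Complex.exp_sum]
  congr 1
  rw [Finset.sum_neg_distrib, ← Finset.sum_div]
  congr 2
  rw [← Complex.ofReal_sum]
  congr 1
  simp_rw [sq, Finset.sum_mul_sum, Finset.mul_sum]
  rw [Finset.sum_comm]
  refine Finset.sum_congr rfl fun k _ => ?_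
  rw [Finset.sum_comm]
  refine Finset.sum_congr rfl fun l _ => Finset.sum_congr rfl fun i _ => by ring

/-- Linear images of standard Gaussian vectors with equal covariances have equal laws. -/
lemma gPi_map_eq {ι ι' κ : Type} [Fintype ι] [Fintype ι'] [Fintype κ]
    (A : κ → ι → ℝ) (A' : κ → ι' → ℝ)
    (h : ∀ k l, ∑ i, A k i * A l i = ∑ i, A' k i * A' l i) :
    (gPi ι).map (fun x k => ∑ i, A k i * x i) = (gPi ι').map (fun x k => ∑ i, A' k i * x i) := by
  classical
  have : IsFiniteMeasure ((gPi ι).map (fun x k => ∑ i, A k i * x i)) := inferInstance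
  apply Measure.ext_of_charFunDual
  ext L
  rw [gPi_charFunDual, gPi_charFunDual]
  simp_rw [h]

end

section
open scoped BigOperators
open MeasureTheory

lemma sgn_measurable : Measurable sgn := by
  unfold sgn
  exact Measurable.ite measurableSet_Ici measurable_const measurable_const

lemma sgn_abs (t : ℝ) : |sgn t| = 1 := by
  unfold sgn; split_ifs <;> simp

lemma sgn_sq (t : ℝ) : sgn t * sgn t = 1 := by
  unfold sgn; split_ifs <;> simp

lemma gPi_sum_map {α β : Type} [Fintype α] [Fintype β] :
    ((gPi α).prod (gPi β)).map (fun p : (α → ℝ) × (β → ℝ) => (Sum.elim p.1 p.2 : α ⊕ β → ℝ))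
      = gPi (α ⊕ β) := by
  have := (measurePreserving_sumPiEquivProdPi (X := fun _ : α ⊕ β => ℝ)
    (fun _ => ProbabilityTheory.gaussianReal 0 1)).symm.map_eq
  unfold gPi
  rw [← this]
  congr 1

lemma integral_gPi_sum {α β : Type} [Fintype α] [Fintype β] (f : (α ⊕ β → ℝ) → ℝ)
    (hf : Measurable f) (C : ℝ) (hC : ∀ x, |f x| ≤ C) :
    ∫ z, f z ∂(gPi (α ⊕ β)) = ∫ x, ∫ y, f (Sum.elim x y) ∂(gPi β) ∂(gPi α) := by
  have hm : Measurable (fun p : (α → ℝ) × (β → ℝ) => (Sum.elim p.1 p.2 : α ⊕ β → ℝ)) := by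
    rw [measurable_pi_iff]
    rintro (i | i) <;> simp <;> fun_prop
  rw [← gPi_sum_map, integral_map hm.aemeasurable hf.aestronglyMeasurable]
  rw [integral_prod]
  refine Integrable.of_bound (hf.comp hm).aestronglyMeasurable C (ae_of_all _ fun p => ?_)
  exact hC _

/-- Smoothed sign. -/
noncomputable def phi (τ u : ℝ) : ℝ := ∫ g, sgn (u + τ * g) ∂(ProbabilityTheory.gaussianReal 0 1)

lemma phi_measurable (τ : ℝ) : Measurable (phi τ) := by
  unfold phi
  apply StronglyMeasurable.measurable
  apply StronglyMeasurable.integral_prod_right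
    (f := fun u g => sgn (u + τ * g))
  apply Measurable.stronglyMeasurable
  exact sgn_measurable.comp (by fun_prop)

lemma phi_abs_le (τ u : ℝ) : |phi τ u| ≤ 1 := by
  unfold phi
  have := norm_integral_le_of_norm_le_const (μ := ProbabilityTheory.gaussianReal 0 1)
    (f := fun g => sgn (u + τ * g)) (C := 1) (ae_of_all _ fun g => (sgn_abs _).le)
  simpa using this

lemma phi_zero (u : ℝ) : phi 0 u = sgn u := by
  simp [phi]

lemma prod_abs_le_one {κ : Type} (K : Finset κ) (f : κ → ℝ) (h : ∀ k, |f k| ≤ 1) :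
    |∏ k ∈ K, f k| ≤ 1 := by
  rw [Finset.abs_prod]
  exact Finset.prod_le_one (fun _ _ => abs_nonneg _) fun k _ => h k

/-- product integral over a subset of coordinates -/
lemma gPi_integral_prod {κ : Type} [Fintype κ] (K : Finset κ) (f : κ → ℝ → ℝ) :
    ∫ x, ∏ k ∈ K, f k (x k) ∂(gPi κ)
      = ∏ k ∈ K, ∫ g, f k g ∂(ProbabilityTheory.gaussianReal 0 1) := by
  classical
  have h := integral_fintype_prod_eq_prod (𝕜 := ℝ) (ι := κ)
    (μ := fun _ => ProbabilityTheory.gaussianReal 0 1)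
    (fun k (y : ℝ) => if k ∈ K then f k y else 1)
  have e1 : ∀ x : κ → ℝ, ∏ k, (if k ∈ K then f k (x k) else 1) = ∏ k ∈ K, f k (x k) := by
    intro x
    rw [Finset.prod_ite_mem, Finset.univ_inter]
  simp_rw [e1] at h
  unfold gPi
  rw [h]
  rw [← Finset.prod_subset (Finset.subset_univ K)]
  · refine Finset.prod_congr rfl fun k hk => by simp [hk]
  · intro k _ hk
    simp [hk]

/-- law comparison only on a subset of coordinates -/
lemma gPi_integral_law {ι ι' κ : Type} [Fintype ι] [Fintype ι'] [Fintype κ]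
    (K : Finset κ) (A : κ → ι → ℝ) (A' : κ → ι' → ℝ)
    (h : ∀ k ∈ K, ∀ l ∈ K, ∑ i, A k i * A l i = ∑ i, A' k i * A' l i)
    (f : κ → ℝ → ℝ) (hf : ∀ k, Measurable (f k)) :
    ∫ x, ∏ k ∈ K, f k (∑ i, A k i * x i) ∂(gPi ι)
      = ∫ x, ∏ k ∈ K, f k (∑ i, A' k i * x i) ∂(gPi ι') := by
  classical
  have key := gPi_map_eq (κ := {k // k ∈ K}) (fun k i => A k.1 i) (fun k i => A' k.1 i)
    (fun k l => h k.1 k.2 l.1 l.2)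
  have hm : Measurable (fun z : {k // k ∈ K} → ℝ => ∏ k, f k.1 (z k)) := by
    apply Finset.measurable_prod
    intro k _
    exact (hf k.1).comp (by fun_prop)
  have h1 := integral_map (μ := gPi ι) (φ := fun x (k : {k // k ∈ K}) => ∑ i, A k.1 i * x i)
    (f := fun z : {k // k ∈ K} → ℝ => ∏ k, f k.1 (z k))
    (Measurable.aemeasurable (by fun_prop)) hm.aestronglyMeasurable
  have h2 := integral_map (μ := gPi ι') (φ := fun x (k : {k // k ∈ K}) => ∑ i, A' k.1 i * x i)
    (f := fun z : {k // k ∈ K} → ℝ => ∏ k, f k.1 (z k))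
    (Measurable.aemeasurable (by fun_prop)) hm.aestronglyMeasurable
  rw [key] at h1
  rw [h1] at h2
  have e : ∀ (F : κ → ℝ), ∏ k : {k // k ∈ K}, F k.1 = ∏ k ∈ K, F k := by
    intro F
    exact Finset.prod_coe_sort K F
  calc _ = ∫ x, ∏ k : {k // k ∈ K}, f k.1 (∑ i, A k.1 i * x i) ∂(gPi ι) := by
        congr 1; ext x; exact (e fun k => f k (∑ i, A k i * x i)).symm
    _ = _ := h2
    _ = _ := by
        congr 1; ext x; exact (e fun k => f k (∑ i, A' k i * x i))

lemma gPi_integral_prod_sgn {ι ι' κ : Type} [Fintype ι] [Fintype ι'] [Fintype κ] [DecidableEq κ]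
    (K : Finset κ) (A : κ → ι → ℝ) (A' : κ → ι' → ℝ) (τ : κ → ℝ)
    (h : ∀ k ∈ K, ∀ l ∈ K, ∑ i, A k i * A l i =
      ∑ i, A' k i * A' l i + if k = l then τ k ^ 2 else 0) :
    ∫ x, ∏ k ∈ K, sgn (∑ i, A k i * x i) ∂(gPi ι)
      = ∫ w, ∏ k ∈ K, phi (τ k) (∑ i, A' k i * w i) ∂(gPi ι') := by
  have h1 := gPi_integral_law (ι := ι) (ι' := ι' ⊕ κ) K A
    (fun k => Sum.elim (A' k) (fun l => if k = l then τ k else 0)) (by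
      intro k hk l hl
      rw [h k hk l hl]
      simp only [Fintype.sum_sum_type, Sum.elim_inl, Sum.elim_inr]
      congr 1
      simp only [ite_mul, zero_mul, mul_ite, mul_zero]
      by_cases hkl : k = l
      · subst hkl; simp [sq]
      · simp [hkl]) (fun _ => sgn) (fun _ => sgn_measurable)
  rw [h1, integral_gPi_sum (C := 1)]
  · congr 1
    ext w
    simp only [Fintype.sum_sum_type, Sum.elim_inl, Sum.elim_inr, ite_mul, zero_mul,
      Finset.sum_ite_eq, Finset.mem_univ, if_true]
    rw [gPi_integral_prod K (fun k g => sgn (∑ i, A' k i * w i + τ k * g))]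
    rfl
  · apply Finset.measurable_prod
    intro k _
    exact sgn_measurable.comp (by fun_prop)
  · intro x
    exact prod_abs_le_one K _ fun k => (sgn_abs _).le

lemma integral_sgn : ∫ g, sgn g ∂(ProbabilityTheory.gaussianReal 0 1) = 0 := by
  have h1 : ∫ g, sgn g ∂(ProbabilityTheory.gaussianReal 0 1)
      = ∫ g, sgn (-g) ∂(ProbabilityTheory.gaussianReal 0 1) := by
    have := ProbabilityTheory.gaussianReal_map_neg (μ := 0) (v := 1)
    rw [neg_zero] at this
    conv_lhs => rw [← this]
    rw [integral_map (by fun_prop) sgn_measurable.aestronglyMeasurable]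
  have h2 : ∫ g, sgn (-g) ∂(ProbabilityTheory.gaussianReal 0 1)
      = ∫ g, - sgn g ∂(ProbabilityTheory.gaussianReal 0 1) := by
    apply integral_congr_ae
    have := ProbabilityTheory.nullSingletonClass_gaussianReal (μ := 0) (v := 1) one_ne_zero
    have h0 : ∀ᵐ g ∂(ProbabilityTheory.gaussianReal 0 1), g ≠ 0 := by
      simp [ae_iff]
    filter_upwards [h0] with g hg
    unfold sgn
    rcases lt_or_gt_of_ne hg with h | h
    · simp [h.le, not_le.mpr h]
    · simp [h.le, h]
  rw [integral_neg] at h2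
  linarith

lemma gauss_interval_le (a b : ℝ) (hab : a ≤ b) :
    (ProbabilityTheory.gaussianReal 0 1).real (Set.Icc a b) ≤ (b - a) / 2 := by
  have h := ProbabilityTheory.gaussianReal_apply_eq_integral 0 (v := 1) one_ne_zero (Set.Icc a b)
  rw [measureReal_def, h, ENNReal.toReal_ofReal
    (integral_nonneg fun x => ProbabilityTheory.gaussianPDFReal_nonneg _ _ _)]
  have hb : ∀ x, ProbabilityTheory.gaussianPDFReal 0 1 x ≤ 1 / 2 := by
    intro x
    unfold ProbabilityTheory.gaussianPDFReal
    have h1 : Real.exp (-(x - 0) ^ 2 / (2 * (1 : NNReal))) ≤ 1 := by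
      rw [Real.exp_le_one_iff]
      have : (0:ℝ) ≤ (x - 0) ^ 2 / (2 * (1 : NNReal)) := by positivity
      rw [neg_div]; linarith
    have h2 : (Real.sqrt (2 * Real.pi * (1 : NNReal)))⁻¹ ≤ 1 / 2 := by
      rw [one_div]
      apply inv_anti₀ (by norm_num)
      apply Real.le_sqrt_of_sq_le
      simp
      nlinarith [Real.pi_gt_three]
    calc _ ≤ (1/2 : ℝ) * 1 := by gcongr
      _ = _ := by ring
  calc ∫ x in Set.Icc a b, ProbabilityTheory.gaussianPDFReal 0 1 x
      ≤ ∫ x in Set.Icc a b, (1/2 : ℝ) := by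
        apply integral_mono
        · exact (ProbabilityTheory.integrable_gaussianPDFReal 0 1).restrict
        · simp
        · exact fun x => hb x
    _ = _ := by
      simp [hab]; ring

lemma phi_abs_le_lin (τ u : ℝ) (hτ : 0 < τ) : |phi τ u| ≤ |u| / τ := by
  set γ := ProbabilityTheory.gaussianReal 0 1
  have h0 : phi τ u = ∫ g, (sgn (u + τ * g) - sgn g) ∂γ := by
    rw [integral_sub, integral_sgn, sub_zero]; rfl
    · refine Integrable.of_bound (sgn_measurable.comp (by fun_prop)).aestronglyMeasurable 1
        (ae_of_all _ fun p => (sgn_abs _).le)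
    · refine Integrable.of_bound (sgn_measurable).aestronglyMeasurable 1
        (ae_of_all _ fun p => (sgn_abs _).le)
  have key : ∀ a b : ℝ, a ≤ b → b - a = |u| / τ →
      (∀ g, g ∉ Set.Icc a b → sgn (u + τ * g) = sgn g) → |phi τ u| ≤ |u| / τ := by
    intro a b hab hba hg
    rw [h0]
    have : ∀ g, ‖sgn (u + τ * g) - sgn g‖ ≤ (Set.Icc a b).indicator (fun _ => (2:ℝ)) g := by
      intro g
      by_cases hm : g ∈ Set.Icc a b
      · rw [Set.indicator_of_mem hm]
        rw [Real.norm_eq_abs]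
        have := abs_sub (sgn (u + τ * g)) (sgn g)
        rw [sgn_abs, sgn_abs] at this
        linarith
      · rw [Set.indicator_of_notMem hm, hg g hm]; simp
    have := norm_integral_le_of_norm_le (μ := γ) (f := fun g => sgn (u + τ * g) - sgn g)
      ((integrable_const (2:ℝ)).indicator (measurableSet_Icc (a := a) (b := b))) (ae_of_all _ this)
    rw [integral_indicator measurableSet_Icc] at this
    simp at this
    have h3 := gauss_interval_le a b hab
    have h4 : γ.real (Set.Icc a b) ≤ (b - a) / 2 := h3
    linarith
  rcases le_total 0 u with hu | hu
  · apply key (-(u/τ)) 0 (by simp; positivity) (by rw [abs_of_nonneg hu]; ring)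
    intro g hg
    simp only [Set.mem_Icc, not_and_or, not_le] at hg
    rcases hg with hg | hg
    · have : u + τ * g < 0 := by
        have := mul_lt_mul_of_pos_left hg hτ
        rw [mul_neg, mul_div_cancel₀ _ hτ.ne'] at this
        linarith
      have h5 : g < 0 := by
        have : 0 ≤ u / τ := by positivity
        linarith
      simp [sgn, not_le.mpr this, not_le.mpr h5]
    · have : 0 ≤ u + τ * g := by positivity
      simp [sgn, this, hg.le]
  · apply key 0 (-u/τ) (by apply div_nonneg <;> linarith) (by rw [abs_of_nonpos hu]; ring)
    intro g hg
    simp only [Set.mem_Icc, not_and_or, not_le] at hg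
    rcases hg with hg | hg
    · have : u + τ * g < 0 := by nlinarith
      simp [sgn, not_le.mpr this, not_le.mpr hg]
    · have h1 : 0 ≤ g := le_trans (by apply div_nonneg <;> linarith) hg.le
      have : 0 ≤ u + τ * g := by
        rw [div_lt_iff₀ hτ] at hg
        nlinarith
      simp [sgn, this, h1]

end

section
open scoped BigOperators
open MeasureTheory

/-- correlation coefficients of the sign pattern of `(x, Uᵀ x)` -/
noncomputable def GG {N : ℕ} (U : Fin N → Fin N → ℝ) (S T : Finset (Fin N)) : ℝ :=
  ∫ x, (∏ i ∈ S, sgn (x i)) * (∏ j ∈ T, sgn (∑ l, U l j * x l)) ∂(gPi (Fin N))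

noncomputable def theta (s : ℝ) : ℝ :=
  ∫ g, phi (Real.sqrt (1 - s)) (Real.sqrt s * g) ^ 2 ∂(ProbabilityTheory.gaussianReal 0 1)

lemma theta_nonneg (s : ℝ) : 0 ≤ theta s := integral_nonneg fun _ => sq_nonneg _

lemma integrable_of_bdd {Ω : Type} [MeasurableSpace Ω] {μ : Measure Ω} [IsFiniteMeasure μ]
    {f : Ω → ℝ} (hf : Measurable f) (C : ℝ) (h : ∀ x, |f x| ≤ C) : Integrable f μ :=
  Integrable.of_bound hf.aestronglyMeasurable C (ae_of_all _ h)

lemma theta_le_one (s : ℝ) : theta s ≤ 1 := by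
  unfold theta
  calc _ ≤ ∫ g, (1:ℝ) ∂(ProbabilityTheory.gaussianReal 0 1) := by
        apply integral_mono_of_nonneg (ae_of_all _ fun _ => sq_nonneg _) (integrable_const _)
        refine ae_of_all _ fun g => ?_
        have := phi_abs_le (Real.sqrt (1 - s)) (Real.sqrt s * g)
        exact (sq_le_one_iff_abs_le_one _).mpr this
    _ = 1 := by simp

lemma integral_sq_gauss : ∫ g, g ^ 2 ∂(ProbabilityTheory.gaussianReal 0 1) = 1 := by
  have h := ProbabilityTheory.variance_id_gaussianReal (μ := 0) (v := 1)
  rw [ProbabilityTheory.variance_eq_integral (by fun_prop)] at h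
  simpa using h

lemma integrable_sq_gauss : Integrable (fun g : ℝ => g ^ 2) (ProbabilityTheory.gaussianReal 0 1) := by
  have := ProbabilityTheory.memLp_id_gaussianReal' (μ := 0) (v := 1) 2 (by simp)
  exact this.integrable_sq

lemma theta_le (s : ℝ) (h0 : 0 ≤ s) : theta s ≤ 2 * s := by
  rcases le_or_gt (1/2) s with h | h
  · linarith [theta_le_one s]
  · unfold theta
    have hp : 0 < Real.sqrt (1 - s) := Real.sqrt_pos.mpr (by linarith)
    calc _ ≤ ∫ g, (2 * s) * g ^ 2 ∂(ProbabilityTheory.gaussianReal 0 1) := by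
          apply integral_mono_of_nonneg (ae_of_all _ fun _ => sq_nonneg _)
            (integrable_sq_gauss.const_mul _)
          refine ae_of_all _ fun g => ?_
          have h1 := phi_abs_le_lin (Real.sqrt (1 - s)) (Real.sqrt s * g) hp
          have h2 := pow_le_pow_left₀ (abs_nonneg _) h1 2
          rw [sq_abs, div_pow, sq_abs, mul_pow, Real.sq_sqrt h0,
            Real.sq_sqrt (by linarith)] at h2
          refine h2.trans ?_
          rw [div_le_iff₀ (by linarith)]
          nlinarith [mul_nonneg h0 (sq_nonneg g), mul_nonneg (mul_nonneg h0 (sq_nonneg g)) (by linarith : 0 ≤ 1/2 - s)]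
      _ = 2 * s := by
          rw [integral_const_mul, integral_sq_gauss, mul_one]

lemma integral_phi (s : ℝ) (h0 : 0 ≤ s) (h1 : s ≤ 1) :
    ∫ g, phi (Real.sqrt (1 - s)) (Real.sqrt s * g) ∂(ProbabilityTheory.gaussianReal 0 1) = 0 := by
  have h := gPi_integral_prod_sgn (ι := Unit) (ι' := Unit) (κ := Unit) Finset.univ
    (fun _ _ => 1) (fun _ _ => Real.sqrt s) (fun _ => Real.sqrt (1 - s)) (by
      intro k _ l _
      simp [← sq, Real.sq_sqrt h0, Real.sq_sqrt (by linarith : (0:ℝ) ≤ 1 - s)])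
  have e1 := gPi_integral_prod (κ := Unit) Finset.univ (fun _ => sgn)
  have e2 := gPi_integral_prod (κ := Unit) Finset.univ
    (fun _ g => phi (Real.sqrt (1 - s)) (Real.sqrt s * g))
  simp only [Finset.univ_unique, PUnit.default_eq_unit, Finset.prod_singleton,
    Finset.sum_singleton, one_mul] at h e1 e2
  rw [← e2, ← h, e1, integral_sgn]

lemma phi_orth {ι κ : Type} [Fintype ι] [Fintype κ] [DecidableEq κ] (s : ℝ) (h0 : 0 ≤ s) (h1 : s ≤ 1)
    (K : Finset κ) (A : κ → ι → ℝ)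
    (h : ∀ k ∈ K, ∀ l ∈ K, ∑ i, A k i * A l i = if k = l then s else 0)
    (S S' : Finset κ) (hS : S ⊆ K) (hS' : S' ⊆ K) :
    ∫ w, (∏ k ∈ S, phi (Real.sqrt (1 - s)) (∑ i, A k i * w i)) *
      (∏ k ∈ S', phi (Real.sqrt (1 - s)) (∑ i, A k i * w i)) ∂(gPi ι) =
      if S = S' then theta s ^ S.card else 0 := by
  set f : κ → ℝ → ℝ := fun k u => (if k ∈ S then phi (Real.sqrt (1 - s)) u else 1) *
    (if k ∈ S' then phi (Real.sqrt (1 - s)) u else 1) with hf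
  have hfm : ∀ k, Measurable (f k) := by
    intro k
    simp only [hf]
    by_cases a : k ∈ S <;> by_cases b : k ∈ S' <;> simp [a, b] <;>
      first | exact (phi_measurable _).mul (phi_measurable _) | exact phi_measurable _
  have e : ∀ F : κ → ℝ, ∏ k ∈ K, ((if k ∈ S then F k else 1) * (if k ∈ S' then F k else 1)) =
      (∏ k ∈ S, F k) * ∏ k ∈ S', F k := by
    intro F
    rw [Finset.prod_mul_distrib, Finset.prod_ite_mem, Finset.prod_ite_mem,
      Finset.inter_eq_right.mpr hS, Finset.inter_eq_right.mpr hS']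
  have hl := gPi_integral_law (ι := ι) (ι' := κ) K A (fun k l => if k = l then Real.sqrt s else 0)
    (by
      intro k hk l hl
      rw [h k hk l hl]
      simp only [ite_mul, zero_mul, mul_ite, mul_zero]
      by_cases hkl : k = l
      · subst hkl; simp [← sq, Real.sq_sqrt h0]
      · simp [hkl]) f hfm
  simp only [hf] at hl
  simp_rw [e] at hl
  rw [hl]
  simp only [ite_mul, zero_mul, Finset.sum_ite_eq, Finset.mem_univ, if_true]
  have hp := gPi_integral_prod (κ := κ) K (fun k g => f k (Real.sqrt s * g))
  simp only [hf] at hp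
  simp_rw [e] at hp
  rw [hp]
  split_ifs with hSS
  · subst hSS
    rw [← Finset.prod_subset hS]
    · rw [Finset.prod_congr rfl (g := fun _ => theta s)]
      · simp
      · intro k hk
        simp [hk, theta, sq]
    · intro k _ hk
      simp [hk]
  · have : ∃ k, ¬ (k ∈ S ↔ k ∈ S') := by
      by_contra hcon
      push Not at hcon
      exact hSS (Finset.ext hcon)
    obtain ⟨k, hk⟩ := this
    have hkK : k ∈ K := by
      by_contra hc
      exact hk ⟨fun h => absurd (hS h) hc, fun h => absurd (hS' h) hc⟩
    apply Finset.prod_eq_zero hkK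
    by_cases a : k ∈ S
    · have b : k ∉ S' := fun b => hk ⟨fun _ => b, fun _ => a⟩
      simp [a, b, integral_phi s h0 h1]
    · have b : k ∈ S' := by tauto
      simp [a, b, integral_phi s h0 h1]

lemma phi_norm {ι κ : Type} [Fintype ι] [Fintype κ] [DecidableEq κ] (s : ℝ) (h0 : 0 ≤ s) (h1 : s ≤ 1)
    (K : Finset κ) (A : κ → ι → ℝ)
    (h : ∀ k ∈ K, ∀ l ∈ K, ∑ i, A k i * A l i = if k = l then s else 0)
    (x : Finset κ → ℝ) (hx : ∀ S, ¬ S ⊆ K → x S = 0) :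
    ∫ w, (∑ S, x S * ∏ k ∈ S, phi (Real.sqrt (1 - s)) (∑ i, A k i * w i)) ^ 2 ∂(gPi ι) =
      ∑ S, theta s ^ S.card * x S ^ 2 := by
  have hm : ∀ S : Finset κ, Measurable
      (fun w : ι → ℝ => ∏ k ∈ S, phi (Real.sqrt (1 - s)) (∑ i, A k i * w i)) := by
    intro S
    apply Finset.measurable_prod
    intro k _
    exact (phi_measurable _).comp (by fun_prop)
  have hb : ∀ (S : Finset κ) (w : ι → ℝ),
      |∏ k ∈ S, phi (Real.sqrt (1 - s)) (∑ i, A k i * w i)| ≤ 1 :=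
    fun S w => prod_abs_le_one _ _ fun k => phi_abs_le _ _
  have e : ∀ w : ι → ℝ, (∑ S, x S * ∏ k ∈ S, phi (Real.sqrt (1 - s)) (∑ i, A k i * w i)) ^ 2 =
      ∑ S, ∑ S', (x S * x S') * ((∏ k ∈ S, phi (Real.sqrt (1 - s)) (∑ i, A k i * w i)) *
        ∏ k ∈ S', phi (Real.sqrt (1 - s)) (∑ i, A k i * w i)) := by
    intro w
    rw [sq, Finset.sum_mul_sum]
    refine Finset.sum_congr rfl fun S _ => Finset.sum_congr rfl fun S' _ => by ring
  simp_rw [e]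
  have hi : ∀ S S' : Finset κ, Integrable (fun w : ι → ℝ =>
      (x S * x S') * ((∏ k ∈ S, phi (Real.sqrt (1 - s)) (∑ i, A k i * w i)) *
        ∏ k ∈ S', phi (Real.sqrt (1 - s)) (∑ i, A k i * w i))) (gPi ι) := by
    intro S S'
    apply Integrable.const_mul
    apply integrable_of_bdd ((hm S).mul (hm S')) 1
    intro w
    rw [Pi.mul_apply, abs_mul]
    exact mul_le_one₀ (hb S w) (abs_nonneg _) (hb S' w)
  rw [integral_finsetSum _ fun S _ => integrable_finsetSum _ fun S' _ => hi S S']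
  refine Finset.sum_congr rfl fun S _ => ?_
  rw [integral_finsetSum _ fun S' _ => hi S S']
  rw [Finset.sum_eq_single S]
  · rw [integral_const_mul]
    by_cases hS : S ⊆ K
    · rw [phi_orth s h0 h1 K A h S S hS hS]; simp; ring
    · rw [hx S hS]; simp
  · intro S' _ hne
    rw [integral_const_mul]
    by_cases hS : S ⊆ K
    · by_cases hS' : S' ⊆ K
      · rw [phi_orth s h0 h1 K A h S S' hS hS', if_neg (Ne.symm hne), mul_zero]
      · rw [hx S' hS']; simp
    · rw [hx S hS]; simp
  · simp

end

section
open scoped BigOperators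
open MeasureTheory

lemma exists_psd_root {ι : Type} [Fintype ι] [DecidableEq ι] (M : Matrix ι ι ℝ)
    (hs : ∀ i j, M i j = M j i) (hp : ∀ y : ι → ℝ, 0 ≤ ∑ i, ∑ j, y i * M i j * y j) :
    ∃ Q : ι → ι → ℝ, ∀ i j, ∑ l, Q i l * Q j l = M i j := by
  have h : M.PosSemidef := by
    rw [Matrix.posSemidef_iff_dotProduct_mulVec]
    refine ⟨?_, ?_⟩
    · ext i j
      simp [Matrix.conjTranspose_apply, hs i j]
    · intro y
      have := hp y
      simp only [dotProduct, Matrix.mulVec, star_trivial, Finset.mul_sum]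
      simpa only [mul_assoc] using this
  obtain ⟨a, ha⟩ : ∃ a : Matrix ι ι ℝ, M = Matrix.conjTranspose a * a := by
    open scoped MatrixOrder ComplexOrder in
    obtain ⟨a, rfl⟩ := CStarAlgebra.nonneg_iff_eq_star_mul_self.mp h.nonneg
    exact ⟨a, rfl⟩
  refine ⟨fun i l => a l i, fun i j => ?_⟩
  rw [ha]
  simp [Matrix.mul_apply]

lemma coupling {N : ℕ} (U : Fin N → Fin N → ℝ) (T1 T2 : Finset (Fin N)) (s t : ℝ)
    (hs : 0 < s) 
    (hB : ∀ y : Fin N → ℝ, ∑ i ∈ T1, (∑ j ∈ T2, U i j * y j) ^ 2 ≤ s * t * ∑ j ∈ T2, y j ^ 2) :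
    ∃ Q : Fin N → Fin N → ℝ, ∀ j ∈ T2, ∀ l ∈ T2,
      (∑ i ∈ T1, (U i j / Real.sqrt s) * (U i l / Real.sqrt s)) + ∑ m, Q j m * Q l m
        = if j = l then t else 0 := by
  obtain ⟨Q, hQ⟩ := exists_psd_root (ι := Fin N)
    (Matrix.of fun j l => if j ∈ T2 then if l ∈ T2 then (if j = l then t else 0) -
      ∑ i ∈ T1, U i j * U i l / s else 0 else 0) (by
      intro j l
      simp only [Matrix.of_apply]
      by_cases hj : j ∈ T2 <;> by_cases hl : l ∈ T2 <;> simp only [hj, hl, if_true, if_false]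
      rw [Finset.sum_congr rfl fun i _ => by rw [mul_comm (U i j)]]
      simp only [eq_comm]) (by
      intro y
      have h := hB y
      simp only [Matrix.of_apply]
      have e : ∑ i, ∑ j, y i * (if i ∈ T2 then if j ∈ T2 then (if i = j then t else 0) -
          ∑ a ∈ T1, U a i * U a j / s else 0 else 0) * y j =
          ∑ i ∈ T2, ∑ j ∈ T2, y i * ((if i = j then t else 0) -
          ∑ a ∈ T1, U a i * U a j / s) * y j := by
        rw [← Finset.sum_subset (Finset.subset_univ T2)]
        · refine Finset.sum_congr rfl fun i hi => ?_
          rw [← Finset.sum_subset (Finset.subset_univ T2)]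
          · refine Finset.sum_congr rfl fun j hj => by simp [hi, hj]
          · intro j _ hj; simp [hj]
        · intro j _ hj; simp [hj]
      rw [e]
      have e2 : ∑ i ∈ T2, ∑ j ∈ T2, y i * ((if i = j then t else 0) -
          ∑ a ∈ T1, U a i * U a j / s) * y j = t * ∑ j ∈ T2, y j ^ 2 -
          (∑ i ∈ T1, (∑ j ∈ T2, U i j * y j) ^ 2) / s := by
        simp_rw [mul_sub, sub_mul, Finset.sum_sub_distrib]
        congr 1
        · rw [Finset.mul_sum]
          refine Finset.sum_congr rfl fun i hi => ?_
          simp [hi]; ring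
        · rw [Finset.sum_div]
          simp_rw [sq, Finset.sum_mul_sum, Finset.mul_sum, Finset.sum_mul, Finset.sum_div]
          rw [Finset.sum_comm]
          rw [Finset.sum_congr rfl fun i _ => Finset.sum_comm]
          rw [Finset.sum_comm]
          refine Finset.sum_congr rfl fun a _ => ?_
          rw [Finset.sum_comm]
          refine Finset.sum_congr rfl fun i _ => Finset.sum_congr rfl fun j _ => by ring
      rw [e2, sub_nonneg, div_le_iff₀ hs]
      linarith)
  refine ⟨Q, fun j hj l hl => ?_⟩
  rw [hQ]
  simp only [Matrix.of_apply, hj, hl, if_true]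
  have : ∀ i, (U i j / Real.sqrt s) * (U i l / Real.sqrt s) = U i j * U i l / s := by
    intro i
    rw [div_mul_div_comm, Real.mul_self_sqrt hs.le]
  simp_rw [this]
  ring

lemma lemmaA {N : ℕ} (U : Fin N → Fin N → ℝ) (hU : IsOrthogonal U) (T1 T2 : Finset (Fin N))
    (s t : ℝ) (hs : 0 < s) (hs1 : s ≤ 1) (ht : 0 < t) (ht1 : t ≤ 1)
    (hB : ∀ y : Fin N → ℝ, ∑ i ∈ T1, (∑ j ∈ T2, U i j * y j) ^ 2 ≤ s * t * ∑ j ∈ T2, y j ^ 2)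
    (x y : Finset (Fin N) → ℝ) (hx : ∀ S, ¬ S ⊆ T1 → x S = 0) (hy : ∀ S, ¬ S ⊆ T2 → y S = 0) :
    |∑ S, ∑ T, x S * GG U S T * y T| ≤ Real.sqrt (∑ S, theta s ^ S.card * x S ^ 2) *
      Real.sqrt (∑ S, theta t ^ S.card * y S ^ 2) := by
  obtain ⟨Q, hQ⟩ := coupling U T1 T2 s t hs hB
  set P : Fin N → (Fin N ⊕ Fin N) → ℝ := fun i =>
    Sum.elim (fun l => if i = l then Real.sqrt s else 0) (fun _ => 0) with hP
  set R : Fin N → (Fin N ⊕ Fin N) → ℝ := fun j =>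
    Sum.elim (fun i => if i ∈ T1 then U i j / Real.sqrt s else 0) (Q j) with hR
  have hss : 0 < Real.sqrt s := Real.sqrt_pos.mpr hs
  have hPP : ∀ i i', ∑ w, P i w * P i' w = if i = i' then s else 0 := by
    intro i i'
    simp only [hP, Fintype.sum_sum_type, Sum.elim_inl, Sum.elim_inr, mul_zero, ite_mul,
      zero_mul, mul_ite]
    by_cases h : i = i'
    · subst h; simp [← sq, Real.sq_sqrt hs.le]
    · simp [h]
  have hPR : ∀ i ∈ T1, ∀ j, ∑ w, P i w * R j w = U i j := by
    intro i hi j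
    simp only [hP, hR, Fintype.sum_sum_type, Sum.elim_inl, Sum.elim_inr, zero_mul, ite_mul]
    simp [hi]
    field_simp
  have hRR : ∀ j ∈ T2, ∀ l ∈ T2, ∑ w, R j w * R l w = if j = l then t else 0 := by
    intro j hj l hl
    rw [← hQ j hj l hl]
    simp only [hR, Fintype.sum_sum_type, Sum.elim_inl, Sum.elim_inr, ite_mul, zero_mul, mul_ite, mul_zero]
    congr 1
    simp
  set p : Finset (Fin N) → (Fin N ⊕ Fin N → ℝ) → ℝ := fun S w =>
    ∏ i ∈ S, phi (Real.sqrt (1 - s)) (∑ z, P i z * w z) with hp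
  set q : Finset (Fin N) → (Fin N ⊕ Fin N → ℝ) → ℝ := fun S w =>
    ∏ i ∈ S, phi (Real.sqrt (1 - t)) (∑ z, R i z * w z) with hq
  have hpm : ∀ S, Measurable (p S) := by
    intro S
    apply Finset.measurable_prod
    intro k _
    exact (phi_measurable _).comp (by fun_prop)
  have hqm : ∀ S, Measurable (q S) := by
    intro S
    apply Finset.measurable_prod
    intro k _
    exact (phi_measurable _).comp (by fun_prop)
  have hpb : ∀ S w, |p S w| ≤ 1 := fun S w => prod_abs_le_one _ _ fun k => phi_abs_le _ _
  have hqb : ∀ S w, |q S w| ≤ 1 := fun S w => prod_abs_le_one _ _ fun k => phi_abs_le _ _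
  have hG : ∀ S T, S ⊆ T1 → T ⊆ T2 → GG U S T = ∫ w, p S w * q T w ∂(gPi (Fin N ⊕ Fin N)) := by
    intro S T hS hT
    have h := gPi_integral_prod_sgn (ι := Fin N) (ι' := Fin N ⊕ Fin N) (κ := Fin N ⊕ Fin N)
      (S.disjSum T)
      (Sum.elim (fun i l => if i = l then 1 else 0) (fun j l => U l j))
      (Sum.elim P R)
      (Sum.elim (fun _ => Real.sqrt (1 - s)) (fun _ => Real.sqrt (1 - t))) (by
        rintro (i | i) hk (j | j) hl
        · simp only [Sum.elim_inl, hPP, Sum.inl.injEq, ite_mul, mul_ite, zero_mul, mul_zero, one_mul]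
          rw [Real.sq_sqrt (by linarith)]
          by_cases h : i = j
          · simp [h]
          · simp [h]
        · simp only [Sum.elim_inl, Sum.elim_inr]
          rw [hPR i (hS (by simpa using hk))]
          simp
        · simp only [Sum.elim_inl, Sum.elim_inr]
          rw [Finset.sum_congr rfl fun z _ => mul_comm (R i z) (P j z)]
          rw [hPR j (hS (by simpa using hl))]
          simp
        · simp only [Sum.elim_inr, Sum.inr.injEq]
          rw [hRR i (hT (by simpa using hk)) j (hT (by simpa using hl)), hU.1,
            Real.sq_sqrt (by linarith)]
          by_cases h : i = j
          · simp [h]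
          · simp [h])
    simp only [Finset.prod_disjSum, Sum.elim_inl, Sum.elim_inr, ite_mul, one_mul, zero_mul,
      Finset.sum_ite_eq, Finset.mem_univ, if_true] at h
    unfold GG
    rw [h]
  have hInt : ∀ S T, Integrable (fun w => (x S * p S w) * (y T * q T w)) (gPi (Fin N ⊕ Fin N)) := by
    intro S T
    apply integrable_of_bdd (((hpm S).const_mul _).mul ((hqm T).const_mul _)) (|x S| * |y T|)
    intro w
    rw [Pi.mul_apply, abs_mul, abs_mul, abs_mul]
    exact mul_le_mul (mul_le_of_le_one_right (abs_nonneg _) (hpb S w))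
      (mul_le_of_le_one_right (abs_nonneg _) (hqb T w)) (by positivity) (abs_nonneg _)
  have hmain : ∑ S, ∑ T, x S * GG U S T * y T =
      ∫ w, (∑ S, x S * p S w) * (∑ T, y T * q T w) ∂(gPi (Fin N ⊕ Fin N)) := by
    simp_rw [Finset.sum_mul_sum]
    rw [integral_finsetSum _ fun S _ => integrable_finsetSum _ fun T _ => hInt S T]
    refine Finset.sum_congr rfl fun S _ => ?_
    rw [integral_finsetSum _ fun T _ => hInt S T]
    refine Finset.sum_congr rfl fun T _ => ?_
    by_cases hS : S ⊆ T1
    · by_cases hT : T ⊆ T2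
      · rw [hG S T hS hT, ← integral_const_mul, ← integral_mul_const]
        congr 1; ext w; ring
      · simp [hy T hT]
    · simp [hx S hS]
  rw [hmain]
  rw [← phi_norm s hs.le hs1 T1 P (fun k _ l _ => hPP k l) x hx,
    ← phi_norm t ht.le ht1 T2 R hRR y hy]
  have hb : ∀ (z : Finset (Fin N) → ℝ) (r : Finset (Fin N) → (Fin N ⊕ Fin N → ℝ) → ℝ),
      (∀ S w, |r S w| ≤ 1) → ∀ w, |∑ S, z S * r S w| ≤ ∑ S, |z S| := by
    intro z r h w
    refine (Finset.abs_sum_le_sum_abs _ _).trans (Finset.sum_le_sum fun S _ => ?_)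
    rw [abs_mul]
    exact mul_le_of_le_one_right (abs_nonneg _) (h S w)
  have hmf : Measurable (fun w => ∑ S, x S * p S w) :=
    Finset.measurable_sum _ fun S _ => (hpm S).const_mul _
  have hmg : Measurable (fun w => ∑ S, y S * q S w) :=
    Finset.measurable_sum _ fun S _ => (hqm S).const_mul _
  have hcs := integral_mul_le_Lp_mul_Lq_of_nonneg (μ := gPi (Fin N ⊕ Fin N))
    (p := 2) (q := 2) Real.HolderConjugate.two_two
    (f := fun w => |∑ S, x S * p S w|) (g := fun w => |∑ T, y T * q T w|)
    (ae_of_all _ fun _ => abs_nonneg _) (ae_of_all _ fun _ => abs_nonneg _)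
    (MemLp.of_bound hmf.abs.aestronglyMeasurable (∑ S, |x S|)
      (ae_of_all _ fun w => by rw [Real.norm_eq_abs, abs_abs]; exact hb x p hpb w))
    (MemLp.of_bound hmg.abs.aestronglyMeasurable (∑ S, |y S|)
      (ae_of_all _ fun w => by rw [Real.norm_eq_abs, abs_abs]; exact hb y q hqb w))
  refine (abs_integral_le_integral_abs).trans ?_
  simp_rw [abs_mul]
  refine hcs.trans (le_of_eq ?_)
  simp only [← Real.sqrt_eq_rpow, Real.rpow_two, sq_abs]
  rfl

end

section
open scoped BigOperators
open MeasureTheory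

lemma choose_two_mul_le (n i : ℕ) : (2 * n).choose (2 * i) ≤ n.choose i * (2 * n - 1) ^ i := by
  induction i with
  | zero => simp
  | succ i ih =>
    rcases Nat.lt_or_ge i n with hin | hin
    · have h1 := Nat.choose_succ_right_eq (2 * n) (2 * i)
      have h2 := Nat.choose_succ_right_eq (2 * n) (2 * i + 1)
      have h3 := Nat.choose_succ_right_eq n i
      obtain ⟨m, rfl⟩ : ∃ m, n = i + 1 + m := ⟨n - (i + 1), by omega⟩
      have e1 : 2 * (i + 1 + m) - 2 * i = 2 * (m + 1) := by omega
      have e2 : 2 * (i + 1 + m) - (2 * i + 1) = 2 * m + 1 := by omega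
      have e3 : (i + 1 + m) - i = m + 1 := by omega
      have e4 : 2 * (i + 1 + m) - 1 = 2 * i + 2 * m + 1 := by omega
      rw [e1] at h1; rw [e2] at h2; rw [e3] at h3; rw [e4] at ih ⊢
      rw [show 2 * (i + 1) = 2 * i + 1 + 1 by ring] at *
      set X := (2 * i + 1 + 1 + 2 * m) 
      have hX : 2 * (i + 1 + m) = X := by simp only [X]; ring
      set a := (2 * (i+1+m)).choose (2 * i)
      set b := (2 * (i+1+m)).choose (2 * i + 1)
      set c := (2 * (i+1+m)).choose (2 * i + 1 + 1)
      set p := (i+1+m).choose i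
      set q := (i+1+m).choose (i+1)
      set w := (2 * i + 2 * m + 1) ^ i
      rw [pow_succ]
      have h4 : c * (2 * i + 1 + 1) * (2 * i + 1) = a * (2 * (m + 1)) * (2 * m + 1) := by
        rw [h2, ← h1]; ring
      have h5 : a * (2 * (m + 1)) * (2 * m + 1) ≤ p * w * (2 * (m + 1)) * (2 * m + 1) := by
        gcongr
      have h6 : p * w * (2 * (m + 1)) * (2 * m + 1) = q * w * (2 * i + 2) * (2 * m + 1) := by
        have : p * w * (2 * (m + 1)) * (2 * m + 1) = (p * (m+1)) * w * 2 * (2 * m + 1) := by ring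
        rw [this, ← h3]; ring
      have h7 : q * w * (2 * i + 2) * (2 * m + 1) ≤
          q * w * (2 * i + 2) * ((2 * i + 2 * m + 1) * (2 * i + 1)) := by
        apply Nat.mul_le_mul_left
        nlinarith
      have h8 : c * ((2 * i + 2) * (2 * i + 1)) ≤
          (q * (w * (2 * i + 2 * m + 1))) * ((2 * i + 2) * (2 * i + 1)) := by
        calc c * ((2 * i + 2) * (2 * i + 1)) = c * (2 * i + 1 + 1) * (2 * i + 1) := by ring
          _ ≤ q * w * (2 * i + 2) * ((2 * i + 2 * m + 1) * (2 * i + 1)) := by omega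
          _ = _ := by ring
      exact Nat.le_of_mul_le_mul_right h8 (by positivity)
    · rw [Nat.choose_eq_zero_of_lt (by omega)]; simp

lemma sum_range_even_odd (f : ℕ → ℝ) (n : ℕ) :
    ∑ j ∈ Finset.range (2 * n + 1), f j =
      ∑ i ∈ Finset.range (n + 1), f (2 * i) + ∑ i ∈ Finset.range n, f (2 * i + 1) := by
  induction n with
  | zero => simp
  | succ n ih =>
    rw [show 2 * (n + 1) + 1 = 2 * n + 1 + 1 + 1 by ring, Finset.sum_range_succ,
      Finset.sum_range_succ, ih, Finset.sum_range_succ (fun i => f (2 * i)) (n + 1),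
      Finset.sum_range_succ (fun i => f (2 * i + 1)) n]
    rw [show 2 * (n + 1) = 2 * n + 1 + 1 by ring]
    ring

lemma two_point (a b η : ℝ) (n : ℕ) (hn : 1 ≤ n) (h : η ^ 2 * (2 * n - 1) ≤ 1) :
    (a + η * b) ^ (2 * n) + (a - η * b) ^ (2 * n) ≤ 2 * (a ^ 2 + b ^ 2) ^ n := by
  have e1 : (a + η * b) ^ (2 * n) + (a - η * b) ^ (2 * n) =
      2 * ∑ i ∈ Finset.range (n + 1), (b ^ 2) ^ i * (a ^ 2) ^ (n - i) *
        ((η ^ 2) ^ i * (2 * n).choose (2 * i)) := by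
    rw [show a + η * b = η * b + a by ring, show a - η * b = -(η * b) + a by ring, add_pow, add_pow,
      ← Finset.sum_add_distrib, sum_range_even_odd, Finset.mul_sum]
    have : ∑ i ∈ Finset.range n, ((η * b) ^ (2 * i + 1) * a ^ (2 * n - (2 * i + 1)) * ((2 * n).choose (2 * i + 1) : ℝ) + (-(η * b)) ^ (2 * i + 1) * a ^ (2 * n - (2 * i + 1)) * ((2 * n).choose (2 * i + 1) : ℝ)) = 0 := by
      apply Finset.sum_eq_zero
      intro i _
      rw [Odd.neg_pow ⟨i, rfl⟩]; ring
    rw [this, add_zero]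
    refine Finset.sum_congr rfl fun i _ => ?_
    rw [Even.neg_pow ⟨i, by ring⟩, show 2 * n - 2 * i = 2 * (n - i) by omega, ← pow_mul a, ← pow_mul b,
      ← pow_mul η, mul_pow]
    ring
  rw [e1, show a ^ 2 + b ^ 2 = b ^ 2 + a ^ 2 by ring, add_pow]
  gcongr with i hi
  have h1 : ((2 * n).choose (2 * i) : ℝ) ≤ n.choose i * (2 * n - 1) ^ i := by
    have := choose_two_mul_le n i
    have h2 : ((2 * n - 1 : ℕ) : ℝ) = 2 * n - 1 := by
      rw [Nat.cast_sub (by omega)]; push_cast; ring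
    rw [← h2]
    exact_mod_cast this
  calc (η ^ 2) ^ i * ((2 * n).choose (2 * i) : ℝ) ≤ (η ^ 2) ^ i * (n.choose i * (2 * n - 1) ^ i) := by gcongr
    _ = (n.choose i : ℝ) * (η ^ 2 * (2 * n - 1)) ^ i := by rw [mul_pow]; ring
    _ ≤ (n.choose i : ℝ) * 1 := by
        gcongr
        apply pow_le_one₀ _ h
        have : (1:ℝ) ≤ n := by exact_mod_cast hn
        apply mul_nonneg (sq_nonneg _); linarith
    _ = _ := by ring

/-- value of a Boolean as a sign -/
noncomputable def sg (b : Bool) : ℝ := if b then 1 else -1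

noncomputable def chiB {ι : Type} (S : Finset ι) (w : ι → Bool) : ℝ := ∏ i ∈ S, sg (w i)

def flipAt {ι : Type} [DecidableEq ι] (a : ι) : Equiv.Perm (ι → Bool) where
  toFun w := Function.update w a (!w a)
  invFun w := Function.update w a (!w a)
  left_inv w := by simp
  right_inv w := by simp

lemma chiB_flip_notMem {ι : Type} [DecidableEq ι] (a : ι) (S : Finset ι) (h : a ∉ S) (w : ι → Bool) :
    chiB S (flipAt a w) = chiB S w := by
  unfold chiB flipAt
  refine Finset.prod_congr rfl fun i hi => ?_
  have : i ≠ a := fun e => h (e ▸ hi)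
  simp [this]

lemma sg_not (b : Bool) : sg (!b) = - sg b := by cases b <;> simp [sg]
lemma sg_sq (b : Bool) : sg b * sg b = 1 := by cases b <;> simp [sg]

lemma chiB_insert {ι : Type} [DecidableEq ι] (a : ι) (S : Finset ι) (h : a ∉ S) (w : ι → Bool) :
    chiB (insert a S) w = sg (w a) * chiB S w := by
  unfold chiB
  rw [Finset.prod_insert h]

lemma sum_powerset_insert' {ι : Type} [DecidableEq ι] (a : ι) (J : Finset ι) (h : a ∉ J)
    (f : Finset ι → ℝ) : ∑ S ∈ (insert a J).powerset, f S =
      ∑ S ∈ J.powerset, f S + ∑ S ∈ J.powerset, f (insert a S) :=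
  Finset.sum_powerset_insert h f

lemma hyperc {ι : Type} [Fintype ι] [DecidableEq ι] (η : ℝ) (n : ℕ) (hn : 1 ≤ n)
    (h : η ^ 2 * (2 * n - 1) ≤ 1) (J : Finset ι) :
    ∀ c : Finset ι → ℝ,
    ∑ w : ι → Bool, (∑ S ∈ J.powerset, η ^ S.card * c S * chiB S w) ^ (2 * n) ≤
      2 ^ Fintype.card ι * (∑ S ∈ J.powerset, c S ^ 2) ^ n := by
  induction J using Finset.induction_on with
  | empty =>
    intro c
    simp [chiB, pow_mul]
  | insert a J ha ih =>
    intro c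
    set f0 : (ι → Bool) → ℝ := fun w => ∑ S ∈ J.powerset, η ^ S.card * c S * chiB S w with hf0
    set f1 : (ι → Bool) → ℝ := fun w => ∑ S ∈ J.powerset, η ^ S.card * c (insert a S) * chiB S w with hf1
    have hna : ∀ S ∈ J.powerset, a ∉ S := fun S hS hS' => ha (Finset.mem_powerset.mp hS hS')
    have hF : ∀ w, ∑ S ∈ (insert a J).powerset, η ^ S.card * c S * chiB S w =
        f0 w + η * (sg (w a) * f1 w) := by
      intro w
      rw [sum_powerset_insert' a J ha]
      congr 1
      simp only [hf1, Finset.mul_sum]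
      refine Finset.sum_congr rfl fun S hS => ?_
      rw [chiB_insert a S (hna S hS), Finset.card_insert_of_notMem (hna S hS)]
      ring
    have hfl0 : ∀ w, f0 (flipAt a w) = f0 w := fun w =>
      Finset.sum_congr rfl fun S hS => by rw [chiB_flip_notMem a S (hna S hS)]
    have hfl1 : ∀ w, f1 (flipAt a w) = f1 w := fun w =>
      Finset.sum_congr rfl fun S hS => by rw [chiB_flip_notMem a S (hna S hS)]
    have hsga : ∀ w : ι → Bool, sg (flipAt a w a) = - sg (w a) := by
      intro w; simp [flipAt, sg_not]
    simp_rw [hF]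
    have hsym : ∑ w, (f0 w + η * (sg (w a) * f1 w)) ^ (2 * n) =
        ∑ w, (f0 w - η * (sg (w a) * f1 w)) ^ (2 * n) := by
      rw [← Equiv.sum_comp (flipAt a)]
      refine Finset.sum_congr rfl fun w _ => ?_
      rw [hfl0, hfl1, hsga]; ring
    have hstep : ∑ w, (f0 w + η * (sg (w a) * f1 w)) ^ (2 * n) ≤
        ∑ w, (f0 w ^ 2 + f1 w ^ 2) ^ n := by
      have : 2 * ∑ w, (f0 w + η * (sg (w a) * f1 w)) ^ (2 * n) ≤
        2 * ∑ w, (f0 w ^ 2 + f1 w ^ 2) ^ n := by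
        rw [two_mul]
        conv_lhs => arg 2; rw [hsym]
        rw [← Finset.sum_add_distrib, Finset.mul_sum]
        refine Finset.sum_le_sum fun w _ => ?_
        refine (two_point _ _ η n hn h).trans (le_of_eq ?_)
        rw [mul_pow, sq (sg (w a)), sg_sq, one_mul]
      linarith
    refine hstep.trans ?_
    have hn' : (1:ℝ) ≤ n := by exact_mod_cast hn
    have hn0 : (0:ℝ) < n := by linarith
    have hmink := Real.Lp_add_le_of_nonneg (s := Finset.univ) (f := fun w => f0 w ^ 2)
      (g := fun w => f1 w ^ 2) (p := n) hn' (fun _ _ => sq_nonneg _) (fun _ _ => sq_nonneg _)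
    simp only [Real.rpow_natCast] at hmink
    have hA : ∀ (c' : Finset ι → ℝ), (∑ w : ι → Bool, ((∑ S ∈ J.powerset, η ^ S.card * c' S * chiB S w)^2)^n) ^ (1/(n:ℝ)) ≤
        (2 ^ Fintype.card ι : ℝ) ^ (1/(n:ℝ)) * ∑ S ∈ J.powerset, c' S ^ 2 := by
      intro c'
      have h1 := ih c'
      simp_rw [pow_mul] at h1
      calc _ ≤ (2 ^ Fintype.card ι * (∑ S ∈ J.powerset, c' S ^ 2) ^ n) ^ (1/(n:ℝ)) := by
            apply Real.rpow_le_rpow _ h1 (by positivity)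
            exact Finset.sum_nonneg fun _ _ => by positivity
        _ = _ := by
            rw [Real.mul_rpow (by positivity) (by positivity), one_div,
              Real.pow_rpow_inv_natCast (Finset.sum_nonneg fun _ _ => sq_nonneg _) (by omega)]
    have h0 := hA c
    have h1 := hA (fun S => c (insert a S))
    rw [sum_powerset_insert' a J ha]
    have hfin := hmink.trans (add_le_add h0 h1)
    rw [← mul_add] at hfin
    have hnn : 0 ≤ ∑ w, (f0 w ^ 2 + f1 w ^ 2) ^ n := Finset.sum_nonneg fun _ _ => by positivity
    have h3 := pow_le_pow_left₀ (by positivity) hfin n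
    rw [mul_pow, one_div, Real.rpow_inv_natCast_pow hnn (by omega),
      Real.rpow_inv_natCast_pow (by positivity) (by omega)] at h3
    exact h3

lemma sum_chiB {ι : Type} [Fintype ι] [DecidableEq ι] (S T : Finset ι) :
    ∑ w : ι → Bool, chiB S w * chiB T w = if S = T then 2 ^ Fintype.card ι else 0 := by
  split_ifs with h
  · subst h
    have : ∀ w, chiB S w * chiB S w = 1 := by
      intro w
      unfold chiB
      rw [← Finset.prod_mul_distrib]
      exact Finset.prod_eq_one fun i _ => sg_sq _
    simp [this]
  · have : ∃ k, ¬ (k ∈ S ↔ k ∈ T) := by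
      by_contra hcon
      push Not at hcon
      exact h (Finset.ext hcon)
    obtain ⟨k, hk⟩ := this
    have hin : ∀ R : Finset ι, k ∈ R → ∀ w, chiB R (flipAt k w) = - chiB R w := by
      intro R hR w
      rw [← Finset.insert_erase hR, chiB_insert _ _ (by simp), chiB_insert _ _ (by simp),
        chiB_flip_notMem _ _ (by simp)]
      simp [flipAt, sg_not]
    have hs : ∑ w : ι → Bool, chiB S w * chiB T w = - ∑ w : ι → Bool, chiB S w * chiB T w := by
      conv_lhs => rw [← Equiv.sum_comp (flipAt k)]
      rw [← Finset.sum_neg_distrib]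
      refine Finset.sum_congr rfl fun w _ => ?_
      by_cases a : k ∈ S
      · have b : k ∉ T := fun b => hk ⟨fun _ => b, fun _ => a⟩
        rw [hin S a, chiB_flip_notMem k T b]; ring
      · have b : k ∈ T := by tauto
        rw [hin T b, chiB_flip_notMem k S a]; ring
    linarith

lemma parseval {ι : Type} [Fintype ι] [DecidableEq ι] (f g : Finset ι → ℝ) :
    ∑ w : ι → Bool, (∑ S, f S * chiB S w) * (∑ S, g S * chiB S w) =
      2 ^ Fintype.card ι * ∑ S, f S * g S := by
  simp_rw [Finset.sum_mul_sum]
  rw [Finset.sum_comm, Finset.mul_sum]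
  refine Finset.sum_congr rfl fun S _ => ?_
  rw [Finset.sum_comm]
  rw [Finset.sum_eq_single S]
  · have : ∀ w : ι → Bool, f S * chiB S w * (g S * chiB S w) = f S * g S * (chiB S w * chiB S w) := by
      intro w; ring
    simp_rw [this]
    rw [← Finset.mul_sum, sum_chiB]; simp; ring
  · intro T _ hT
    have : ∀ w : ι → Bool, f S * chiB S w * (g T * chiB T w) = f S * g T * (chiB S w * chiB T w) := by
      intro w; ring
    simp_rw [this]
    rw [← Finset.mul_sum, sum_chiB, if_neg (Ne.symm hT)]; simp
  · simp

/-- Small-set expansion style bound for a density with bounded second moment. -/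
lemma noise_bound {ι : Type} [Fintype ι] [DecidableEq ι] (f : Finset ι → ℝ) (n : ℕ) (hn : 1 ≤ n)
    (E δ : ℝ) (hδ : δ * (2 * n - 1) = 1)
    (hpos : ∀ w, 0 ≤ ∑ S, f S * chiB S w) (h1 : f ∅ = 1) (hE : ∑ S, f S ^ 2 ≤ E) :
    (∑ S, δ ^ S.card * f S ^ 2) ^ n ≤ E := by
  have hn' : (1:ℝ) ≤ n := by exact_mod_cast hn
  have hδ0 : 0 < δ := by
    by_contra hc
    push Not at hc
    nlinarith
  set η := Real.sqrt δ
  have hη : η ^ 2 = δ := Real.sq_sqrt hδ0.le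
  set M : ℝ := 2 ^ Fintype.card ι with hM
  have hM0 : 0 < M := by positivity
  set A := ∑ S, δ ^ S.card * f S ^ 2 with hA
  have hA1 : 1 ≤ A := by
    have := Finset.single_le_sum (f := fun S => δ ^ S.card * f S ^ 2)
      (fun S _ => by positivity) (Finset.mem_univ ∅)
    simpa [h1] using this
  set F : (ι → Bool) → ℝ := fun w => ∑ S, f S * chiB S w
  set g : (ι → Bool) → ℝ := fun w => ∑ S, (δ ^ S.card * f S) * chiB S w
  have hFsum : ∑ w, F w / M = 1 := by
    have := parseval f (fun S => if S = ∅ then 1 else 0)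
    simp [chiB, h1] at this
    rw [← Finset.sum_div]
    rw [div_eq_one_iff_eq hM0.ne']
    simpa [F, chiB] using this
  have hFg : ∑ w, F w * g w = M * A := by
    rw [parseval f]
    congr 1
    refine Finset.sum_congr rfl fun S _ => by ring
  have hFF : ∑ w, F w ^ 2 ≤ M * E := by
    have := parseval f f
    simp_rw [← sq] at this
    rw [this]
    gcongr
  have hgg : ∑ w, g w ^ (2 * n) ≤ M * A ^ n := by
    have := hyperc η n hn (by rw [hη, hδ]) Finset.univ (fun S => η ^ S.card * f S)
    simp only [Finset.powerset_univ] at this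
    have e : ∀ S : Finset ι, η ^ S.card * (η ^ S.card * f S) = δ ^ S.card * f S := by
      intro S
      rw [← mul_assoc, ← mul_pow, ← sq, hη]
    have e2 : ∀ S : Finset ι, (η ^ S.card * f S) ^ 2 = δ ^ S.card * f S ^ 2 := by
      intro S
      rw [mul_pow, ← pow_mul, mul_comm S.card, pow_mul, hη]
    simp_rw [e, e2] at this
    exact this
  have hjen : A ^ n ≤ ∑ w, F w / M * |g w| ^ n := by
    have h2 := Real.pow_arith_mean_le_arith_mean_pow Finset.univ (fun w => F w / M) (fun w => |g w|)
      (fun w _ => div_nonneg (hpos w) hM0.le) hFsum (fun w _ => abs_nonneg _) n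
    refine le_trans (pow_le_pow_left₀ (by linarith) ?_ n) h2
    have : A = ∑ w, F w / M * g w := by
      have : ∀ w, F w / M * g w = (F w * g w) / M := fun w => by ring
      simp_rw [this]
      rw [← Finset.sum_div, hFg]; field_simp
    rw [this]
    exact Finset.sum_le_sum fun w _ =>
      mul_le_mul_of_nonneg_left (le_abs_self _) (div_nonneg (hpos w) hM0.le)
  have hcs := Finset.sum_mul_sq_le_sq_mul_sq Finset.univ F (fun w => |g w| ^ n)
  have hX : ∑ w, F w / M * |g w| ^ n = (∑ w, F w * |g w| ^ n) / M := by
    rw [Finset.sum_div]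
    refine Finset.sum_congr rfl fun w _ => by ring
  rw [hX, le_div_iff₀ hM0] at hjen
  have hgn : ∑ w, (|g w| ^ n) ^ 2 ≤ M * A ^ n := by
    refine le_trans (le_of_eq ?_) hgg
    refine Finset.sum_congr rfl fun w _ => ?_
    rw [← pow_mul, mul_comm n 2, Even.pow_abs ⟨n, by ring⟩]
  have hAn : 0 < A ^ n := by positivity
  have h5 : (A ^ n * M) ^ 2 ≤ (M * E) * (M * A ^ n) := by
    calc (A ^ n * M) ^ 2 ≤ (∑ w, F w * |g w| ^ n) ^ 2 := pow_le_pow_left₀ (by positivity) hjen 2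
      _ ≤ _ := hcs
      _ ≤ _ := by
        apply mul_le_mul hFF hgn (Finset.sum_nonneg fun _ _ => sq_nonneg _)
        exact le_trans (Finset.sum_nonneg fun _ _ => sq_nonneg _) hFF
  have h6 : (A ^ n * M ^ 2) * A ^ n ≤ (A ^ n * M ^ 2) * E := by nlinarith
  exact le_of_mul_le_mul_left h6 (by positivity)

end

section
open scoped BigOperators
open MeasureTheory

lemma sg_sgnBool (t : ℝ) : sg (sgnBool t) = sgn t := by
  unfold sg sgnBool sgn
  split_ifs <;> simp_all

lemma sgn_mul_of_ne {x y : ℝ} (hx : x ≠ 0) (hy : y ≠ 0) : sgn (x * y) = sgn x * sgn y := by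
  unfold sgn
  rcases lt_or_gt_of_ne hx with h | h <;> rcases lt_or_gt_of_ne hy with h' | h'
  · simp [not_le.mpr h, not_le.mpr h', (mul_pos_of_neg_of_neg h h').le]
  · simp [not_le.mpr h, h'.le, mul_neg_of_neg_of_pos h h']
  · simp [not_le.mpr h', h.le, mul_neg_of_pos_of_neg h h']
  · simp [h.le, h'.le, (mul_pos h h').le]

lemma gPi_rot {N : ℕ} (U : Fin N → Fin N → ℝ) (hU : IsOrthogonal U) :
    (gPi (Fin N)).map (fun x j => ∑ l, U l j * x l) = gPi (Fin N) := by
  have h := gPi_map_eq (ι := Fin N) (ι' := Fin N) (κ := Fin N) (fun j l => U l j)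
    (fun j l => if j = l then 1 else 0) (by
      intro k l
      rw [hU.1]
      simp)
  rw [h]
  have : (fun (x : Fin N → ℝ) (k : Fin N) => ∑ i, (if k = i then (1:ℝ) else 0) * x i) = id := by
    ext x k; simp
  rw [this, Measure.map_id]

lemma gPi_coord_ne {N : ℕ} (j : Fin N) : ∀ᵐ x ∂(gPi (Fin N)), x j ≠ 0 := by
  have := ProbabilityTheory.nullSingletonClass_gaussianReal (μ := 0) (v := 1) one_ne_zero
  have h0 : ∀ᵐ g ∂(ProbabilityTheory.gaussianReal 0 1), g ≠ 0 := by
    simp [ae_iff]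
  have hq := (measurePreserving_eval (fun _ : Fin N => ProbabilityTheory.gaussianReal 0 1) j).quasiMeasurePreserving
  exact hq.ae h0

lemma gPi_rot_coord_ne {N : ℕ} (U : Fin N → Fin N → ℝ) (hU : IsOrthogonal U) (j : Fin N) :
    ∀ᵐ x ∂(gPi (Fin N)), (∑ l, U l j * x l) ≠ 0 := by
  have h := gPi_coord_ne j
  rw [← gPi_rot U hU] at h
  exact ae_of_ae_map (f := fun (x : Fin N → ℝ) j => ∑ l, U l j * x l) (p := fun x => x j ≠ 0) (Measurable.aemeasurable (by fun_prop)) h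

lemma Zfam_sgn {N m : ℕ} (hm : 1 ≤ m) (U : Fin N → Fin N → ℝ)
    (X : Fin m → Fin N → ℝ) (h1 : ∀ i j, X i j ≠ 0) (h2 : ∀ i j, (∑ l, U l j * X i l) ≠ 0)
    (a : Fin (m + 1)) (j : Fin N) :
    sgn (Zfam N (m + 1) U X a j) =
      (if h : a.val < m then sgn (X ⟨a.val, h⟩ j) else 1) *
      (if h : 0 < a.val then sgn (∑ l, U l j * X ⟨a.val - 1, by omega⟩ l) else 1) := by
  unfold Zfam
  have hmm : m + 1 - 1 = m := rfl
  by_cases ha : a.val = 0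
  · have : 0 < m + 1 - 1 := by omega
    simp only [ha, if_true, this, dif_pos, lt_irrefl, dif_neg, not_false_iff, mul_one]
    have h0 : 0 < m := by omega
    simp [h0]
  · by_cases hb : a.val = m + 1 - 1
    · have h3 : m + 1 - 2 < m + 1 - 1 := by omega
      have h4 : ¬ (a.val < m) := by omega
      have h5 : 0 < a.val := by omega
      rw [if_neg ha, if_pos hb, dif_pos h3, dif_neg h4, dif_pos h5, one_mul]
      have e : (⟨m + 1 - 2, h3⟩ : Fin (m + 1 - 1)) = (⟨a.val - 1, by omega⟩ : Fin m) := by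
        apply Fin.ext; show m + 1 - 2 = a.val - 1; omega
      rw [e]
    · have h3 : a.val - 1 < m + 1 - 1 ∧ a.val < m + 1 - 1 := by
        have := a.isLt
        omega
      have h4 : a.val < m := h3.2
      have h5 : 0 < a.val := by omega
      rw [if_neg ha, if_neg hb, dif_pos h3, dif_pos h4, dif_pos h5]
      rw [sgn_mul_of_ne (h2 _ _) (h1 _ _), mul_comm]
      

instance stdGaussianVec_prob (N : ℕ) : IsProbabilityMeasure (stdGaussianVec N) := by
  unfold stdGaussianVec; infer_instance

instance stdGaussianFam_prob (N m : ℕ) : IsProbabilityMeasure (stdGaussianFam N m) := by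
  unfold stdGaussianFam; infer_instance

/-- Fourier coefficients of `D_{U,k}`. -/
lemma fourierD {N m : ℕ} (hm : 1 ≤ m) (U : Fin N → Fin N → ℝ) (hU : IsOrthogonal U)
    (p : Fin (m + 1) → Finset (Fin N)) :
    ∫ X : Fin m → Fin N → ℝ, ∏ a, ∏ j ∈ p a, sg (sgnBool (Zfam N (m + 1) U X a j)) ∂(stdGaussianFam N m) =
      ∏ i : Fin m, GG U (p i.castSucc) (p i.succ) := by
  have hpt : ∀ᵐ X : Fin m → Fin N → ℝ ∂(stdGaussianFam N m), (∏ a, ∏ j ∈ p a, sg (sgnBool (Zfam N (m + 1) U X a j))) =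
      ∏ i : Fin m, ((∏ j ∈ p i.castSucc, sgn (X i j)) * ∏ j ∈ p i.succ, sgn (∑ l, U l j * X i l)) := by
    have q : ∀ i : Fin m, ∀ P : (Fin N → ℝ) → Prop, (∀ᵐ x ∂(gPi (Fin N)), P x) →
        ∀ᵐ X ∂(stdGaussianFam N m), P (X i) := by
      intro i P hP
      have hq := (measurePreserving_eval (fun _ : Fin m => gPi (Fin N)) i).quasiMeasurePreserving
      exact hq.ae hP
    have a1 : ∀ᵐ X ∂(stdGaussianFam N m), ∀ i j, X i j ≠ 0 := by
      rw [ae_all_iff]; intro i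
      rw [ae_all_iff]; intro j
      exact q i _ (gPi_coord_ne j)
    have a2 : ∀ᵐ X ∂(stdGaussianFam N m), ∀ i j, (∑ l, U l j * X i l) ≠ 0 := by
      rw [ae_all_iff]; intro i
      rw [ae_all_iff]; intro j
      exact q i (fun x => (∑ l, U l j * x l) ≠ 0) (gPi_rot_coord_ne U hU j)
    filter_upwards [a1, a2] with X h1 h2
    simp_rw [sg_sgnBool, Zfam_sgn hm U X h1 h2, Finset.prod_mul_distrib]
    congr 1
    · rw [Fin.prod_univ_castSucc]
      simp
    · rw [Fin.prod_univ_succ]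
      simp
  rw [integral_congr_ae hpt]
  unfold stdGaussianFam
  rw [integral_fintype_prod_eq_prod (𝕜 := ℝ) (fun i (x : Fin N → ℝ) =>
    ((∏ j ∈ p (Fin.castSucc i), sgn (x j)) * ∏ j ∈ p (Fin.succ i), sgn (∑ l, U l j * x l)))]
  rfl

/-- indicator of a subcube -/
noncomputable def cubeInd {κ : Type} (c : Finset κ) (a z : κ → Bool) : ℝ :=
  ∏ p ∈ c, ((1 + sg (a p) * sg (z p)) / 2)

/-- slices of a set of queried coordinates -/
def slice {k N : ℕ} (c : Finset (Fin k × Fin N)) (i : Fin k) : Finset (Fin N) :=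
  Finset.univ.filter fun j => (i, j) ∈ c

lemma prod_slice {k N : ℕ} (c : Finset (Fin k × Fin N)) (f : Fin k × Fin N → ℝ) :
    ∏ p ∈ c, f p = ∏ i, ∏ j ∈ slice c i, f (i, j) := by
  classical
  have : ∀ i, ∏ j ∈ slice c i, f (i, j) = ∏ j, if (i, j) ∈ c then f (i, j) else 1 := by
    intro i
    rw [slice, Finset.prod_filter]
  simp_rw [this]
  rw [← Fintype.prod_prod_type' (f := fun i j => if (i, j) ∈ c then f (i, j) else 1)]
  rw [Finset.prod_ite_mem, Finset.univ_inter]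

lemma sum_card_slice {k N : ℕ} (c : Finset (Fin k × Fin N)) :
    ∑ i, (slice c i).card = c.card := by
  classical
  have : ∀ i, (slice c i).card = ∑ j, if (i, j) ∈ c then 1 else 0 := by
    intro i
    rw [slice, Finset.card_filter]
  simp_rw [this]
  rw [← Fintype.sum_prod_type' (f := fun i j => if (i, j) ∈ c then 1 else 0)]
  simp

/-- coefficient vector of a block of the subcube -/
noncomputable def alph {N : ℕ} (T : Finset (Fin N)) (a : Fin N → Bool) (S : Finset (Fin N)) : ℝ :=
  if S ⊆ T then chiB S a else 0

lemma prod_one_add_eq {N : ℕ} (T : Finset (Fin N)) (a : Fin N → Bool) (z : Fin N → ℝ) :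
    ∏ j ∈ T, (1 + sg (a j) * z j) = ∑ S, alph T a S * ∏ j ∈ S, z j := by
  classical
  rw [Finset.prod_one_add]
  rw [← Finset.sum_subset (Finset.subset_univ T.powerset)]
  · refine Finset.sum_congr rfl fun S hS => ?_
    rw [alph, if_pos (Finset.mem_powerset.mp hS), chiB, Finset.prod_mul_distrib]
  · intro S _ hS
    rw [alph, if_neg (fun h => hS (Finset.mem_powerset.mpr h)), zero_mul]

/-- normalized probability of a subcube -/
lemma cubeD {N m : ℕ} (hm : 1 ≤ m) (U : Fin N → Fin N → ℝ) (hU : IsOrthogonal U)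
    (c : Finset (Fin (m + 1) × Fin N)) (a : Fin (m + 1) × Fin N → Bool) :
    2 ^ c.card * ∫ X : Fin m → Fin N → ℝ, cubeInd c a (fun p => sgnBool (Zfam N (m + 1) U X p.1 p.2)) ∂(stdGaussianFam N m) =
      ∑ p : Fin (m + 1) → Finset (Fin N), (∏ i, alph (slice c i) (fun j => a (i, j)) (p i)) *
        ∏ i : Fin m, GG U (p i.castSucc) (p i.succ) := by
  classical
  have e : ∀ z : Fin (m + 1) × Fin N → Bool, 2 ^ c.card * cubeInd c a z =
      ∑ p : Fin (m + 1) → Finset (Fin N), (∏ i, alph (slice c i) (fun j => a (i, j)) (p i)) *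
        ∏ i, ∏ j ∈ p i, sg (z (i, j)) := by
    intro z
    unfold cubeInd
    rw [Finset.prod_div_distrib, Finset.prod_const, mul_div_cancel₀ _ (by positivity),
      prod_slice c (fun p => 1 + sg (a p) * sg (z p))]
    simp_rw [prod_one_add_eq _ (fun j => a (_, j)) (fun j => sg (z (_, j)))]
    rw [Finset.prod_univ_sum]
    simp only [Fintype.piFinset_univ]
    refine Finset.sum_congr rfl fun p _ => ?_
    rw [Finset.prod_mul_distrib]
  rw [← integral_const_mul]
  simp_rw [e]
  have : IsProbabilityMeasure (stdGaussianFam N m) := by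
    unfold stdGaussianFam stdGaussianVec; infer_instance
  rw [integral_finsetSum]
  · refine Finset.sum_congr rfl fun p _ => ?_
    rw [integral_const_mul, fourierD hm U hU]
  · intro p _
    apply Integrable.const_mul
    apply integrable_of_bdd (C := 1)
    · apply Finset.measurable_prod; intro i _
      apply Finset.measurable_prod; intro j _
      simp_rw [sg_sgnBool]
      apply sgn_measurable.comp
      unfold Zfam
      split_ifs <;> fun_prop
    · intro X
      apply prod_abs_le_one; intro i
      apply prod_abs_le_one; intro j
      rw [sg_sgnBool, sgn_abs]

end

section
open scoped BigOperators
open MeasureTheory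

section chains

/-- iterated kernel sums -/
noncomputable def chain {X : Type} [Fintype X] (K : X → X → ℝ) :
    (m : ℕ) → (Fin (m + 1) → X → ℝ) → X → ℝ
  | 0, α, S => α 0 S
  | m + 1, α, S => α 0 S * ∑ T, K S T * chain K m (fun i => α i.succ) T

lemma sum_fin_cons {X : Type} [Fintype X] (m : ℕ) (F : (Fin (m + 1) → X) → ℝ) :
    ∑ p, F p = ∑ S, ∑ q : Fin m → X, F (Fin.cons S q) := by
  rw [← (Fin.consEquiv (fun _ : Fin (m + 1) => X)).sum_comp, Fintype.sum_prod_type]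
  rfl

lemma chain_eq {X : Type} [Fintype X] (K : X → X → ℝ) (m : ℕ) :
    ∀ (α : Fin (m + 1) → X → ℝ) (S : X),
    ∑ q : Fin m → X, (∏ i, α i ((Fin.cons S q : Fin (m + 1) → X) i)) *
      ∏ i : Fin m, K ((Fin.cons S q : Fin (m + 1) → X) i.castSucc)
        ((Fin.cons S q : Fin (m + 1) → X) i.succ) = chain K m α S := by
  induction m with
  | zero => intro α S; simp [chain]
  | succ m ih =>
    intro α S
    rw [chain, sum_fin_cons, Finset.mul_sum]
    refine Finset.sum_congr rfl fun T _ => ?_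
    rw [← ih, Finset.mul_sum, Finset.mul_sum]
    refine Finset.sum_congr rfl fun q _ => ?_
    rw [Fin.prod_univ_succ, Fin.prod_univ_succ (fun i : Fin (m + 1) => K _ _)]
    simp only [Fin.cons_zero, Fin.cons_succ, Fin.castSucc_zero, ← Fin.succ_castSucc]
    ring

lemma chain_sum {X : Type} [Fintype X] (K : X → X → ℝ) (m : ℕ) (α : Fin (m + 1) → X → ℝ) :
    ∑ p : Fin (m + 1) → X, (∏ i, α i (p i)) * ∏ i : Fin m, K (p i.castSucc) (p i.succ) =
      ∑ S, chain K m α S := by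
  rw [sum_fin_cons]
  exact Finset.sum_congr rfl fun S _ => chain_eq K m α S

variable {N : ℕ}

/-- kernel bound -/
def KB (K : Finset (Fin N) → Finset (Fin N) → ℝ) (T1 T2 : Finset (Fin N)) (r1 r2 : ℝ) : Prop :=
  ∀ x y : Finset (Fin N) → ℝ, (∀ S, ¬ S ⊆ T1 → x S = 0) → (∀ S, ¬ S ⊆ T2 → y S = 0) →
    |∑ S, ∑ T, x S * K S T * y T| ≤ Real.sqrt (∑ S, r1 ^ S.card * x S ^ 2) *
      Real.sqrt (∑ S, r2 ^ S.card * y S ^ 2)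

/-- remove the empty set coefficient -/
noncomputable def trim (y : Finset (Fin N) → ℝ) (S : Finset (Fin N)) : ℝ := if S = ∅ then 0 else y S

/-- weighted square norm -/
noncomputable def wn (r : ℝ) (y : Finset (Fin N) → ℝ) : ℝ := ∑ S, r ^ S.card * y S ^ 2

lemma wn_nonneg {r : ℝ} (hr : 0 ≤ r) (y : Finset (Fin N) → ℝ) : 0 ≤ wn r y :=
  Finset.sum_nonneg fun _ _ => by positivity

lemma wn_mono {r r' : ℝ} (hr : 0 ≤ r) (h : r ≤ r') (y z : Finset (Fin N) → ℝ)
    (hyz : ∀ S, |y S| ≤ |z S|) : wn r y ≤ wn r' z := by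
  unfold wn
  refine Finset.sum_le_sum fun S _ => ?_
  have := sq_le_sq.mpr (hyz S)
  have h2 := pow_le_pow_left₀ hr h S.card
  exact mul_le_mul h2 this (sq_nonneg _) (pow_nonneg (hr.trans h) _)

lemma wn_trim_le {r : ℝ} (hr : 0 ≤ r) (hr1 : r ≤ 1) (y : Finset (Fin N) → ℝ) :
    wn r (trim y) ≤ r * wn 1 (trim y) := by
  unfold wn
  rw [Finset.mul_sum]
  refine Finset.sum_le_sum fun S _ => ?_
  by_cases h : S = ∅
  · simp [trim, h]
  · have : r ^ S.card ≤ r := by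
      have h1 : 1 ≤ S.card := Finset.card_pos.mpr (Finset.nonempty_iff_ne_empty.mpr h)
      calc r ^ S.card ≤ r ^ 1 := pow_le_pow_of_le_one hr hr1 h1
        _ = r := pow_one r
    rw [one_pow, one_mul]
    gcongr

lemma KB.op {K : Finset (Fin N) → Finset (Fin N) → ℝ} {T1 T2 : Finset (Fin N)} {r : ℝ}
    (h : KB K T1 T2 1 r) (hr : 0 ≤ r) (y : Finset (Fin N) → ℝ) (hy : ∀ S, ¬ S ⊆ T2 → y S = 0) :
    wn 1 (fun S => if S ⊆ T1 then ∑ T, K S T * y T else 0) ≤ wn r y := by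
  set x : Finset (Fin N) → ℝ := fun S => if S ⊆ T1 then ∑ T, K S T * y T else 0 with hx
  have h1 := h x y (fun S hS => by simp [hx, hS]) hy
  have e : ∑ S, ∑ T, x S * K S T * y T = wn 1 x := by
    unfold wn
    refine Finset.sum_congr rfl fun S _ => ?_
    rw [one_pow, one_mul, sq]
    simp_rw [mul_assoc]
    rw [← Finset.mul_sum]
    by_cases hS : S ⊆ T1
    · simp [hx, hS]
    · simp [hx, hS]
  rw [e] at h1
  change |wn 1 x| ≤ Real.sqrt (wn 1 x) * Real.sqrt (wn r y) at h1
  have h0 := wn_nonneg zero_le_one x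
  have h0' := wn_nonneg hr y
  rw [abs_of_nonneg h0] at h1
  rcases h0.eq_or_lt with h2 | h2
  · rw [← h2]; exact h0'
  · have hs := Real.sqrt_pos.mpr h2
    have h3 : Real.sqrt (wn 1 x) * Real.sqrt (wn 1 x) ≤ Real.sqrt (wn 1 x) * Real.sqrt (wn r y) := by
      rw [Real.mul_self_sqrt h0]; exact h1
    have h4 := le_of_mul_le_mul_left h3 hs
    exact (Real.sqrt_le_sqrt_iff h0').mp h4

/-- kernel normalization at the empty set -/
structure KN (K : Finset (Fin N) → Finset (Fin N) → ℝ) : Prop where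
  ee : K ∅ ∅ = 1
  el : ∀ T, T ≠ ∅ → K ∅ T = 0
  er : ∀ S, S ≠ ∅ → K S ∅ = 0

/-- end vector -/
noncomputable def endv (K : Finset (Fin N) → Finset (Fin N) → ℝ) (T1 : Finset (Fin N))
    (α : Finset (Fin N) → ℝ) (S : Finset (Fin N)) : ℝ :=
  if S ⊆ T1 then ∑ T, K S T * α T else 0

lemma alph_empty (T : Finset (Fin N)) (a : Fin N → Bool) : alph T a ∅ = 1 := by
  simp [alph, chiB]

lemma chiB_abs (S : Finset (Fin N)) (w : Fin N → Bool) : |chiB S w| = 1 := by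
  unfold chiB
  rw [Finset.abs_prod]
  exact Finset.prod_eq_one fun i _ => by cases w i <;> simp [sg]

lemma alph_abs_le (T : Finset (Fin N)) (a : Fin N → Bool) (S : Finset (Fin N)) :
    |alph T a S| ≤ 1 := by
  unfold alph
  split_ifs
  · exact (chiB_abs _ _).le
  · simp

lemma alph_supp (T : Finset (Fin N)) (a : Fin N → Bool) : ∀ S, ¬ S ⊆ T → alph T a S = 0 := by
  intro S h; simp [alph, h]

lemma wn_alph (r : ℝ) (T : Finset (Fin N)) (a : Fin N → Bool) :
    wn r (alph T a) = (1 + r) ^ T.card := by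
  classical
  unfold wn
  have h := Finset.prod_one_add (f := fun _ : Fin N => r) T
  rw [Finset.prod_const] at h
  rw [h, ← Finset.sum_subset (Finset.subset_univ T.powerset)]
  · refine Finset.sum_congr rfl fun S hS => ?_
    have : alph T a S ^ 2 = 1 := by
      rw [alph, if_pos (Finset.mem_powerset.mp hS), ← sq_abs, chiB_abs, one_pow]
    rw [this, Finset.prod_const, mul_one]
  · intro S _ hS
    rw [alph, if_neg (fun h => hS (Finset.mem_powerset.mpr h))]; simp

lemma exp_le_one_add_two_mul {x : ℝ} (h0 : 0 ≤ x) (h1 : x ≤ 1) : Real.exp x ≤ 1 + 2 * x := by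
  have := Real.abs_exp_sub_one_sub_id_le (x := x) (by rw [abs_of_nonneg h0]; exact h1)
  have h2 := (abs_le.mp this).2
  nlinarith

lemma endv_empty {K : Finset (Fin N) → Finset (Fin N) → ℝ} (hK : KN K) (T1 T2 : Finset (Fin N))
    (a : Fin N → Bool) : endv K T1 (alph T2 a) ∅ = 1 := by
  unfold endv
  rw [if_pos (Finset.empty_subset _), Finset.sum_eq_single ∅]
  · rw [hK.ee, alph_empty, one_mul]
  · intro T _ hT; rw [hK.el T hT, zero_mul]
  · simp

lemma end_bound {K : Finset (Fin N) → Finset (Fin N) → ℝ} (hK : KN K) (T1 T2 : Finset (Fin N))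
    (a : Fin N → Bool) (r : ℝ) (hr : 0 ≤ r) (h : KB K T1 T2 1 r)
    (hpos : ∀ w, 0 ≤ ∑ S, endv K T1 (alph T2 a) S * chiB S w)
    (d : ℕ) (hd : T2.card ≤ d) (n : ℕ) (hn : 1 ≤ n) (δ : ℝ) (hδ : δ * (2 * n - 1) = 1)
    (hsm : 2 * δ * r * d ≤ 1) :
    wn δ (trim (endv K T1 (alph T2 a))) ≤ 4 * δ * r * d := by
  set f := endv K T1 (alph T2 a) with hf
  have hn' : (1:ℝ) ≤ n := by exact_mod_cast hn
  have hδ0 : 0 < δ := by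
    by_contra hc
    push Not at hc
    nlinarith
  have hE : ∑ S, f S ^ 2 ≤ Real.exp (r * d) := by
    have h1 := h.op hr (alph T2 a) (alph_supp T2 a)
    rw [wn_alph] at h1
    have h2 : wn 1 f = ∑ S, f S ^ 2 := by simp [wn]
    calc ∑ S, f S ^ 2 = wn 1 f := h2.symm
      _ ≤ (1 + r) ^ T2.card := h1
      _ ≤ (1 + r) ^ d := pow_le_pow_right₀ (by linarith) hd
      _ ≤ (Real.exp r) ^ d := by
          apply pow_le_pow_left₀ (by linarith)
          linarith [Real.add_one_le_exp r]
      _ = Real.exp (r * d) := by rw [← Real.exp_nat_mul, mul_comm]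
  have hfe : f ∅ = 1 := endv_empty hK T1 T2 a
  have hnb := noise_bound f n hn _ δ hδ hpos hfe hE
  have hA : wn δ f ≤ Real.exp (2 * δ * r * d) := by
    have h3 : (wn δ f) ^ n ≤ (Real.exp (2 * δ * r * d)) ^ n := by
      refine hnb.trans ?_
      rw [← Real.exp_nat_mul]
      apply Real.exp_le_exp.mpr
      have : 1 ≤ (n : ℝ) * (2 * δ) := by nlinarith
      have hrd : 0 ≤ r * d := by positivity
      nlinarith
    exact le_of_pow_le_pow_left₀ (by omega) (Real.exp_pos _).le h3
  have h4 : wn δ f = 1 + wn δ (trim f) := by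
    unfold wn
    rw [← Finset.add_sum_erase _ _ (Finset.mem_univ (∅ : Finset (Fin N)))]
    rw [← Finset.add_sum_erase _ (fun S => δ ^ S.card * trim f S ^ 2) (Finset.mem_univ (∅ : Finset (Fin N)))]
    have : ∑ x ∈ Finset.univ.erase ∅, δ ^ x.card * f x ^ 2 =
        ∑ x ∈ Finset.univ.erase ∅, δ ^ x.card * trim f x ^ 2 := by
      refine Finset.sum_congr rfl fun S hS => ?_
      rw [trim, if_neg (Finset.ne_of_mem_erase hS)]
    rw [this]
    simp [hfe, trim]
  have h5 := exp_le_one_add_two_mul (x := 2 * δ * r * d) (by positivity) hsm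
  linarith

lemma chain_empty {K : Finset (Fin N) → Finset (Fin N) → ℝ} (hK : KN K) (m : ℕ) :
    ∀ (α : Fin (m + 1) → Finset (Fin N) → ℝ), (∀ i, α i ∅ = 1) → chain K m α ∅ = 1 := by
  induction m with
  | zero => intro α h; simp [chain, h]
  | succ m ih =>
    intro α h
    rw [chain, h, one_mul, Finset.sum_eq_single ∅]
    · rw [hK.ee, ih _ (fun i => h i.succ), one_mul]
    · intro T _ hT; rw [hK.el T hT, zero_mul]
    · simp

lemma chain_supp {K : Finset (Fin N) → Finset (Fin N) → ℝ} (m : ℕ) 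
    (α : Fin (m + 1) → Finset (Fin N) → ℝ) (T : Finset (Fin N)) (h : ∀ S, ¬ S ⊆ T → α 0 S = 0) :
    ∀ S, ¬ S ⊆ T → chain K m α S = 0 := by
  intro S hS
  cases m with
  | zero => exact h S hS
  | succ m => rw [chain, h S hS, zero_mul]

lemma trim_supp {y : Finset (Fin N) → ℝ} {T : Finset (Fin N)} (h : ∀ S, ¬ S ⊆ T → y S = 0) :
    ∀ S, ¬ S ⊆ T → trim y S = 0 := by
  intro S hS
  unfold trim
  split_ifs
  · rfl
  · exact h S hS

lemma trim_sum {K : Finset (Fin N) → Finset (Fin N) → ℝ} (hK : KN K) (y : Finset (Fin N) → ℝ)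
    (S : Finset (Fin N)) (hS : S ≠ ∅) : ∑ T, K S T * y T = ∑ T, K S T * trim y T := by
  refine Finset.sum_congr rfl fun T _ => ?_
  unfold trim
  split_ifs with h
  · rw [h, hK.er S hS]; simp
  · rfl

/-- one step of the chain -/
lemma chain_step {K : Finset (Fin N) → Finset (Fin N) → ℝ} (hK : KN K) (m : ℕ)
    (T : Fin (m + 2) → Finset (Fin N)) (a : Fin (m + 2) → Fin N → Bool) (r : ℝ) (hr : 0 ≤ r)
    (h : KB K (T 0) (T 1) 1 r) :
    wn 1 (trim (chain K (m + 1) fun i => alph (T i) (a i))) ≤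
      wn r (trim (chain K m fun i => alph (T i.succ) (a i.succ))) := by
  set y := trim (chain K m fun i => alph (T i.succ) (a i.succ)) with hy
  have hs : ∀ S, ¬ S ⊆ T 1 → y S = 0 := trim_supp (chain_supp m _ (T 1) (alph_supp _ _))
  refine le_trans (wn_mono zero_le_one le_rfl _ _ ?_) (h.op hr y hs)
  intro S
  unfold trim
  by_cases hS : S = ∅
  · simp [hS]
  · rw [if_neg hS, chain, trim_sum hK _ S hS, abs_mul]
    by_cases hST : S ⊆ T 0
    · rw [if_pos hST]
      exact mul_le_of_le_one_left (abs_nonneg _) (alph_abs_le _ _ _)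
    · rw [alph_supp _ _ S hST]; simp

lemma chain_bound {K : Finset (Fin N) → Finset (Fin N) → ℝ} (hK : KN K) (r : ℝ) (hr : 0 ≤ r)
    (hr1 : r ≤ 1) (B : ℝ) (m : ℕ) : ∀ 
    (T : Fin (m + 2) → Finset (Fin N)) (a : Fin (m + 2) → Fin N → Bool)
    (_ : ∀ i : Fin (m + 1), KB K (T i.castSucc) (T i.succ) 1 r)
    (_ : wn r (trim (endv K (T (Fin.last m).castSucc) (alph (T (Fin.last (m + 1))) (a (Fin.last (m + 1)))))) ≤ B),
    wn r (trim (chain K (m + 1) fun i => alph (T i) (a i))) ≤ r ^ m * B := by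
  induction m with
  | zero =>
    intro T a h hB
    rw [pow_zero, one_mul]
    refine le_trans (wn_mono hr le_rfl _ _ ?_) hB
    intro S
    unfold trim
    by_cases hS : S = ∅
    · simp [hS]
    · rw [if_neg hS, if_neg hS, chain, abs_mul]
      unfold endv
      by_cases hST : S ⊆ T 0
      · have : S ⊆ T (Fin.last 0).castSucc := hST
        rw [if_pos this]
        exact mul_le_of_le_one_left (abs_nonneg _) (alph_abs_le _ _ _)
      · rw [alph_supp _ _ S hST]; simp
  | succ m ih =>
    intro T a h hB
    have h1 := ih (fun i => T i.succ) (fun i => a i.succ) (fun i => h i.succ) hB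
    have h2 := chain_step hK (m + 1) T a r hr (h 0)
    have h3 := wn_trim_le hr hr1 (chain K (m + 1 + 1) fun i => alph (T i) (a i))
    calc _ ≤ r * wn 1 (trim (chain K (m + 1 + 1) fun i => alph (T i) (a i))) := h3
      _ ≤ r * (r ^ m * B) := by gcongr; exact h2.trans h1
      _ = _ := by ring

/-- the total sum, with the left end separated -/
lemma chain_total {K : Finset (Fin N) → Finset (Fin N) → ℝ} (hK : KN K) (m : ℕ)
    (T : Fin (m + 2) → Finset (Fin N)) (a : Fin (m + 2) → Fin N → Bool) :
    ∑ S, chain K (m + 1) (fun i => alph (T i) (a i)) S - 1 =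
      ∑ S, trim (endv (fun S T => K T S) (T 1) (alph (T 0) (a 0))) S *
        trim (chain K m fun i => alph (T i.succ) (a i.succ)) S := by
  have hK' : KN (fun S T => K T S) := ⟨hK.ee, hK.er, hK.el⟩
  set c := chain K m fun i => alph (T i.succ) (a i.succ) with hc
  set f := endv (fun S T => K T S) (T 1) (alph (T 0) (a 0)) with hf
  have e1 : ∑ S, chain K (m + 1) (fun i => alph (T i) (a i)) S = ∑ S, f S * c S := by
    simp_rw [chain, Finset.mul_sum]
    rw [Finset.sum_comm]
    refine Finset.sum_congr rfl fun S _ => ?_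
    by_cases hS : S ⊆ T 1
    · simp only [hf, endv, if_pos hS, Finset.sum_mul]
      refine Finset.sum_congr rfl fun R _ => by ring
    · have : c S = 0 := chain_supp m _ (T 1) (alph_supp _ _) S hS
      rw [this]
      simp only [← hc, this]; simp
  have hf1 : f ∅ = 1 := endv_empty hK' _ _ _
  have hc1 : c ∅ = 1 := chain_empty hK m _ fun i => alph_empty _ _
  rw [e1, ← Finset.add_sum_erase _ _ (Finset.mem_univ (∅ : Finset (Fin N))),
    ← Finset.add_sum_erase _ (fun S => trim f S * trim c S) (Finset.mem_univ (∅ : Finset (Fin N)))]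
  have : ∑ x ∈ Finset.univ.erase ∅, f x * c x = ∑ x ∈ Finset.univ.erase ∅, trim f x * trim c x := by
    refine Finset.sum_congr rfl fun S hS => ?_
    rw [trim, trim, if_neg (Finset.ne_of_mem_erase hS), if_neg (Finset.ne_of_mem_erase hS)]
  rw [this, hf1, hc1]
  simp [trim]

end chains

end

section
open scoped BigOperators
open MeasureTheory

lemma opNorm_bound {m n : Type} [Fintype m] [Fintype n] (A : m → n → ℝ) (b : ℝ) (hb : 0 ≤ b)
    (h : opNorm A ≤ Real.sqrt b) (x : n → ℝ) :
    ∑ i, (∑ j, A i j * x j) ^ 2 ≤ b * ∑ j, x j ^ 2 := by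
  by_cases hx : x = 0
  · subst hx; simp
  · have hpos : 0 < ∑ j, x j ^ 2 := by
      obtain ⟨j, hj⟩ := Function.ne_iff.mp hx
      exact Finset.sum_pos' (fun _ _ => sq_nonneg _) ⟨j, Finset.mem_univ _, by
        have : x j ≠ 0 := hj
        positivity⟩
    have hbdd : BddAbove {r : ℝ | ∃ x : n → ℝ, x ≠ 0 ∧
        r = Real.sqrt (∑ i, (∑ j, A i j * x j) ^ 2) / Real.sqrt (∑ j, x j ^ 2)} := by
      refine ⟨Real.sqrt (∑ i, ∑ j, A i j ^ 2), ?_⟩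
      rintro r ⟨z, hz, rfl⟩
      apply div_le_of_le_mul₀ (Real.sqrt_nonneg _) (Real.sqrt_nonneg _)
      rw [← Real.sqrt_mul (Finset.sum_nonneg fun _ _ => Finset.sum_nonneg fun _ _ => sq_nonneg _)]
      apply Real.sqrt_le_sqrt
      rw [Finset.sum_mul]
      exact Finset.sum_le_sum fun i _ => Finset.sum_mul_sq_le_sq_mul_sq _ _ _
    have h1 := (le_csSup hbdd ⟨x, hx, rfl⟩).trans h
    rw [div_le_iff₀ (Real.sqrt_pos.mpr hpos), ← Real.sqrt_mul hb] at h1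
    exact (Real.sqrt_le_sqrt_iff (by positivity)).mp h1

lemma good_bound {N : ℕ} (U : Fin N → Fin N → ℝ) (hg : IsGood U)
    (T1 T2 : Finset (Fin N)) (d : ℕ) (hd : T1.card + T2.card ≤ d) (y : Fin N → ℝ) :
    ∑ i ∈ T1, (∑ j ∈ T2, U i j * y j) ^ 2 ≤ (100 * d * Real.log N / N) * ∑ j ∈ T2, y j ^ 2 := by
  have hl : 0 ≤ Real.log N := Real.log_natCast_nonneg N
  have hnn : 0 ≤ (100 * d * Real.log N / N) * ∑ j ∈ T2, y j ^ 2 := by positivity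
  rcases T1.eq_empty_or_nonempty with h1 | h1
  · subst h1; simpa using hnn
  rcases T2.eq_empty_or_nonempty with h2 | h2
  · subst h2; simp
  have h := hg T1 T2 h1 h2
  have hb : (100 * ((T1.card : ℝ) + T2.card) * Real.log N / N) ≤ 100 * d * Real.log N / N := by
    have : (T1.card : ℝ) + T2.card ≤ d := by exact_mod_cast hd
    gcongr
  have h3 := opNorm_bound _ _ (by positivity) (h.trans (Real.sqrt_le_sqrt hb)) (fun j => y j.1)
  rw [← Finset.sum_coe_sort T1, ← Finset.sum_coe_sort T2 (fun j => y j ^ 2)]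
  refine le_trans (le_of_eq ?_) h3
  refine Finset.sum_congr rfl fun i _ => ?_
  rw [← Finset.sum_coe_sort T2]

lemma KB_GG {N : ℕ} (U : Fin N → Fin N → ℝ) (hU : IsOrthogonal U)
    (T1 T2 : Finset (Fin N)) (s t v r1 r2 : ℝ) (hs : 0 < s) (hs1 : s ≤ 1) (ht : 0 < t) (ht1 : t ≤ 1)
    (hst : s * t = v)
    (hB : ∀ y : Fin N → ℝ, ∑ i ∈ T1, (∑ j ∈ T2, U i j * y j) ^ 2 ≤ v * ∑ j ∈ T2, y j ^ 2)
    (h1 : theta s ≤ r1) (h2 : theta t ≤ r2) :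
    KB (GG U) T1 T2 r1 r2 := by
  intro x y hx hy
  refine (lemmaA U hU T1 T2 s t hs hs1 ht ht1 (by rw [hst]; exact hB) x y hx hy).trans ?_
  have a1 := wn_mono (theta_nonneg s) h1 x x (fun _ => le_rfl)
  have a2 := wn_mono (theta_nonneg t) h2 y y (fun _ => le_rfl)
  unfold wn at a1 a2
  gcongr

lemma integral_prod_sgn_zero {N : ℕ} (S : Finset (Fin N)) (hS : S ≠ ∅) :
    ∫ x, ∏ i ∈ S, sgn (x i) ∂(gPi (Fin N)) = 0 := by
  rw [gPi_integral_prod S (fun _ => sgn)]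
  obtain ⟨i, hi⟩ := Finset.nonempty_iff_ne_empty.mpr hS
  exact Finset.prod_eq_zero hi integral_sgn

lemma KN_GG {N : ℕ} (U : Fin N → Fin N → ℝ) (hU : IsOrthogonal U) : KN (GG U) where
  ee := by simp [GG]
  er := by
    intro S hS
    simp only [GG, Finset.prod_empty, mul_one]
    exact integral_prod_sgn_zero S hS
  el := by
    intro S hS
    simp only [GG, Finset.prod_empty, one_mul]
    have h := integral_map (μ := gPi (Fin N)) (φ := fun (x : Fin N → ℝ) j => ∑ l, U l j * x l)
      (f := fun y => ∏ j ∈ S, sgn (y j)) (Measurable.aemeasurable (by fun_prop))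
      (Measurable.aestronglyMeasurable (Finset.measurable_prod _ fun j _ =>
        sgn_measurable.comp (by fun_prop)))
    rw [gPi_rot U hU] at h
    rw [← h]
    exact integral_prod_sgn_zero S hS

lemma GG_bilin {N : ℕ} (U : Fin N → Fin N → ℝ) (x y : Finset (Fin N) → ℝ) :
    ∑ S, ∑ T, x S * GG U S T * y T =
    ∫ z, (∑ S, x S * ∏ i ∈ S, sgn (z i)) * (∑ T, y T * ∏ j ∈ T, sgn (∑ l, U l j * z l))
      ∂(gPi (Fin N)) := by
  have hInt : ∀ S T : Finset (Fin N), Integrable (fun z : Fin N → ℝ =>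
      (x S * ∏ i ∈ S, sgn (z i)) * (y T * ∏ j ∈ T, sgn (∑ l, U l j * z l))) (gPi (Fin N)) := by
    intro S T
    apply integrable_of_bdd (C := |x S| * |y T|)
    · apply Measurable.mul <;> apply Measurable.const_mul
      · exact Finset.measurable_prod _ fun j _ => sgn_measurable.comp (by fun_prop)
      · exact Finset.measurable_prod _ fun j _ => sgn_measurable.comp (by fun_prop)
    · intro z
      rw [abs_mul, abs_mul, abs_mul]
      exact mul_le_mul (mul_le_of_le_one_right (abs_nonneg _) 
          (prod_abs_le_one _ _ fun _ => (sgn_abs _).le))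
        (mul_le_of_le_one_right (abs_nonneg _) (prod_abs_le_one _ _ fun _ => (sgn_abs _).le))
          (by positivity) (abs_nonneg _)
  simp_rw [Finset.sum_mul_sum]
  rw [integral_finsetSum _ fun S _ => integrable_finsetSum _ fun T _ => hInt S T]
  refine Finset.sum_congr rfl fun S _ => ?_
  rw [integral_finsetSum _ fun T _ => hInt S T]
  refine Finset.sum_congr rfl fun T _ => ?_
  unfold GG
  rw [← integral_const_mul, ← integral_mul_const]
  congr 1; ext w; ring

lemma GG_pos {N : ℕ} (U : Fin N → Fin N → ℝ) (T1 T2 : Finset (Fin N)) (a b : Fin N → Bool) :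
    0 ≤ ∑ S, ∑ T, alph T1 a S * GG U S T * alph T2 b T := by
  rw [GG_bilin]
  have h : ∀ (a : Bool) (z : ℝ), 0 ≤ 1 + sg a * sgn z := by
    intro a z
    unfold sgn
    cases a <;> simp [sg] <;> split_ifs <;> norm_num
  apply integral_nonneg
  intro z
  have e1 := prod_one_add_eq T1 a (fun i => sgn (z i))
  have e2 := prod_one_add_eq T2 b (fun j => sgn (∑ l, U l j * z l))
  show 0 ≤ _ * _
  rw [← e1, ← e2]
  exact mul_nonneg (Finset.prod_nonneg fun _ _ => h _ _) (Finset.prod_nonneg fun _ _ => h _ _)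

lemma endv_pos_right {N : ℕ} (U : Fin N → Fin N → ℝ) (T1 T2 : Finset (Fin N)) (b w : Fin N → Bool) :
    0 ≤ ∑ S, endv (GG U) T1 (alph T2 b) S * chiB S w := by
  refine (GG_pos U T1 T2 w b).trans (le_of_eq ?_)
  refine Finset.sum_congr rfl fun S _ => ?_
  unfold endv
  by_cases h : S ⊆ T1
  · rw [if_pos h, Finset.sum_mul]
    refine Finset.sum_congr rfl fun T _ => ?_
    rw [alph, if_pos h]; ring
  · simp [h, alph]

lemma endv_pos_left {N : ℕ} (U : Fin N → Fin N → ℝ) (T1 T2 : Finset (Fin N)) (b w : Fin N → Bool) :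
    0 ≤ ∑ S, endv (fun S T => GG U T S) T1 (alph T2 b) S * chiB S w := by
  refine (GG_pos U T2 T1 b w).trans (le_of_eq ?_)
  rw [Finset.sum_comm]
  refine Finset.sum_congr rfl fun S _ => ?_
  unfold endv
  by_cases h : S ⊆ T1
  · rw [if_pos h, Finset.sum_mul]
    refine Finset.sum_congr rfl fun T _ => ?_
    rw [alph, alph, if_pos h]; ring
  · simp [h, alph]

lemma KB_swap {N : ℕ} {K : Finset (Fin N) → Finset (Fin N) → ℝ} {T1 T2 : Finset (Fin N)} {r1 r2 : ℝ}
    (h : KB K T1 T2 r1 r2) : KB (fun S T => K T S) T2 T1 r2 r1 := by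
  intro x y hx hy
  have := h y x hy hx
  rw [Finset.sum_comm, mul_comm] at this
  refine le_trans (le_of_eq ?_) this
  congr 1
  refine Finset.sum_congr rfl fun S _ => Finset.sum_congr rfl fun T _ => by ring

lemma exists_delta (r : ℝ) (hr : 0 < r) (hr1 : r ≤ 1) :
    ∃ (n : ℕ) (δ : ℝ), 1 ≤ n ∧ δ * (2 * n - 1) = 1 ∧ r ≤ δ ∧ δ ≤ 3 * r := by
  have h1r : 1 ≤ 1 / r := by rw [le_div_iff₀ hr]; linarith
  set n := ⌊(1 / r + 1) / 2⌋₊ with hn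
  have hn1 : 1 ≤ n := Nat.le_floor (by push_cast; linarith)
  have hn1' : (1:ℝ) ≤ n := by exact_mod_cast hn1
  have hle : (n : ℝ) ≤ (1 / r + 1) / 2 := Nat.floor_le (by linarith)
  have hlt : (1 / r + 1) / 2 < n + 1 := Nat.lt_floor_add_one _
  have hp : (0:ℝ) < 2 * n - 1 := by linarith
  refine ⟨n, 1 / (2 * n - 1), hn1, by field_simp, ?_, ?_⟩
  · rw [le_div_iff₀ hp]
    have : 2 * (n:ℝ) - 1 ≤ 1 / r := by linarith
    calc r * (2 * n - 1) ≤ r * (1 / r) := by gcongr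
      _ = 1 := by field_simp
  · rw [div_le_iff₀ hp]
    have h3 : 1 / r ≤ 3 * (2 * (n:ℝ) - 1) := by linarith
    calc 1 = r * (1 / r) := by field_simp
      _ ≤ r * (3 * (2 * (n:ℝ) - 1)) := by gcongr
      _ = _ := by ring

lemma chain_one {N : ℕ} {K : Finset (Fin N) → Finset (Fin N) → ℝ} (r : ℝ) (hr : 0 ≤ r)
    (T : Fin 2 → Finset (Fin N)) (a : Fin 2 → Fin N → Bool) :
    wn r (trim (chain K 1 fun i => alph (T i) (a i))) ≤
      wn r (trim (endv K (T 0) (alph (T 1) (a 1)))) := by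
  refine (wn_mono hr le_rfl _ _ ?_)
  intro S
  unfold trim
  by_cases hS : S = ∅
  · simp [hS]
  · rw [if_neg hS, if_neg hS, chain, abs_mul]
    unfold endv
    by_cases hST : S ⊆ T 0
    · rw [if_pos hST]
      exact mul_le_of_le_one_left (abs_nonneg _) (alph_abs_le _ _ _)
    · rw [alph_supp _ _ S hST]; simp

/-- separating the left end and one more kernel -/
lemma chain_total2 {N : ℕ} {K : Finset (Fin N) → Finset (Fin N) → ℝ} (hK : KN K) (m : ℕ)
    (T : Fin (m + 3) → Finset (Fin N)) (a : Fin (m + 3) → Fin N → Bool) (r1 r2 : ℝ)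
    (hr1 : 0 ≤ r1)
    (h : KB K (T 1) (T 2) r1 r2) :
    |∑ S, chain K (m + 2) (fun i => alph (T i) (a i)) S - 1| ≤
      Real.sqrt (wn r1 (trim (endv (fun S T => K T S) (T 1) (alph (T 0) (a 0))))) *
      Real.sqrt (wn r2 (trim (chain K m fun i => alph (T i.succ.succ) (a i.succ.succ)))) := by
  rw [chain_total hK (m + 1) T a]
  set f := endv (fun S T => K T S) (T 1) (alph (T 0) (a 0)) with hf
  set c := chain K m fun i => alph (T i.succ.succ) (a i.succ.succ) with hc
  have h1 := h (fun S => trim f S * alph (T 1) (a 1) S) (trim c) (by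
    intro S hS; simp [alph_supp _ _ S hS])
    (trim_supp (chain_supp m _ (T 2) (alph_supp _ _)))
  have e : ∑ S, trim f S * trim (chain K (m + 1) fun i => alph (T i.succ) (a i.succ)) S =
      ∑ S, ∑ R, (trim f S * alph (T 1) (a 1) S) * K S R * trim c R := by
    refine Finset.sum_congr rfl fun S _ => ?_
    by_cases hS : S = ∅
    · simp [trim, hS]
    · have h2 : trim (chain K (m + 1) fun i => alph (T i.succ) (a i.succ)) S =
          alph (T 1) (a 1) S * ∑ R, K S R * trim c R := by
        rw [trim, if_neg hS, chain, trim_sum hK _ S hS]; rfl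
      rw [h2, Finset.mul_sum, Finset.mul_sum]
      refine Finset.sum_congr rfl fun R _ => by ring
  rw [e]
  refine h1.trans ?_
  have h3 := wn_mono hr1 le_rfl (fun S => trim f S * alph (T 1) (a 1) S) (trim f) (by
    intro S
    rw [abs_mul]
    exact mul_le_of_le_one_right (abs_nonneg _) (alph_abs_le _ _ _))
  unfold wn at h3 ⊢
  gcongr

end

section
open scoped BigOperators
open MeasureTheory

/-- goodness at depth d in quadratic-form shape -/
def GoodAt {N : ℕ} (U : Fin N → Fin N → ℝ) (d : ℕ) (v : ℝ) : Prop :=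
  ∀ T1 T2 : Finset (Fin N), T1.card + T2.card ≤ d → ∀ y : Fin N → ℝ,
    ∑ i ∈ T1, (∑ j ∈ T2, U i j * y j) ^ 2 ≤ v * ∑ j ∈ T2, y j ^ 2

section

lemma KB_1r {N : ℕ} {U : Fin N → Fin N → ℝ} (hU : IsOrthogonal U) {d : ℕ} {v : ℝ}
    (hg : GoodAt U d v) (hv : 0 < v) (hv1 : v ≤ 1 / 2)
    (T1 T2 : Finset (Fin N)) (hT : T1.card + T2.card ≤ d) :
    KB (GG U) T1 T2 1 (2 * v) :=
  KB_GG U hU T1 T2 1 v v 1 (2 * v) one_pos le_rfl hv (by linarith) (by ring) (hg T1 T2 hT)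
    (theta_le_one 1) (theta_le v hv.le)

lemma KB_r1 {N : ℕ} {U : Fin N → Fin N → ℝ} (hU : IsOrthogonal U) {d : ℕ} {v : ℝ}
    (hg : GoodAt U d v) (hv : 0 < v) (hv1 : v ≤ 1 / 2)
    (T1 T2 : Finset (Fin N)) (hT : T1.card + T2.card ≤ d) :
    KB (GG U) T1 T2 (2 * v) 1 :=
  KB_GG U hU T1 T2 v 1 v (2 * v) 1 hv (by linarith) one_pos le_rfl (by ring) (hg T1 T2 hT)
    (theta_le v hv.le) (theta_le_one 1)

lemma KB_qq {N : ℕ} {U : Fin N → Fin N → ℝ} (hU : IsOrthogonal U) {d : ℕ} {v : ℝ}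
    (hg : GoodAt U d v) (hv : 0 < v) (hv1 : v ≤ 1 / 2)
    (T1 T2 : Finset (Fin N)) (hT : T1.card + T2.card ≤ d) :
    KB (GG U) T1 T2 (2 * Real.sqrt v) (2 * Real.sqrt v) :=
  KB_GG U hU T1 T2 (Real.sqrt v) (Real.sqrt v) v _ _ (Real.sqrt_pos.mpr hv)
    (Real.sqrt_le_one.mpr (by linarith)) (Real.sqrt_pos.mpr hv)
    (Real.sqrt_le_one.mpr (by linarith)) (Real.mul_self_sqrt hv.le) (hg T1 T2 hT)
    (theta_le _ (Real.sqrt_nonneg _)) (theta_le _ (Real.sqrt_nonneg _))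

lemma right_end {N : ℕ} {U : Fin N → Fin N → ℝ} (hU : IsOrthogonal U) {d : ℕ} {v : ℝ}
    (hg : GoodAt U d v) (hv : 0 < v) (hv1 : v ≤ 1 / 2)
    (T1 T2 : Finset (Fin N)) (hT : T1.card + T2.card ≤ d) (a : Fin N → Bool)
    (n : ℕ) (hn : 1 ≤ n) (δ : ℝ) (hδ : δ * (2 * n - 1) = 1) (hsm : 2 * δ * (2 * v) * d ≤ 1) :
    wn δ (trim (endv (GG U) T1 (alph T2 a))) ≤ 4 * δ * (2 * v) * d :=
  end_bound (KN_GG U hU) T1 T2 a (2 * v) (by linarith) (KB_1r hU hg hv hv1 T1 T2 hT)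
    (endv_pos_right U T1 T2 a) d (by omega) n hn δ hδ hsm

lemma left_end {N : ℕ} {U : Fin N → Fin N → ℝ} (hU : IsOrthogonal U) {d : ℕ} {v : ℝ}
    (hg : GoodAt U d v) (hv : 0 < v) (hv1 : v ≤ 1 / 2)
    (T1 T2 : Finset (Fin N)) (hT : T2.card + T1.card ≤ d) (a : Fin N → Bool)
    (n : ℕ) (hn : 1 ≤ n) (δ : ℝ) (hδ : δ * (2 * n - 1) = 1) (hsm : 2 * δ * (2 * v) * d ≤ 1) :
    wn δ (trim (endv (fun S T => GG U T S) T1 (alph T2 a))) ≤ 4 * δ * (2 * v) * d := by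
  have hK := KN_GG U hU
  exact end_bound (K := fun S T => GG U T S) ⟨hK.ee, hK.er, hK.el⟩ T1 T2 a (2 * v) (by linarith)
    (KB_swap (KB_r1 hU hg hv hv1 T2 T1 hT))
    (endv_pos_left U T1 T2 a) d (by omega) n hn δ hδ hsm

lemma bound_k3 {N : ℕ} {U : Fin N → Fin N → ℝ} (hU : IsOrthogonal U) {d : ℕ} {v : ℝ}
    (hg : GoodAt U d v) (hv : 0 < v) (hv1 : v ≤ 1 / 2)
    (T : Fin 3 → Finset (Fin N)) (a : Fin 3 → Fin N → Bool)
    (hT : ∀ i : Fin 2, (T i.castSucc).card + (T i.succ).card ≤ d)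
    (hs : 288 * (d:ℝ) ^ 2 * (2 * v) ^ 2 ≤ 1) :
    (∑ S, chain (GG U) 2 (fun i => alph (T i) (a i)) S - 1) ^ 2 ≤
      288 * (d:ℝ) ^ 2 * (2 * v) ^ 2 := by
  have hsm : 2 * 1 * (2 * v) * (d:ℝ) ≤ 1 := by
    by_contra hc
    push Not at hc
    have : (1:ℝ) < (2 * 1 * (2 * v) * (d:ℝ)) ^ 2 := by
      nlinarith
    nlinarith
  rw [chain_total (KN_GG U hU) 1 T a]
  have h1 := left_end hU hg hv hv1 (T 1) (T 0) (hT 0) (a 0) 1 le_rfl 1 (by norm_num) hsm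
  have h2 := right_end hU hg hv hv1 (T 1) (T 2) (hT 1) (a 2) 1 le_rfl 1 (by norm_num) hsm
  have h3 := (chain_one (K := GG U) 1 zero_le_one (fun i => T i.succ) (fun i => a i.succ)).trans h2
  have hcs := Finset.sum_mul_sq_le_sq_mul_sq Finset.univ
    (trim (endv (fun S T => GG U T S) (T 1) (alph (T 0) (a 0))))
    (trim (chain (GG U) 1 fun i => alph (T i.succ) (a i.succ)))
  refine hcs.trans ?_
  unfold wn at h1 h3
  simp only [one_pow, one_mul] at h1 h3
  have := mul_le_mul h1 h3 (Finset.sum_nonneg fun _ _ => sq_nonneg _) (by positivity)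
  refine this.trans ?_
  nlinarith [sq_nonneg ((d:ℝ) * v)]

lemma bound_k4 {N : ℕ} {U : Fin N → Fin N → ℝ} (hU : IsOrthogonal U) {d : ℕ} {v : ℝ}
    (hg : GoodAt U d v) (hv : 0 < v) (hv1 : v ≤ 1 / 2)
    (T : Fin 4 → Finset (Fin N)) (a : Fin 4 → Fin N → Bool)
    (hT : ∀ i : Fin 3, (T i.castSucc).card + (T i.succ).card ≤ d) (hv4 : v ≤ 1 / 4)
    (hs : 288 * (d:ℝ) ^ 2 * (2 * v) ^ 3 ≤ 1) :
    (∑ S, chain (GG U) 3 (fun i => alph (T i) (a i)) S - 1) ^ 2 ≤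
      288 * (d:ℝ) ^ 2 * (2 * v) ^ 3 := by
  have hq0 : 0 < 2 * Real.sqrt v := by have := Real.sqrt_pos.mpr hv; linarith
  have hsq := Real.sq_sqrt hv.le
  have hq1 : 2 * Real.sqrt v ≤ 1 := by
    nlinarith [Real.sqrt_nonneg v]
  obtain ⟨n, δ, hn, hδ, hd1, hd2⟩ := exists_delta (2 * Real.sqrt v) hq0 hq1
  have hδ0 : 0 < δ := lt_of_lt_of_le hq0 hd1
  have hδ2 : δ ^ 2 ≤ 18 * (2 * v) := by nlinarith
  have hX : (4 * δ * (2 * v) * d) ^ 2 ≤ 288 * (d:ℝ) ^ 2 * (2 * v) ^ 3 := by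
    have : (4 * δ * (2 * v) * d) ^ 2 = 16 * ((2 * v) * d) ^ 2 * δ ^ 2 := by ring
    rw [this]
    calc _ ≤ 16 * ((2 * v) * d) ^ 2 * (18 * (2 * v)) := by gcongr
      _ = _ := by ring
  have hsm : 2 * δ * (2 * v) * (d:ℝ) ≤ 1 := by
    have h4 := hX.trans hs
    by_contra hc
    push Not at hc
    nlinarith
  have h1 := left_end hU hg hv hv1 (T 1) (T 0) (hT 0) (a 0) n hn δ hδ hsm
  have h2 := right_end hU hg hv hv1 (T 2) (T 3) (hT 2) (a 3) n hn δ hδ hsm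
  have h3 := (chain_one (K := GG U) δ hδ0.le (fun i => T i.succ.succ) (fun i => a i.succ.succ)).trans h2
  have h1' := (wn_mono hq0.le hd1 _ _ (fun _ => le_rfl)).trans h1
  have h3' := (wn_mono hq0.le hd1 _ _ (fun _ => le_rfl)).trans h3
  have ht := chain_total2 (KN_GG U hU) 1 T a (2 * Real.sqrt v) (2 * Real.sqrt v) hq0.le
    (KB_qq hU hg hv hv1 (T 1) (T 2) (hT 1))
  have h5 : |∑ S, chain (GG U) 3 (fun i => alph (T i) (a i)) S - 1| ≤ 4 * δ * (2 * v) * d := by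
    refine ht.trans ?_
    have hm := mul_le_mul (Real.sqrt_le_sqrt h1') (Real.sqrt_le_sqrt h3') (Real.sqrt_nonneg _)
      (Real.sqrt_nonneg _)
    rw [Real.mul_self_sqrt (by positivity)] at hm
    exact hm
  rw [← sq_abs]
  exact (pow_le_pow_left₀ (abs_nonneg _) h5 2).trans hX

lemma bound_k5 {N : ℕ} {U : Fin N → Fin N → ℝ} (hU : IsOrthogonal U) {d : ℕ} {v : ℝ}
    (hg : GoodAt U d v) (hv : 0 < v) (hv1 : v ≤ 1 / 2)
    (m : ℕ) (T : Fin (m + 5) → Finset (Fin N)) (a : Fin (m + 5) → Fin N → Bool)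
    (hT : ∀ i : Fin (m + 4), (T i.castSucc).card + (T i.succ).card ≤ d)
    (hs : 6 * (2 * v) ^ 2 * (d:ℝ) ≤ 1) :
    (∑ S, chain (GG U) (m + 4) (fun i => alph (T i) (a i)) S - 1) ^ 2 ≤
      288 * (d:ℝ) ^ 2 * (2 * v) ^ (m + 4) := by
  have hr0 : 0 < 2 * v := by linarith
  have hr1 : 2 * v ≤ 1 := by linarith
  obtain ⟨n, δ, hn, hδ, hd1, hd2⟩ := exists_delta (2 * v) hr0 hr1
  have hsm : 2 * δ * (2 * v) * (d:ℝ) ≤ 1 := by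
    calc 2 * δ * (2 * v) * (d:ℝ) ≤ 2 * (3 * (2 * v)) * (2 * v) * (d:ℝ) := by gcongr
      _ = 6 * (2 * v) ^ 2 * (d:ℝ) := by ring
      _ ≤ 1 := hs
  have hB : 4 * δ * (2 * v) * d ≤ 12 * (2 * v) ^ 2 * d := by
    calc 4 * δ * (2 * v) * (d:ℝ) ≤ 4 * (3 * (2 * v)) * (2 * v) * (d:ℝ) := by gcongr
      _ = _ := by ring
  set B := 12 * (2 * v) ^ 2 * (d:ℝ) with hBd
  have hB0 : 0 ≤ B := by positivity
  have h1 := (left_end hU hg hv hv1 (T 1) (T 0) (hT 0) (a 0) n hn δ hδ hsm).trans hB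
  have h1' := (wn_mono hr0.le hd1 _ _ (fun _ => le_rfl)).trans h1
  have h2 := (right_end hU hg hv hv1 (T (Fin.last (m + 3)).castSucc) (T (Fin.last (m + 4)))
    (by simpa using hT (Fin.last (m + 3))) (a (Fin.last (m + 4))) n hn δ hδ hsm).trans hB
  have h2' := (wn_mono hr0.le hd1 _ _ (fun _ => le_rfl)).trans h2
  have h3 := chain_bound (KN_GG U hU) (2 * v) hr0.le hr1 B m (fun i => T i.succ.succ.succ)
    (fun i => a i.succ.succ.succ)
    (fun i => KB_1r hU hg hv hv1 _ _ (hT i.succ.succ.succ)) h2'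
  have h4 := chain_step (KN_GG U hU) (m + 1) (fun i => T i.succ.succ) (fun i => a i.succ.succ)
    (2 * v) hr0.le (KB_1r hU hg hv hv1 _ _ (hT 2))
  have h5 := h4.trans h3
  have ht := chain_total2 (KN_GG U hU) (m + 2) T a (2 * v) 1 hr0.le
    (KB_r1 hU hg hv hv1 (T 1) (T 2) (hT 1))
  have h6 := mul_le_mul (Real.sqrt_le_sqrt h1') (Real.sqrt_le_sqrt h5) (Real.sqrt_nonneg _)
      (Real.sqrt_nonneg _)
  have h7 := pow_le_pow_left₀ (abs_nonneg _) (ht.trans h6) 2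
  rw [sq_abs, mul_pow, Real.sq_sqrt hB0, Real.sq_sqrt (by positivity)] at h7
  refine h7.trans ?_
  rw [hBd]
  have : 0 ≤ (d:ℝ) ^ 2 * (2 * v) ^ (m + 4) := by positivity
  calc _ = 144 * ((d:ℝ) ^ 2 * (2 * v) ^ (m + 4)) := by ring
    _ ≤ _ := by linarith

end

end

section
open scoped BigOperators
open MeasureTheory

section
variable {κ : Type} [Fintype κ] [DecidableEq κ]

lemma cubeInd_insert (c : Finset κ) (a z : κ → Bool) (p : κ) (hp : p ∉ c) (b : Bool) :
    cubeInd (insert p c) (Function.update a p b) z =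
      (1 + sg b * sg (z p)) / 2 * cubeInd c a z := by
  unfold cubeInd
  rw [Finset.prod_insert hp]
  congr 1
  · simp
  · refine Finset.prod_congr rfl fun q hq => ?_
    have : q ≠ p := fun h => hp (h ▸ hq)
    simp [this]

lemma cubeInd_node (c : Finset κ) (a z : κ → Bool) (p : κ) (hp : p ∉ c) (f0 f1 : ℝ) :
    cubeInd c a z * (if z p then f1 else f0) =
      cubeInd (insert p c) (Function.update a p false) z * f0 +
      cubeInd (insert p c) (Function.update a p true) z * f1 := by
  rw [cubeInd_insert c a z p hp, cubeInd_insert c a z p hp]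
  cases z p <;> simp [sg]

lemma cubeInd_mem (c : Finset κ) (a z : κ → Bool) (p : κ) (hp : p ∈ c) (f0 f1 : ℝ) :
    cubeInd c a z * (if z p then f1 else f0) =
      cubeInd c a z * (if a p then f1 else f0) := by
  by_cases h : z p = a p
  · rw [h]
  · have : cubeInd c a z = 0 := by
      unfold cubeInd
      refine Finset.prod_eq_zero hp ?_
      revert h
      cases z p <;> cases a p <;> simp [sg]
    rw [this]; simp

lemma cubeInd_nonneg (c : Finset κ) (a z : κ → Bool) : 0 ≤ cubeInd c a z := by
  unfold cubeInd
  refine Finset.prod_nonneg fun p _ => ?_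
  cases z p <;> cases a p <;> simp [sg] 

lemma sum_cubeInd (c : Finset κ) (a : κ → Bool) :
    ∑ z : κ → Bool, cubeInd c a z * (1 / 2 ^ Fintype.card κ) = 1 / 2 ^ c.card := by
  have h : ∀ z : κ → Bool, cubeInd c a z =
      ∏ p, (if p ∈ c then (1 + sg (a p) * sg (z p)) / 2 else 1) := by
    intro z
    unfold cubeInd
    rw [Finset.prod_ite_mem, Finset.univ_inter]
  have h2 : ∑ z : κ → Bool, cubeInd c a z = 2 ^ (Fintype.card κ - c.card) := by
    simp_rw [h]
    rw [← Fintype.piFinset_univ, Finset.sum_prod_piFinset (s := Finset.univ)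
      (g := fun p b => if p ∈ c then (1 + sg (a p) * sg b) / 2 else 1)]
    have : ∀ p, ∑ b : Bool, (if p ∈ c then (1 + sg (a p) * sg b) / 2 else 1) =
        if p ∈ c then (1:ℝ) else 2 := by
      intro p
      by_cases hp : p ∈ c
      · cases a p <;> simp [hp, sg]
      · simp [hp]
    simp_rw [this]
    rw [Finset.prod_ite]
    simp only [Finset.prod_const_one, one_mul, Finset.prod_const]
    congr 1
    rw [← Finset.compl_filter, Finset.card_compl]
    simp
  rw [← Finset.sum_mul, h2]
  have hc : c.card ≤ Fintype.card κ := Finset.card_le_univ c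
  rw [mul_one_div, div_eq_div_iff (by positivity) (by positivity), ← pow_add, one_mul]
  congr 1
  omega

/-- tree induction, pointwise closeness -/
lemma tree_diff (w : (κ → Bool) → ℝ) (d : ℕ) (ε : ℝ)
    (h : ∀ (c : Finset κ) (a : κ → Bool), c.card ≤ d →
      |∑ z, w z * cubeInd c a z| ≤ ε * (1 / 2 ^ c.card)) (hε : 0 ≤ ε) (t : DTree κ) :
    ∀ (c : Finset κ) (a : κ → Bool), c.card + t.depth ≤ d →
      |∑ z, w z * (cubeInd c a z * t.eval z)| ≤ ε * (1 / 2 ^ c.card) := by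
  induction t with
  | leaf b =>
    intro c a hc
    cases b
    · simp [DTree.eval]; positivity
    · simpa [DTree.eval] using h c a (by simpa [DTree.depth] using hc)
  | node p t0 t1 ih0 ih1 =>
    intro c a hc
    simp only [DTree.depth] at hc
    by_cases hp : p ∈ c
    · simp only [DTree.eval]
      simp_rw [cubeInd_mem c a _ p hp]
      cases a p
      · simpa using ih0 c a (by have := le_max_left t0.depth t1.depth; omega)
      · simpa using ih1 c a (by have := le_max_right t0.depth t1.depth; omega)
    · simp only [DTree.eval]
      simp_rw [cubeInd_node c a _ p hp, mul_add]
      rw [Finset.sum_add_distrib]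
      have hcard := Finset.card_insert_of_notMem hp
      have i0 := ih0 (insert p c) (Function.update a p false)
        (by have := le_max_left t0.depth t1.depth; omega)
      have i1 := ih1 (insert p c) (Function.update a p true)
        (by have := le_max_right t0.depth t1.depth; omega)
      rw [hcard] at i0 i1
      refine (abs_add_le _ _).trans ((add_le_add i0 i1).trans (le_of_eq ?_))
      rw [pow_succ]; field_simp; ring

lemma sqrt_superadd (p1 p2 q1 q2 : ℝ) (h1 : 0 ≤ p1) (h2 : 0 ≤ p2) (h3 : 0 ≤ q1) (h4 : 0 ≤ q2) :
    Real.sqrt (p1 * q1) + Real.sqrt (p2 * q2) ≤ Real.sqrt ((p1 + p2) * (q1 + q2)) := by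
  rw [Real.sqrt_mul h1, Real.sqrt_mul h2]
  apply Real.le_sqrt_of_sq_le
  have e1 := Real.sq_sqrt h1
  have e2 := Real.sq_sqrt h2
  have e3 := Real.sq_sqrt h3
  have e4 := Real.sq_sqrt h4
  generalize Real.sqrt p1 = x1 at *
  generalize Real.sqrt p2 = x2 at *
  generalize Real.sqrt q1 = y1 at *
  generalize Real.sqrt q2 = y2 at *
  subst e1 e2 e3 e4
  nlinarith [sq_nonneg (x1 * y2 - x2 * y1)]

lemma eval_bounds (t : DTree κ) (z : κ → Bool) : 0 ≤ t.eval z ∧ t.eval z ≤ 1 := by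
  induction t with
  | leaf b => cases b <;> simp [DTree.eval]
  | node p t0 t1 ih0 ih1 => simp only [DTree.eval]; split_ifs <;> assumption

/-- tree induction, Hellinger affinity -/
lemma tree_hell (w u : (κ → Bool) → ℝ) (hw : ∀ z, 0 ≤ w z) (hu : ∀ z, 0 ≤ u z) (d : ℕ)
    (ell : Finset κ → (κ → Bool) → ℝ)
    (hell : ∀ c a p, p ∉ c → ell (insert p c) (Function.update a p false) +
      ell (insert p c) (Function.update a p true) = 2 * ell c a)
    (h : ∀ (c : Finset κ) (a : κ → Bool), c.card ≤ d →
      1 / 2 ^ c.card * ell c a ≤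
        Real.sqrt ((∑ z, w z * cubeInd c a z) * (∑ z, u z * cubeInd c a z))) (t : DTree κ) :
    ∀ (c : Finset κ) (a : κ → Bool), c.card + t.depth ≤ d →
      1 / 2 ^ c.card * ell c a ≤
      Real.sqrt ((∑ z, w z * (cubeInd c a z * t.eval z)) * (∑ z, u z * (cubeInd c a z * t.eval z))) +
      Real.sqrt ((∑ z, w z * (cubeInd c a z * (1 - t.eval z))) *
        (∑ z, u z * (cubeInd c a z * (1 - t.eval z)))) := by
  induction t with
  | leaf b =>
    intro c a hc
    have := h c a (by simpa [DTree.depth] using hc)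
    cases b
    · simpa [DTree.eval] using this
    · simpa [DTree.eval] using this
  | node p t0 t1 ih0 ih1 =>
    intro c a hc
    simp only [DTree.depth] at hc
    have hsub : ∀ z : κ → Bool, (1 - if z p then t1.eval z else t0.eval z) =
        if z p then 1 - t1.eval z else 1 - t0.eval z := by
      intro z; split_ifs <;> rfl
    by_cases hp : p ∈ c
    · simp only [DTree.eval, hsub]
      simp_rw [cubeInd_mem c a _ p hp]
      cases a p
      · simpa using ih0 c a (by have := le_max_left t0.depth t1.depth; omega)
      · simpa using ih1 c a (by have := le_max_right t0.depth t1.depth; omega)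
    · simp only [DTree.eval, hsub]
      simp_rw [cubeInd_node c a _ p hp, mul_add]
      simp_rw [Finset.sum_add_distrib]
      have hcard := Finset.card_insert_of_notMem hp
      have i0 := ih0 (insert p c) (Function.update a p false)
        (by have := le_max_left t0.depth t1.depth; omega)
      have i1 := ih1 (insert p c) (Function.update a p true)
        (by have := le_max_right t0.depth t1.depth; omega)
      rw [hcard] at i0 i1
      have hm := hell c a p hp
      have nn : ∀ (w : (κ → Bool) → ℝ), (∀ z, 0 ≤ w z) → ∀ c a (t : DTree κ),
          0 ≤ ∑ z, w z * (cubeInd c a z * t.eval z) := fun w hw c a t =>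
        Finset.sum_nonneg fun z _ => mul_nonneg (hw z) (mul_nonneg (cubeInd_nonneg _ _ _)
          (eval_bounds t z).1)
      have nn' : ∀ (w : (κ → Bool) → ℝ), (∀ z, 0 ≤ w z) → ∀ c a (t : DTree κ),
          0 ≤ ∑ z, w z * (cubeInd c a z * (1 - t.eval z)) := fun w hw c a t =>
        Finset.sum_nonneg fun z _ => mul_nonneg (hw z) (mul_nonneg (cubeInd_nonneg _ _ _)
          (sub_nonneg.mpr (eval_bounds t z).2))
      have s1 := sqrt_superadd _ _ _ _ (nn w hw (insert p c) (Function.update a p false) t0)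
        (nn w hw (insert p c) (Function.update a p true) t1)
        (nn u hu (insert p c) (Function.update a p false) t0)
        (nn u hu (insert p c) (Function.update a p true) t1)
      have s2 := sqrt_superadd _ _ _ _ (nn' w hw (insert p c) (Function.update a p false) t0)
        (nn' w hw (insert p c) (Function.update a p true) t1)
        (nn' u hu (insert p c) (Function.update a p false) t0)
        (nn' u hu (insert p c) (Function.update a p true) t1)
      have e : 1 / 2 ^ c.card * ell c a = 1 / 2 ^ (c.card + 1) *
          ell (insert p c) (Function.update a p false) + 1 / 2 ^ (c.card + 1) *
          ell (insert p c) (Function.update a p true) := by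
        rw [← mul_add, hm, pow_succ]; field_simp
      rw [e]
      linarith

lemma hell_tv (P Q b : ℝ) (hP : 0 ≤ P) (hP1 : P ≤ 1) (hQ : 0 ≤ Q) (hQ1 : Q ≤ 1) (hb : 0 ≤ b)
    (h : b ≤ Real.sqrt (P * Q) + Real.sqrt ((1 - P) * (1 - Q))) : (P - Q) ^ 2 ≤ 1 - b ^ 2 := by
  have h1 : 0 ≤ P * Q := mul_nonneg hP hQ
  have h2 : 0 ≤ (1 - P) * (1 - Q) := mul_nonneg (by linarith) (by linarith)
  have hb2 := pow_le_pow_left₀ hb h 2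
  rw [add_sq, Real.sq_sqrt h1, Real.sq_sqrt h2, mul_assoc, ← Real.sqrt_mul h1] at hb2
  have : 2 * Real.sqrt (P * Q * ((1 - P) * (1 - Q))) ≤ P * (1 - P) + Q * (1 - Q) := by
    have h3 : 0 ≤ P * (1 - P) := mul_nonneg hP (by linarith)
    have h4 : 0 ≤ Q * (1 - Q) := mul_nonneg hQ (by linarith)
    have : P * Q * ((1 - P) * (1 - Q)) ≤ ((P * (1 - P) + Q * (1 - Q)) / 2) ^ 2 := by
      nlinarith [sq_nonneg (P * (1 - P) - Q * (1 - Q))]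
    have := Real.sqrt_le_sqrt this
    rw [Real.sqrt_sq (by linarith)] at this
    linarith
  nlinarith

/-- expectation as a finite weighted sum -/
lemma exists_weights {Ω : Type} [MeasurableSpace Ω] (μ : Measure Ω) [IsProbabilityMeasure μ]
    (g : Ω → κ → Bool) (hg : Measurable g) :
    ∃ w : (κ → Bool) → ℝ, (∀ z, 0 ≤ w z) ∧
      ∀ f : (κ → Bool) → ℝ, ∫ x, f (g x) ∂μ = ∑ z, w z * f z := by
  refine ⟨fun z => (μ.map g).real {z}, fun z => measureReal_nonneg, fun f => ?_⟩
  have : IsProbabilityMeasure (μ.map g) := Measure.isProbabilityMeasure_map hg.aemeasurable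
  rw [← integral_map (f := f) hg.aemeasurable
    (measurable_of_finite f).aestronglyMeasurable, integral_fintype (Integrable.of_finite)]
  simp

end

lemma Zfam_measurable {N m : ℕ} (U : Fin N → Fin N → ℝ) :
    Measurable (fun (X : Fin m → Fin N → ℝ) (p : Fin (m + 1) × Fin N) =>
      sgnBool (Zfam N (m + 1) U X p.1 p.2)) := by
  have hs : Measurable sgnBool := by
    unfold sgnBool
    exact Measurable.ite (measurableSet_le measurable_const measurable_id) measurable_const
      measurable_const
  refine measurable_pi_lambda _ fun p => hs.comp ?_
  unfold Zfam
  have hX : ∀ (i : Fin m) (l : Fin N), Measurable (fun X : Fin m → Fin N → ℝ => X i l) :=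
    fun i l => (measurable_pi_apply l).comp (measurable_pi_apply i)
  split_ifs
  · exact hX _ _
  · exact measurable_const
  · exact Finset.measurable_sum _ fun l _ => (hX _ _).const_mul _
  · exact measurable_const
  · exact (Finset.measurable_sum _ fun l _ => (hX _ _).const_mul _).mul (hX _ _)
  · exact measurable_const

end

section
open scoped BigOperators
open MeasureTheory

lemma slice_pair_card {m N d : ℕ} (c : Finset (Fin (m + 1) × Fin N)) (hc : c.card ≤ d) (i : Fin m) :
    (slice c i.castSucc).card + (slice c i.succ).card ≤ d := by
  rw [← sum_card_slice c] at hc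
  refine le_trans ?_ hc
  have hne : i.castSucc ≠ i.succ := (Fin.castSucc_lt_succ).ne
  rw [← Finset.sum_pair (f := fun i => (slice c i).card) hne]
  exact Finset.sum_le_sum_of_subset (Finset.subset_univ _)

lemma main_ge3 {N m d : ℕ} (hm : 2 ≤ m) {U : Fin N → Fin N → ℝ} (hU : IsOrthogonal U) {v : ℝ}
    (hg : GoodAt U d v) (hv : 0 < v) (hv1 : v ≤ 1 / 4)
    (hs3 : m ≤ 3 → 288 * (d:ℝ) ^ 2 * (2 * v) ^ m ≤ 1)
    (hs5 : 4 ≤ m → 6 * (2 * v) ^ 2 * (d:ℝ) ≤ 1)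
    (t : DTree (Fin (m + 1) × Fin N)) (ht : t.depth ≤ d) :
    |uavg (fun x => t.eval x) - ∫ X : Fin m → Fin N → ℝ,
      t.eval (fun p => sgnBool (Zfam N (m + 1) U X p.1 p.2)) ∂(stdGaussianFam N m)| ≤
      Real.sqrt (288 * (d:ℝ) ^ 2 * (2 * v) ^ m) := by
  obtain ⟨w, hw, hwf⟩ := exists_weights (stdGaussianFam N m)
    (fun (X : Fin m → Fin N → ℝ) (p : Fin (m + 1) × Fin N) =>
      sgnBool (Zfam N (m + 1) U X p.1 p.2)) (Zfam_measurable U)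
  set M := Fintype.card (Fin (m + 1) × Fin N) with hM
  have hsq : ∀ (c : Finset (Fin (m + 1) × Fin N)) (a : Fin (m + 1) × Fin N → Bool), c.card ≤ d →
      (2 ^ c.card * (∑ z, w z * cubeInd c a z) - 1) ^ 2 ≤ 288 * (d:ℝ) ^ 2 * (2 * v) ^ m := by
    intro c a hc
    rw [← hwf (cubeInd c a), cubeD (by omega) U hU c a,
      chain_sum (GG U) m (fun i => alph (slice c i) (fun j => a (i, j)))]
    have hsl := slice_pair_card c hc
    match m, hm with
    | 2, _ => exact bound_k3 hU hg hv (by linarith) _ (fun i j => a (i, j)) hsl (hs3 (by norm_num))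
    | 3, _ => exact bound_k4 hU hg hv (by linarith) _ (fun i j => a (i, j)) hsl hv1
                (hs3 (by norm_num))
    | m + 4, _ => exact bound_k5 hU hg hv (by linarith) m _ (fun i j => a (i, j)) hsl
                    (hs5 (by omega))
  have key := tree_diff (fun z => w z - 1 / 2 ^ M) d (Real.sqrt (288 * (d:ℝ) ^ 2 * (2 * v) ^ m))
    (by
      intro c a hc
      have h1 := Real.abs_le_sqrt (hsq c a hc)
      have h2 : ∑ z, (1:ℝ) / 2 ^ M * cubeInd c a z = 1 / 2 ^ c.card := by
        rw [← sum_cubeInd c a]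
        exact Finset.sum_congr rfl fun z _ => mul_comm _ _
      have h3 : ∑ z, (w z - 1 / 2 ^ M) * cubeInd c a z =
          (2 ^ c.card * (∑ z, w z * cubeInd c a z) - 1) * (1 / 2 ^ c.card) := by
        simp_rw [sub_mul]
        rw [Finset.sum_sub_distrib]
        rw [h2]
        field_simp
      rw [h3, abs_mul, abs_of_pos (by positivity : (0:ℝ) < 1 / 2 ^ c.card)]
      gcongr) (Real.sqrt_nonneg _) t ∅ (fun _ => false) (by simpa using ht)
  rw [hwf t.eval, abs_sub_comm]
  simp only [cubeInd, Finset.prod_empty, one_mul, Finset.card_empty, pow_zero, sub_mul,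
    Finset.sum_sub_distrib, div_one, mul_one] at key
  unfold uavg
  rw [Finset.sum_div]
  refine le_trans (le_of_eq ?_) key
  congr 2
  refine Finset.sum_congr rfl fun z _ => ?_
  rw [div_eq_mul_one_div, mul_comm]

end

section
open scoped BigOperators
open MeasureTheory

lemma gPi_integral_prod_aff {ι ι' κ : Type} [Fintype ι] [Fintype ι'] [Fintype κ] [DecidableEq κ]
    (K : Finset κ) (A : κ → ι → ℝ) (A' : κ → ι' → ℝ) (τ : κ → ℝ) (a : κ → ℝ) (ha : ∀ k, |a k| ≤ 1)
    (h : ∀ k ∈ K, ∀ l ∈ K, ∑ i, A k i * A l i =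
      ∑ i, A' k i * A' l i + if k = l then τ k ^ 2 else 0) :
    ∫ x, ∏ k ∈ K, (1 + a k * sgn (∑ i, A k i * x i)) ∂(gPi ι)
      = ∫ w, ∏ k ∈ K, (1 + a k * phi (τ k) (∑ i, A' k i * w i)) ∂(gPi ι') := by
  have hm : ∀ k, Measurable (fun y => 1 + a k * sgn y) := fun k =>
    (sgn_measurable.const_mul _).const_add _
  have h1 := gPi_integral_law (ι := ι) (ι' := ι' ⊕ κ) K A
    (fun k => Sum.elim (A' k) (fun l => if k = l then τ k else 0)) (by
      intro k hk l hl
      rw [h k hk l hl]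
      simp only [Fintype.sum_sum_type, Sum.elim_inl, Sum.elim_inr]
      congr 1
      simp only [ite_mul, zero_mul, mul_ite, mul_zero]
      by_cases hkl : k = l
      · subst hkl; simp [sq]
      · simp [hkl]) (fun k y => 1 + a k * sgn y) hm
  rw [h1, integral_gPi_sum (C := 2 ^ K.card)]
  · congr 1
    ext w
    simp only [Fintype.sum_sum_type, Sum.elim_inl, Sum.elim_inr, ite_mul, zero_mul,
      Finset.sum_ite_eq, Finset.mem_univ, if_true]
    rw [gPi_integral_prod K (fun k g => 1 + a k * sgn (∑ i, A' k i * w i + τ k * g))]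
    refine Finset.prod_congr rfl fun k _ => ?_
    have hi : Integrable (fun g => sgn (∑ i, A' k i * w i + τ k * g))
        (ProbabilityTheory.gaussianReal 0 1) :=
      integrable_of_bdd (sgn_measurable.comp (by fun_prop)) 1 fun g => (sgn_abs _).le
    rw [integral_add (integrable_const _) (hi.const_mul _), integral_const_mul]
    simp [phi]
  · apply Finset.measurable_prod
    intro k _
    exact (hm k).comp (by fun_prop)
  · intro x
    rw [Finset.abs_prod, ← Finset.prod_const]
    refine Finset.prod_le_prod (fun _ _ => abs_nonneg _) fun k _ => ?_
    refine (abs_add_le _ _).trans ?_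
    rw [abs_mul, sgn_abs, abs_one]
    linarith [ha k]

/-- mean absolute value of a standard gaussian -/
noncomputable def cz : ℝ := ∫ g, |g| ∂(ProbabilityTheory.gaussianReal 0 1)

lemma sgn_mul_self (t : ℝ) : sgn t * t = |t| := by
  unfold sgn
  split_ifs with h
  · rw [abs_of_nonneg h, one_mul]
  · rw [abs_of_neg (by linarith)]; ring

lemma integrable_id_gauss : Integrable (fun g : ℝ => g) (ProbabilityTheory.gaussianReal 0 1) := by
  have := ProbabilityTheory.memLp_id_gaussianReal' (μ := 0) (v := 1) 1 (by simp)
  exact memLp_one_iff_integrable.mp this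

lemma integral_id_gauss : ∫ g, g ∂(ProbabilityTheory.gaussianReal 0 1) = 0 := by
  simp

lemma cz_nonneg : 0 ≤ cz := integral_nonneg fun _ => abs_nonneg _

lemma cz_le_one : cz ≤ 1 := by
  unfold cz
  have h : ∫ g, |g| ∂(ProbabilityTheory.gaussianReal 0 1) ≤
      ∫ g, (1 + g ^ 2) / 2 ∂(ProbabilityTheory.gaussianReal 0 1) := by
    apply integral_mono integrable_id_gauss.abs
      (((integrable_const _).add integrable_sq_gauss).div_const _)
    intro g
    show |g| ≤ (1 + g ^ 2) / 2
    rw [← sq_abs g]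
    nlinarith [sq_nonneg (|g| - 1)]
  refine h.trans (le_of_eq ?_)
  rw [integral_div, integral_add (integrable_const _) integrable_sq_gauss, integral_sq_gauss]
  simp

/-- weighted moment integrability -/
lemma integrable_sgn_mul {f : ℝ → ℝ} (b : ℝ) (hf : Integrable f (ProbabilityTheory.gaussianReal 0 1)) :
    Integrable (fun g => (1 + b * sgn g) * f g) (ProbabilityTheory.gaussianReal 0 1) := by
  refine hf.bdd_mul (c := 1 + |b|)
    ((sgn_measurable.const_mul _).const_add _).aestronglyMeasurable (ae_of_all _ fun g => ?_)
  rw [Real.norm_eq_abs]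
  refine (abs_add_le _ _).trans ?_
  rw [abs_mul, sgn_abs, abs_one, mul_one]

lemma mom0 (b : ℝ) : ∫ g, (1 + b * sgn g) ∂(ProbabilityTheory.gaussianReal 0 1) = 1 := by
  have hi : Integrable sgn (ProbabilityTheory.gaussianReal 0 1) :=
      integrable_of_bdd sgn_measurable 1 fun g => (sgn_abs _).le
  rw [integral_add (integrable_const _) (hi.const_mul _), integral_const_mul, integral_sgn]
  simp

lemma mom1 (b : ℝ) : ∫ g, (1 + b * sgn g) * g ∂(ProbabilityTheory.gaussianReal 0 1) = b * cz := by
  have : ∀ g : ℝ, (1 + b * sgn g) * g = g + b * |g| := by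
    intro g; rw [← sgn_mul_self]; ring
  simp_rw [this]
  rw [integral_add integrable_id_gauss (integrable_id_gauss.abs.const_mul _), integral_const_mul,
    integral_id_gauss, zero_add]
  rfl

lemma mom2 (b : ℝ) : ∫ g, (1 + b * sgn g) * g ^ 2 ∂(ProbabilityTheory.gaussianReal 0 1) = 1 := by
  have hz : ∫ g, g * |g| ∂(ProbabilityTheory.gaussianReal 0 1) = 0 := by
    have h1 : ∫ g, g * |g| ∂(ProbabilityTheory.gaussianReal 0 1)
      = ∫ g, (-g) * |(-g)| ∂(ProbabilityTheory.gaussianReal 0 1) := by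
      have := ProbabilityTheory.gaussianReal_map_neg (μ := 0) (v := 1)
      rw [neg_zero] at this
      conv_lhs => rw [← this]
      rw [integral_map (by fun_prop) (by fun_prop)]
    simp only [abs_neg, neg_mul] at h1
    rw [integral_neg] at h1
    linarith
  have : ∀ g : ℝ, (1 + b * sgn g) * g ^ 2 = g ^ 2 + b * (g * |g|) := by
    intro g; rw [← sgn_mul_self]; ring
  simp_rw [this]
  have hi : Integrable (fun g : ℝ => g * |g|) (ProbabilityTheory.gaussianReal 0 1) := by
    refine integrable_sq_gauss.mono (by fun_prop) (ae_of_all _ fun g => ?_)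
    rw [Real.norm_eq_abs, Real.norm_eq_abs, abs_mul, abs_abs, ← sq, sq_abs, abs_of_nonneg (sq_nonneg _)]
  rw [integral_add integrable_sq_gauss (hi.const_mul _), integral_const_mul, hz, integral_sq_gauss]
  simp

/-- shift of a gaussian -/
lemma gauss_shift (f : ℝ → ℝ) (hf : Measurable f) (u : ℝ) :
    ∫ g, f (u + g) ∂(ProbabilityTheory.gaussianReal 0 1) =
      ∫ g, f g * Real.exp (u * g - u ^ 2 / 2) ∂(ProbabilityTheory.gaussianReal 0 1) := by
  have h1 : (ProbabilityTheory.gaussianReal 0 1).map (fun g => u + g) =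
      ProbabilityTheory.gaussianReal u 1 := by
    rw [ProbabilityTheory.gaussianReal_map_const_add, zero_add]
  rw [← integral_map (φ := fun g => u + g) (f := f) (by fun_prop) hf.aestronglyMeasurable, h1,
    ProbabilityTheory.integral_gaussianReal_eq_integral_smul one_ne_zero,
    ProbabilityTheory.integral_gaussianReal_eq_integral_smul one_ne_zero]
  congr 1
  ext x
  simp only [smul_eq_mul, ProbabilityTheory.gaussianPDFReal]
  have : Real.exp (-(x - u) ^ 2 / (2 * ((1:NNReal):ℝ))) =
      Real.exp (-(x - 0) ^ 2 / (2 * ((1:NNReal):ℝ))) * Real.exp (u * x - u ^ 2 / 2) := by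
    rw [← Real.exp_add]
    congr 1
    simp
    ring
  rw [this]
  ring

lemma exp_tangent (y m : ℝ) : Real.exp m * (1 + y - m) ≤ Real.exp y := by
  have := Real.add_one_le_exp (y - m)
  calc Real.exp m * (1 + y - m) ≤ Real.exp m * Real.exp (y - m) := by
        gcongr; linarith
    _ = Real.exp y := by rw [← Real.exp_add]; congr 1; ring

lemma integrable_exp_gauss (u : ℝ) :
    Integrable (fun g => Real.exp (u * g - u ^ 2 / 2)) (ProbabilityTheory.gaussianReal 0 1) := by
  have h := ProbabilityTheory.integrable_exp_mul_gaussianReal (μ := 0) (v := 1) u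
  have := h.mul_const (Real.exp (-(u ^ 2 / 2)))
  refine this.congr (ae_of_all _ fun g => ?_)
  simp only
  rw [← Real.exp_add]; congr 1

lemma one_dim (b σ u : ℝ) (hb : |b| ≤ 1) (hσ : 0 < σ) :
    Real.exp (b * cz * (u / σ) - (u / σ) ^ 2 / 2) ≤ 1 + b * phi σ u := by
  set t := u / σ with ht
  have hu : u = σ * t := by rw [ht]; field_simp
  have hsg : ∀ g, sgn (u + σ * g) = sgn (t + g) := by
    intro g
    rw [hu, ← mul_add]
    unfold sgn
    simp only [mul_nonneg_iff_of_pos_left hσ]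
  have h1 : 1 + b * phi σ u = ∫ g, (1 + b * sgn (t + g)) ∂(ProbabilityTheory.gaussianReal 0 1) := by
    have hi : Integrable (fun g => sgn (t + g)) (ProbabilityTheory.gaussianReal 0 1) :=
      integrable_of_bdd (sgn_measurable.comp (by fun_prop)) 1 fun g => (sgn_abs _).le
    rw [integral_add (integrable_const _) (hi.const_mul _), integral_const_mul]
    simp [phi, hsg]
  rw [h1, gauss_shift (fun g => 1 + b * sgn g) ((sgn_measurable.const_mul _).const_add _) t]
  set m := b * cz * t - t ^ 2 / 2 with hm
  have hnn : ∀ g, 0 ≤ 1 + b * sgn g := by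
    intro g
    have : |b * sgn g| ≤ 1 := by rw [abs_mul, sgn_abs, mul_one]; exact hb
    linarith [(abs_le.mp this).1]
  have i0 := integrable_sgn_mul b (integrable_const (1:ℝ))
  have i1 := integrable_sgn_mul b integrable_id_gauss
  calc Real.exp m = ∫ g, Real.exp m * ((1 - t ^ 2 / 2 - m) * ((1 + b * sgn g) * 1) +
        t * ((1 + b * sgn g) * g)) ∂(ProbabilityTheory.gaussianReal 0 1) := by
        rw [integral_const_mul, integral_add (i0.const_mul _) (i1.const_mul _), integral_const_mul,
          integral_const_mul]
        simp only [mul_one]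
        rw [mom0, mom1, hm]; ring
    _ ≤ _ := by
        apply integral_mono (((i0.const_mul _).add (i1.const_mul _)).const_mul _)
          (integrable_sgn_mul b (integrable_exp_gauss t))
        intro g
        have := mul_le_mul_of_nonneg_left (exp_tangent (t * g - t ^ 2 / 2) m) (hnn g)
        refine le_trans (le_of_eq ?_) this
        simp only [Pi.add_apply]
        ring

end

section
open scoped BigOperators
open MeasureTheory

section
variable {ι : Type} [Fintype ι] [DecidableEq ι]

/-- product of half-gaussian weights -/
noncomputable def hw (a : ι → ℝ) (ξ : ι → ℝ) : ℝ := ∏ k, (1 + a k * sgn (ξ k))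

lemma gPi_prod_integrable (f : ι → ℝ → ℝ)
    (hf : ∀ i, Integrable (f i) (ProbabilityTheory.gaussianReal 0 1)) :
    Integrable (fun ξ : ι → ℝ => ∏ i, f i (ξ i)) (gPi ι) :=
  Integrable.fintype_prod (f := f) hf

lemma gPi_prod_integral (f : ι → ℝ → ℝ) :
    ∫ ξ, ∏ i, f i (ξ i) ∂(gPi ι) = ∏ i, ∫ g, f i g ∂(ProbabilityTheory.gaussianReal 0 1) :=
  gPi_integral_prod Finset.univ f

lemma hw0 (a : ι → ℝ) : Integrable (hw a) (gPi ι) ∧ ∫ ξ, hw a ξ ∂(gPi ι) = 1 := by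
  constructor
  · refine gPi_prod_integrable (fun k g => 1 + a k * sgn g) fun k => ?_
    simpa using integrable_sgn_mul (a k) (integrable_const (1:ℝ))
  · unfold hw
    rw [gPi_prod_integral (fun k g => 1 + a k * sgn g)]
    simp_rw [mom0]; simp

lemma hw1 (a : ι → ℝ) (k : ι) : Integrable (fun ξ => hw a ξ * ξ k) (gPi ι) ∧
    ∫ ξ, hw a ξ * ξ k ∂(gPi ι) = a k * cz := by
  have e : ∀ ξ : ι → ℝ, hw a ξ * ξ k =
      ∏ i, ((1 + a i * sgn (ξ i)) * (if i = k then ξ i else 1)) := by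
    intro ξ
    rw [Finset.prod_mul_distrib, Finset.prod_ite_eq']
    simp [hw]
  simp_rw [e]
  constructor
  · refine gPi_prod_integrable (fun i g => (1 + a i * sgn g) * (if i = k then g else 1)) fun i => ?_
    by_cases h : i = k
    · simpa [h] using integrable_sgn_mul (a k) integrable_id_gauss
    · simpa [h] using integrable_sgn_mul (a i) (integrable_const (1:ℝ))
  · rw [gPi_prod_integral (fun i g => (1 + a i * sgn g) * (if i = k then g else 1))]
    rw [Finset.prod_eq_single k]
    · simpa using mom1 (a k)
    · intro i _ h
      simpa [h] using mom0 (a i)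
    · simp

lemma hw2 (a : ι → ℝ) (k l : ι) : Integrable (fun ξ => hw a ξ * (ξ k * ξ l)) (gPi ι) ∧
    ∫ ξ, hw a ξ * (ξ k * ξ l) ∂(gPi ι) =
      (a k * cz) * (a l * cz) + if k = l then (1 - (a k * cz) ^ 2) else 0 := by
  have e : ∀ ξ : ι → ℝ, hw a ξ * (ξ k * ξ l) =
      ∏ i, ((1 + a i * sgn (ξ i)) * ((if i = k then ξ i else 1) * (if i = l then ξ i else 1))) := by
    intro ξ
    rw [Finset.prod_mul_distrib, Finset.prod_mul_distrib, Finset.prod_ite_eq', Finset.prod_ite_eq']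
    simp [hw]
  simp_rw [e]
  constructor
  · refine gPi_prod_integrable (fun i g => (1 + a i * sgn g) *
      ((if i = k then g else 1) * (if i = l then g else 1))) fun i => ?_
    by_cases h : i = k <;> by_cases h' : i = l
    · simpa [← h, ← h', ← sq] using integrable_sgn_mul (a i) integrable_sq_gauss
    · simp only [if_pos h, if_neg h', mul_one]
      exact integrable_sgn_mul (a i) integrable_id_gauss
    · simp only [if_pos h', if_neg h, one_mul]
      exact integrable_sgn_mul (a i) integrable_id_gauss
    · simpa [h, h'] using integrable_sgn_mul (a i) (integrable_const (1:ℝ))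
  · rw [gPi_prod_integral (fun i g => (1 + a i * sgn g) *
      ((if i = k then g else 1) * (if i = l then g else 1)))]
    by_cases hkl : k = l
    · subst hkl
      rw [Finset.prod_eq_single k]
      · have := mom2 (a k)
        simp only [sq] at this
        simp [this]; ring
      · intro i _ h
        simpa [h] using mom0 (a i)
      · simp
    · rw [if_neg hkl, add_zero, ← Finset.mul_prod_erase _ _ (Finset.mem_univ k),
        ← Finset.mul_prod_erase _ _ (Finset.mem_erase.mpr ⟨Ne.symm hkl, Finset.mem_univ l⟩),
        Finset.prod_eq_one]
      · simp only [if_true, if_neg hkl, if_neg (Ne.symm hkl), mul_one, one_mul]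
        rw [mom1, mom1]
      · intro i hi
        simp only [Finset.mem_erase] at hi
        simpa [hi.1, hi.2.1] using mom0 (a i)

lemma hwL1 (a A : ι → ℝ) : Integrable (fun ξ => hw a ξ * ∑ k, A k * ξ k) (gPi ι) ∧
    ∫ ξ, hw a ξ * ∑ k, A k * ξ k ∂(gPi ι) = cz * ∑ k, A k * a k := by
  have e : ∀ ξ : ι → ℝ, hw a ξ * ∑ k, A k * ξ k = ∑ k, A k * (hw a ξ * ξ k) := by
    intro ξ; rw [Finset.mul_sum]; exact Finset.sum_congr rfl fun k _ => by ring
  simp_rw [e]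
  refine ⟨integrable_finsetSum _ fun k _ => (hw1 a k).1.const_mul _, ?_⟩
  rw [integral_finsetSum _ fun k _ => (hw1 a k).1.const_mul _, Finset.mul_sum]
  refine Finset.sum_congr rfl fun k _ => ?_
  rw [integral_const_mul, (hw1 a k).2]; ring

lemma hwL2 (a A : ι → ℝ) : Integrable (fun ξ => hw a ξ * (∑ k, A k * ξ k) ^ 2) (gPi ι) ∧
    ∫ ξ, hw a ξ * (∑ k, A k * ξ k) ^ 2 ∂(gPi ι) ≤
      ∑ k, A k ^ 2 + (cz * ∑ k, A k * a k) ^ 2 := by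
  have e : ∀ ξ : ι → ℝ, hw a ξ * (∑ k, A k * ξ k) ^ 2 =
      ∑ k, ∑ l, (A k * A l) * (hw a ξ * (ξ k * ξ l)) := by
    intro ξ; rw [sq, Finset.sum_mul_sum, Finset.mul_sum]
    refine Finset.sum_congr rfl fun k _ => ?_
    rw [Finset.mul_sum]
    exact Finset.sum_congr rfl fun l _ => by ring
  simp_rw [e]
  have hi : ∀ k l, Integrable (fun ξ => (A k * A l) * (hw a ξ * (ξ k * ξ l))) (gPi ι) :=
    fun k l => (hw2 a k l).1.const_mul _
  refine ⟨integrable_finsetSum _ fun k _ => integrable_finsetSum _ fun l _ => hi k l, ?_⟩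
  rw [integral_finsetSum _ fun k _ => integrable_finsetSum _ fun l _ => hi k l]
  have e2 : ∀ k, ∫ ξ, ∑ l, (A k * A l) * (hw a ξ * (ξ k * ξ l)) ∂(gPi ι) =
      (cz * (A k * a k)) * (cz * ∑ l, A l * a l) + A k ^ 2 * (1 - (a k * cz) ^ 2) := by
    intro k
    rw [integral_finsetSum _ fun l _ => hi k l]
    simp_rw [integral_const_mul, (hw2 a k _).2, mul_add]
    rw [Finset.sum_add_distrib]
    congr 1
    · rw [Finset.mul_sum, Finset.mul_sum]
      exact Finset.sum_congr rfl fun l _ => by ring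
    · simp only [mul_ite, mul_zero, Finset.sum_ite_eq, Finset.mem_univ, if_true]
      ring
  simp_rw [e2]
  rw [Finset.sum_add_distrib, ← Finset.sum_mul, ← Finset.mul_sum, add_comm]
  refine add_le_add (Finset.sum_le_sum fun k _ => ?_) (le_of_eq (by ring))
  nlinarith [mul_nonneg (sq_nonneg (A k)) (sq_nonneg (a k * cz))]

lemma jensen_main {J : Type} (a : ι → ℝ) (ha : ∀ k, |a k| ≤ 1) (T : Finset J) (A : J → ι → ℝ)
    (b : J → ℝ) (hb : ∀ j, |b j| ≤ 1) (σ : ℝ) (hσ : 0 < σ) :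
    Real.exp (∑ j ∈ T, (b j * cz / σ * (cz * ∑ k, A j k * a k) -
      (1 / (2 * σ ^ 2)) * (∑ k, A j k ^ 2 + (cz * ∑ k, A j k * a k) ^ 2))) ≤
    ∫ ξ, hw a ξ * ∏ j ∈ T, (1 + b j * phi σ (∑ k, A j k * ξ k)) ∂(gPi ι) := by
  set m := ∑ j ∈ T, (b j * cz / σ * (cz * ∑ k, A j k * a k) -
      (1 / (2 * σ ^ 2)) * (∑ k, A j k ^ 2 + (cz * ∑ k, A j k * a k) ^ 2)) with hm
  have hwnn : ∀ ξ, 0 ≤ hw a ξ := by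
    intro ξ
    refine Finset.prod_nonneg fun k _ => ?_
    have : |a k * sgn (ξ k)| ≤ 1 := by rw [abs_mul, sgn_abs, mul_one]; exact ha k
    linarith [(abs_le.mp this).1]
  set Y : (ι → ℝ) → ℝ := fun ξ => ∑ j ∈ T, (b j * cz * ((∑ k, A j k * ξ k) / σ) -
    ((∑ k, A j k * ξ k) / σ) ^ 2 / 2) with hY
  have hYle : ∀ ξ, Real.exp (Y ξ) ≤ ∏ j ∈ T, (1 + b j * phi σ (∑ k, A j k * ξ k)) := by
    intro ξ
    rw [hY, Real.exp_sum]
    exact Finset.prod_le_prod (fun _ _ => (Real.exp_pos _).le) fun j _ => one_dim _ _ _ (hb j) hσ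
  have eY : ∀ ξ, hw a ξ * Y ξ = ∑ j ∈ T, (b j * cz / σ * (hw a ξ * ∑ k, A j k * ξ k) -
      (1 / (2 * σ ^ 2)) * (hw a ξ * (∑ k, A j k * ξ k) ^ 2)) := by
    intro ξ
    rw [hY, Finset.mul_sum]
    refine Finset.sum_congr rfl fun j _ => ?_
    field_simp
  have hij : ∀ j, Integrable (fun ξ => b j * cz / σ * (hw a ξ * ∑ k, A j k * ξ k) -
      (1 / (2 * σ ^ 2)) * (hw a ξ * (∑ k, A j k * ξ k) ^ 2)) (gPi ι) := fun j =>
    ((hwL1 a (A j)).1.const_mul _).sub ((hwL2 a (A j)).1.const_mul _)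
  have hYi : Integrable (fun ξ => hw a ξ * Y ξ) (gPi ι) := by
    simp_rw [eY]
    exact integrable_finsetSum _ fun j _ => hij j
  have hYint : m ≤ ∫ ξ, hw a ξ * Y ξ ∂(gPi ι) := by
    simp_rw [eY]
    rw [integral_finsetSum _ fun j _ => hij j, hm]
    refine Finset.sum_le_sum fun j _ => ?_
    rw [integral_sub ((hwL1 a (A j)).1.const_mul _) ((hwL2 a (A j)).1.const_mul _),
      integral_const_mul, integral_const_mul, (hwL1 a (A j)).2]
    have := (hwL2 a (A j)).2
    gcongr
  have h0 := hw0 a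
  have hmW : Measurable (hw a) := by
    unfold hw
    exact Finset.measurable_prod _ fun k _ =>
      ((sgn_measurable.comp (measurable_pi_apply k)).const_mul _).const_add _
  calc Real.exp m ≤ Real.exp m * ((1 - m) * 1 + ∫ ξ, hw a ξ * Y ξ ∂(gPi ι)) := by
        nlinarith [Real.exp_pos m]
    _ = ∫ ξ, Real.exp m * ((1 - m) * hw a ξ + hw a ξ * Y ξ) ∂(gPi ι) := by
        rw [integral_const_mul, integral_add (h0.1.const_mul _) hYi, integral_const_mul, h0.2]
    _ ≤ _ := by
        apply integral_mono (((h0.1.const_mul _).add hYi).const_mul _)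
        · have hmP : Measurable (fun ξ : ι → ℝ => ∏ j ∈ T, (1 + b j * phi σ (∑ k, A j k * ξ k))) :=
            Finset.measurable_prod _ fun k _ =>
              (((phi_measurable σ).comp (by fun_prop)).const_mul _).const_add _
          refine h0.1.mul_bdd (c := 2 ^ T.card) hmP.aestronglyMeasurable (ae_of_all _ fun ξ => ?_)
          rw [Real.norm_eq_abs, Finset.abs_prod, ← Finset.prod_const]
          refine Finset.prod_le_prod (fun _ _ => abs_nonneg _) fun k _ => ?_
          refine (abs_add_le _ _).trans ?_
          rw [abs_mul, abs_one]
          have := mul_le_one₀ (hb k) (abs_nonneg _) (phi_abs_le σ (∑ l, A k l * ξ l))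
          linarith
        · intro ξ
          have h1 := mul_le_mul_of_nonneg_left ((exp_tangent (Y ξ) m).trans (hYle ξ)) (hwnn ξ)
          refine le_trans (le_of_eq ?_) h1
          simp only [Pi.add_apply]
          ring

end

end

section
open scoped BigOperators
open MeasureTheory

lemma sg_abs (b : Bool) : |sg b| = 1 := by cases b <;> simp [sg]

lemma transpose_bound {N : ℕ} (U : Fin N → Fin N → ℝ) (T1 T2 : Finset (Fin N)) (v : ℝ) (hv : 0 ≤ v)
    (hB : ∀ y : Fin N → ℝ, ∑ i ∈ T1, (∑ j ∈ T2, U i j * y j) ^ 2 ≤ v * ∑ j ∈ T2, y j ^ 2)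
    (x : Fin N → ℝ) (hx : ∀ i, |x i| = 1) :
    ∑ j ∈ T2, (∑ i ∈ T1, U i j * x i) ^ 2 ≤ v * T1.card := by
  set y : Fin N → ℝ := fun j => ∑ i ∈ T1, U i j * x i with hy
  set Z := ∑ j ∈ T2, y j ^ 2 with hZ
  have hZ0 : 0 ≤ Z := Finset.sum_nonneg fun _ _ => sq_nonneg _
  have e : Z = ∑ i ∈ T1, x i * (∑ j ∈ T2, U i j * y j) := by
    rw [hZ]
    have : ∀ j, y j ^ 2 = ∑ i ∈ T1, x i * (U i j * y j) := by
      intro j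
      rw [sq]
      conv_lhs => rw [hy]
      simp only
      rw [Finset.sum_mul]
      exact Finset.sum_congr rfl fun i _ => by rw [hy]; ring
    simp_rw [this, Finset.mul_sum]
    rw [Finset.sum_comm]
  have hcs := Finset.sum_mul_sq_le_sq_mul_sq T1 x (fun i => ∑ j ∈ T2, U i j * y j)
  rw [← e] at hcs
  have hx2 : ∑ i ∈ T1, x i ^ 2 = T1.card := by
    rw [Finset.sum_congr rfl fun i _ => by rw [← sq_abs, hx i, one_pow]]
    simp
  rw [hx2] at hcs
  have h1 : Z ^ 2 ≤ T1.card * (v * Z) := hcs.trans (by gcongr; exact hB y)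
  by_contra hc
  push Not at hc
  have hZp : 0 < Z := lt_of_le_of_lt (by positivity) hc
  nlinarith

lemma R2_lower {N : ℕ} (U : Fin N → Fin N → ℝ) (hU : IsOrthogonal U) (T1 T2 : Finset (Fin N)) (v : ℝ)
    (hv : 0 < v) (hv1 : v ≤ 1 / 2)
    (hB : ∀ y : Fin N → ℝ, ∑ i ∈ T1, (∑ j ∈ T2, U i j * y j) ^ 2 ≤ v * ∑ j ∈ T2, y j ^ 2)
    (a b : Fin N → Bool) :
    Real.exp (cz ^ 2 / Real.sqrt (1 - v) * ∑ j ∈ T2, ∑ i ∈ T1, sg (b j) * (U i j * sg (a i)) -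
      v * (T1.card + T2.card)) ≤ ∑ S, ∑ T, alph T1 a S * GG U S T * alph T2 b T := by
  obtain ⟨Q, hQ⟩ := coupling U T1 T2 1 v one_pos (by simpa using hB)
  simp only [Real.sqrt_one, div_one] at hQ
  set P : Fin N → (Fin N ⊕ Fin N) → ℝ := fun i =>
    Sum.elim (fun l => if i = l then 1 else 0) (fun _ => 0) with hP
  set R : Fin N → (Fin N ⊕ Fin N) → ℝ := fun j =>
    Sum.elim (fun i => if i ∈ T1 then U i j else 0) (Q j) with hR
  set σ := Real.sqrt (1 - v) with hσd
  have hσ : 0 < σ := Real.sqrt_pos.mpr (by linarith)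
  have hσ2 : σ ^ 2 = 1 - v := Real.sq_sqrt (by linarith)
  have hPP : ∀ i i', ∑ w, P i w * P i' w = if i = i' then 1 else 0 := by
    intro i i'
    simp only [hP, Fintype.sum_sum_type, Sum.elim_inl, Sum.elim_inr, mul_zero, ite_mul,
      zero_mul, mul_ite]
    by_cases h : i = i'
    · subst h; simp
    · simp [h]
  have hPR : ∀ i ∈ T1, ∀ j, ∑ w, P i w * R j w = U i j := by
    intro i hi j
    simp only [hP, hR, Fintype.sum_sum_type, Sum.elim_inl, Sum.elim_inr, zero_mul, ite_mul]
    simp [hi]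
  have hRR : ∀ j ∈ T2, ∀ l ∈ T2, ∑ w, R j w * R l w = if j = l then v else 0 := by
    intro j hj l hl
    rw [← hQ j hj l hl]
    simp only [hR, Fintype.sum_sum_type, Sum.elim_inl, Sum.elim_inr, ite_mul, zero_mul, mul_ite, mul_zero]
    congr 1
    simp
  have h := gPi_integral_prod_aff (ι := Fin N) (ι' := Fin N ⊕ Fin N) (κ := Fin N ⊕ Fin N)
      (T1.disjSum T2)
      (Sum.elim (fun i l => if i = l then 1 else 0) (fun j l => U l j))
      (Sum.elim P R)
      (Sum.elim (fun _ => 0) (fun _ => σ))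
      (Sum.elim (fun i => sg (a i)) (fun j => sg (b j)))
      (by rintro (i | i) <;> simp [sg_abs]) (by
        rintro (i | i) hk (j | j) hl
        · simp only [Sum.elim_inl, hPP, Sum.inl.injEq, ite_mul, mul_ite, zero_mul, mul_zero, one_mul]
          by_cases h : i = j
          · simp [h]
          · simp [h]
        · simp only [Sum.elim_inl, Sum.elim_inr]
          rw [hPR i (by simpa using hk)]
          simp
        · simp only [Sum.elim_inl, Sum.elim_inr]
          rw [Finset.sum_congr rfl fun z _ => mul_comm (R i z) (P j z)]
          rw [hPR j (by simpa using hl)]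
          simp
        · simp only [Sum.elim_inr, Sum.inr.injEq]
          rw [hRR i (by simpa using hk) j (by simpa using hl), hU.1, hσ2]
          by_cases h : i = j
          · simp [h]
          · simp [h])
  simp only [Finset.prod_disjSum, Sum.elim_inl, Sum.elim_inr, ite_mul, one_mul, zero_mul,
      Finset.sum_ite_eq, Finset.mem_univ, if_true, phi_zero] at h
  rw [GG_bilin]
  simp_rw [← prod_one_add_eq T1 a (fun i => sgn (_)), ← prod_one_add_eq T2 b (fun i => sgn (_))]
  rw [h]
  set a' : Fin N ⊕ Fin N → ℝ := Sum.elim (fun i => if i ∈ T1 then sg (a i) else 0) (fun _ => 0) with ha'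
  have ha'1 : ∀ k, |a' k| ≤ 1 := by
    rintro (i | i)
    · simp only [ha', Sum.elim_inl]
      split_ifs
      · exact (sg_abs _).le
      · simp
    · simp [ha']
  have hW : ∀ w : Fin N ⊕ Fin N → ℝ, ∏ i ∈ T1, (1 + sg (a i) * sgn (∑ k, P i k * w k)) = hw a' w := by
    intro w
    unfold hw
    rw [Fintype.prod_sum_type]
    simp only [ha', hP, Fintype.sum_sum_type, Sum.elim_inl, Sum.elim_inr, zero_mul, add_zero,
      Finset.prod_const_one, mul_one, ite_mul, one_mul, Finset.sum_ite_eq, Finset.mem_univ, if_true,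
      Finset.sum_const_zero]
    rw [← Finset.prod_subset (Finset.subset_univ T1)]
    · exact Finset.prod_congr rfl fun i hi => by simp [hi]
    · intro i _ hi; simp [hi]
  simp_rw [hW]
  refine le_trans ?_ (jensen_main a' ha'1 T2 R (fun j => sg (b j)) (fun j => (sg_abs _).le) σ hσ)
  rw [Real.exp_le_exp]
  have hRa : ∀ j, ∑ k, R j k * a' k = ∑ i ∈ T1, U i j * sg (a i) := by
    intro j
    simp only [hR, ha', Fintype.sum_sum_type, Sum.elim_inl, Sum.elim_inr, mul_zero,
      Finset.sum_const_zero, add_zero]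
    rw [← Finset.sum_subset (Finset.subset_univ T1)]
    · exact Finset.sum_congr rfl fun i hi => by simp [hi]
    · intro i _ hi; simp [hi]
  simp_rw [hRa]
  rw [Finset.sum_sub_distrib, ← Finset.mul_sum]
  have e1 : ∑ j ∈ T2, sg (b j) * cz / σ * (cz * ∑ i ∈ T1, U i j * sg (a i)) =
      cz ^ 2 / σ * ∑ j ∈ T2, ∑ i ∈ T1, sg (b j) * (U i j * sg (a i)) := by
    rw [Finset.mul_sum]
    refine Finset.sum_congr rfl fun j _ => ?_
    rw [← Finset.mul_sum]
    ring
  rw [e1]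
  apply sub_le_sub_left
  rw [Finset.sum_add_distrib]
  have e2 : ∑ j ∈ T2, ∑ k, R j k ^ 2 = v * T2.card := by
    rw [Finset.sum_congr rfl fun j hj => (Finset.sum_congr rfl fun k _ => sq (R j k)).trans
      ((hRR j hj j hj).trans (if_pos rfl))]
    simp [mul_comm]
  have e3 : ∑ j ∈ T2, (cz * ∑ i ∈ T1, U i j * sg (a i)) ^ 2 ≤ v * T1.card := by
    refine le_trans (Finset.sum_le_sum fun j _ => ?_)
      (transpose_bound U T1 T2 v hv.le hB (fun i => sg (a i)) (fun i => sg_abs _))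
    rw [mul_pow]
    have : cz ^ 2 ≤ 1 := pow_le_one₀ cz_nonneg cz_le_one
    exact mul_le_of_le_one_left (sq_nonneg _) this
  rw [e2]
  have e4 : 1 / (2 * σ ^ 2) ≤ 1 := by
    rw [hσ2, div_le_one (by linarith)]; linarith
  have hnn : 0 ≤ v * T2.card + ∑ j ∈ T2, (cz * ∑ i ∈ T1, U i j * sg (a i)) ^ 2 :=
    add_nonneg (by positivity) (Finset.sum_nonneg fun _ _ => sq_nonneg _)
  calc _ ≤ 1 * (v * T2.card + ∑ j ∈ T2, (cz * ∑ i ∈ T1, U i j * sg (a i)) ^ 2) := by gcongr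
    _ ≤ _ := by linarith

end

section
open scoped BigOperators
open MeasureTheory

noncomputable def ee {κ : Type} [DecidableEq κ] (c : Finset κ) (a : κ → Bool) (q : κ) : ℝ :=
  if q ∈ c then sg (a q) else 0

lemma ee_ne {κ : Type} [DecidableEq κ] (c : Finset κ) (a : κ → Bool) (p q : κ) (b : Bool) (h : q ≠ p) :
    ee (insert p c) (Function.update a p b) q = ee c a q := by
  simp [ee, h]

lemma ee_add {κ : Type} [DecidableEq κ] (c : Finset κ) (a : κ → Bool) (p q : κ) (hp : p ∉ c) :
    ee (insert p c) (Function.update a p false) q + ee (insert p c) (Function.update a p true) q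
      = 2 * ee c a q := by
  by_cases h : q = p
  · subst h; simp [ee, sg, hp]
  · rw [ee_ne _ _ _ _ _ h, ee_ne _ _ _ _ _ h]; ring

noncomputable def Psi {N : ℕ} (U : Fin N → Fin N → ℝ) (c : Finset (Fin 2 × Fin N))
    (a : Fin 2 × Fin N → Bool) : ℝ :=
  ∑ j, ∑ i, ee c a (1, j) * (U i j * ee c a (0, i))

lemma Psi_mart {N : ℕ} (U : Fin N → Fin N → ℝ) (c : Finset (Fin 2 × Fin N))
    (a : Fin 2 × Fin N → Bool) (p : Fin 2 × Fin N) (hp : p ∉ c) :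
    Psi U (insert p c) (Function.update a p false) + Psi U (insert p c) (Function.update a p true)
      = 2 * Psi U c a := by
  unfold Psi
  simp only [Finset.mul_sum, ← Finset.sum_add_distrib]
  refine Finset.sum_congr rfl fun j _ => Finset.sum_congr rfl fun i _ => ?_
  by_cases h : p = (1, j)
  · have h0 : ((0 : Fin 2), i) ≠ p := by rw [h]; simp
    have := ee_add c a p (1, j) hp
    rw [ee_ne _ _ _ _ _ h0, ee_ne _ _ _ _ _ h0]
    linear_combination (U i j * ee c a (0, i)) * this
  · have h0 : ((1 : Fin 2), j) ≠ p := fun e => h e.symm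
    have := ee_add c a p (0, i) hp
    rw [ee_ne _ _ _ _ _ h0, ee_ne _ _ _ _ _ h0]
    linear_combination (U i j * ee c a (1, j)) * this

lemma Psi_eq {N : ℕ} (U : Fin N → Fin N → ℝ) (c : Finset (Fin 2 × Fin N))
    (a : Fin 2 × Fin N → Bool) :
    Psi U c a = ∑ j ∈ slice c 1, ∑ i ∈ slice c 0, sg (a (1, j)) * (U i j * sg (a (0, i))) := by
  unfold Psi slice
  rw [Finset.sum_filter]
  refine Finset.sum_congr rfl fun j _ => ?_
  by_cases h : ((1 : Fin 2), j) ∈ c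
  · rw [if_pos h, Finset.sum_filter]
    refine Finset.sum_congr rfl fun i _ => ?_
    by_cases h' : ((0 : Fin 2), i) ∈ c <;> simp [ee, h, h']
  · simp [ee, h]

lemma main_2 {N d : ℕ} {U : Fin N → Fin N → ℝ} (hU : IsOrthogonal U) {v : ℝ}
    (hg : GoodAt U d v) (hv : 0 < v) (hv1 : v ≤ 1 / 2)
    (t : DTree (Fin 2 × Fin N)) (ht : t.depth ≤ d) :
    |uavg (fun x => t.eval x) - ∫ X : Fin 1 → Fin N → ℝ,
      t.eval (fun p => sgnBool (Zfam N 2 U X p.1 p.2)) ∂(stdGaussianFam N 1)| ≤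
      Real.sqrt (v * d) := by
  obtain ⟨w, hw, hwf⟩ := exists_weights (stdGaussianFam N 1)
    (fun (X : Fin 1 → Fin N → ℝ) (p : Fin (1 + 1) × Fin N) =>
      sgnBool (Zfam N (1 + 1) U X p.1 p.2)) (Zfam_measurable U)
  set M := Fintype.card (Fin 2 × Fin N) with hM
  have hw1 : ∑ z, w z = 1 := by
    have h1 := hwf (fun _ => 1)
    have : IsProbabilityMeasure (stdGaussianFam N 1) := by
      unfold stdGaussianFam stdGaussianVec; infer_instance
    simpa using h1.symm
  have hu1 : ∑ _z : Fin 2 × Fin N → Bool, (1:ℝ) / 2 ^ M = 1 := by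
    simp [hM]
  set P := ∑ z, w z * t.eval z with hP
  set Q := ∑ z, (1:ℝ) / 2 ^ M * t.eval z with hQ
  have hP0 : 0 ≤ P := Finset.sum_nonneg fun z _ => mul_nonneg (hw z) (eval_bounds t z).1
  have hQ0 : 0 ≤ Q := Finset.sum_nonneg fun z _ => mul_nonneg (by positivity) (eval_bounds t z).1
  have hP1 : P ≤ 1 := by
    rw [← hw1]
    exact Finset.sum_le_sum fun z _ => mul_le_of_le_one_right (hw z) (eval_bounds t z).2
  have hQ1 : Q ≤ 1 := by
    rw [← hu1]
    exact Finset.sum_le_sum fun z _ => mul_le_of_le_one_right (by positivity) (eval_bounds t z).2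
  have hQu : uavg (fun x => t.eval x) = Q := by
    unfold uavg
    rw [Finset.sum_div]
    exact Finset.sum_congr rfl fun z _ => by rw [div_eq_mul_one_div, mul_comm]
  have hPi : ∫ X : Fin 1 → Fin N → ℝ,
      t.eval (fun p => sgnBool (Zfam N 2 U X p.1 p.2)) ∂(stdGaussianFam N 1) = P := hwf t.eval
  rw [hQu, hPi, abs_sub_comm]
  apply Real.abs_le_sqrt
  by_cases hvd : 1 ≤ v * d
  · refine le_trans ?_ hvd
    nlinarith
  push Not at hvd
  set κ := cz ^ 2 / Real.sqrt (1 - v) with hκ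
  have key := tree_hell w (fun _ => (1:ℝ) / 2 ^ M) hw (fun _ => by positivity) d
    (fun c a => 1 - v * d / 2 + κ / 2 * Psi U c a)
    (by
      intro c a p hp
      have := Psi_mart U c a p hp
      linear_combination κ / 2 * this)
    (by
      intro c a hc
      have h2 : ∑ z, (1:ℝ) / 2 ^ M * cubeInd c a z = 1 / 2 ^ c.card := by
        rw [← sum_cubeInd c a]
        exact Finset.sum_congr rfl fun z _ => mul_comm _ _
      rw [h2]
      have hsl : (slice c 0).card + (slice c 1).card ≤ d := slice_pair_card (m := 1) c hc 0
      have hR := R2_lower U hU (slice c 0) (slice c 1) v hv hv1 (hg _ _ hsl)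
        (fun j => a (0, j)) (fun j => a (1, j))
      rw [← Psi_eq] at hR
      have hc1 : 2 ^ c.card * ∑ z, w z * cubeInd c a z = ∑ S, ∑ T,
          alph (slice c 0) (fun j => a (0, j)) S * GG U S T *
            alph (slice c 1) (fun j => a (1, j)) T := by
        rw [← hwf (cubeInd c a), cubeD le_rfl U hU c a,
          chain_sum (GG U) 1 (fun i => alph (slice c i) (fun j => a (i, j)))]
        refine Finset.sum_congr rfl fun S _ => ?_
        simp only [chain, Finset.mul_sum, mul_assoc]
        rfl
      rw [← hc1] at hR
      set W := ∑ z, w z * cubeInd c a z with hW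
      have hcast : ((slice c 0).card : ℝ) + (slice c 1).card ≤ d := by exact_mod_cast hsl
      have hy : Real.exp (κ * Psi U c a - v * d) ≤ 2 ^ c.card * W := by
        refine le_trans (Real.exp_le_exp.2 ?_) hR
        have := mul_le_mul_of_nonneg_left hcast hv.le
        linarith
      have h3 : W * (1 / 2 ^ c.card) = (1 / 2 ^ c.card) ^ 2 * (2 ^ c.card * W) := by
        field_simp
      rw [h3, Real.sqrt_mul (by positivity), Real.sqrt_sq (by positivity)]
      refine mul_le_mul_of_nonneg_left ?_ (by positivity)
      refine le_trans ?_ (Real.sqrt_le_sqrt hy)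
      have h4 : Real.exp (κ * Psi U c a - v * d) =
          Real.exp ((κ * Psi U c a - v * d) / 2) ^ 2 := by
        rw [← Real.exp_nat_mul]; congr 1; push_cast; ring
      rw [h4, Real.sqrt_sq (Real.exp_pos _).le]
      have := Real.add_one_le_exp ((κ * Psi U c a - v * d) / 2)
      linarith)
    t ∅ (fun _ => false) (by simpa using ht)
  have hroot : Psi U ∅ (fun _ => false) = 0 := by simp [Psi, ee]
  simp only [cubeInd, Finset.prod_empty, one_mul, Finset.card_empty, pow_zero, div_one, hroot,
    mul_zero, add_zero] at key
  have hP' : ∑ z, w z * (1 - t.eval z) = 1 - P := by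
    simp only [mul_sub, mul_one, Finset.sum_sub_distrib, hw1, hP]
  have hQ' : ∑ z, (1:ℝ) / 2 ^ M * (1 - t.eval z) = 1 - Q := by
    simp only [mul_sub, mul_one, Finset.sum_sub_distrib, hu1, hQ]
  rw [hP', hQ'] at key
  have hb : 0 ≤ 1 - v * d / 2 := by linarith
  have := hell_tv P Q _ hP0 hP1 hQ0 hQ1 hb key
  nlinarith [sq_nonneg (v * d)]

end

section
open scoped BigOperators
open MeasureTheory

lemma leaf_case {N m : ℕ} (U : Fin N → Fin N → ℝ) (t : DTree (Fin (m + 1) × Fin N))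
    (ht : t.depth ≤ 0) :
    uavg (fun x => t.eval x) - ∫ X : Fin m → Fin N → ℝ,
      t.eval (fun p => sgnBool (Zfam N (m + 1) U X p.1 p.2)) ∂(stdGaussianFam N m) = 0 := by
  have : IsProbabilityMeasure (stdGaussianFam N m) := by
    unfold stdGaussianFam stdGaussianVec; infer_instance
  cases t with
  | leaf b => cases b <;> simp [DTree.eval, uavg]
  | node p t0 t1 => simp [DTree.depth] at ht

lemma final_aux (N m d : ℕ) (hN : 2 ≤ N) (hm : 1 ≤ m) (U : Fin N → Fin N → ℝ)
    (hU : IsOrthogonal U) (hg : IsGood U) (t : DTree (Fin (m + 1) × Fin N)) (ht : t.depth ≤ d)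
    (hY : 10000 * d * Real.log (((m + 1 : ℕ) : ℝ) * N) ≤
      (N : ℝ) ^ ((2 * (((m + 1 : ℕ) : ℝ) - 1)) / (3 * ((m + 1 : ℕ) : ℝ) - 1))) :
    |uavg (fun x => t.eval x) - ∫ X : Fin m → Fin N → ℝ,
      t.eval (fun p => sgnBool (Zfam N (m + 1) U X p.1 p.2)) ∂(stdGaussianFam N m)| ≤
      Real.sqrt ((10000 * d * Real.log (((m + 1 : ℕ) : ℝ) * N)) ^
        ((3 * ((m + 1 : ℕ) : ℝ) - 1) / 2) / (N : ℝ) ^ m) := by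
  rcases Nat.eq_zero_or_pos d with h0 | hd
  · subst h0
    rw [leaf_case U t ht, abs_zero]
    exact Real.sqrt_nonneg _
  have hNr : (2:ℝ) ≤ N := by exact_mod_cast hN
  have hmr : (1:ℝ) ≤ m := by exact_mod_cast hm
  have hdr : (1:ℝ) ≤ d := by exact_mod_cast hd
  have hN0 : (0:ℝ) < N := by linarith
  set ell := Real.log N with hell
  set L := Real.log (((m + 1 : ℕ) : ℝ) * N) with hL
  have hell0 : 0 < ell := Real.log_pos (by linarith)
  have hellL : ell ≤ L := by
    apply Real.log_le_log hN0
    push_cast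
    nlinarith
  have hL1 : 1 ≤ L := by
    rw [hL, Real.le_log_iff_exp_le (by positivity)]
    have := Real.exp_one_lt_d9
    push_cast
    nlinarith
  set Y := 10000 * (d:ℝ) * L with hYd
  have hYd1 : 10000 * (d:ℝ) ≤ Y := by nlinarith
  have hY1 : 1 ≤ Y := by linarith
  have hY0 : 0 < Y := by linarith
  have hex : (2 * (((m + 1 : ℕ) : ℝ) - 1)) / (3 * ((m + 1 : ℕ) : ℝ) - 1) = 2 * m / (3 * m + 2) := by
    push_cast; congr 1 <;> ring
  have hex2 : (3 * ((m + 1 : ℕ) : ℝ) - 1) / 2 = (3 * m + 2) / 2 := by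
    push_cast; ring
  rw [hex] at hY
  rw [hex2]
  have hA : Y ^ ((3 * (m:ℝ) + 2) / 2) ≤ (N:ℝ) ^ m := by
    refine le_trans (Real.rpow_le_rpow hY0.le hY (by positivity)) ?_
    rw [← Real.rpow_mul hN0.le, ← Real.rpow_natCast]
    apply le_of_eq
    congr 1
    field_simp
  have hB : Y ≤ N := by
    refine hY.trans ?_
    conv_rhs => rw [← Real.rpow_one (N:ℝ)]
    apply Real.rpow_le_rpow_of_exponent_le (by linarith)
    rw [div_le_one (by positivity)]
    linarith
  have hC : Y ^ 3 ≤ (N:ℝ) ^ 2 := by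
    refine le_trans (pow_le_pow_left₀ hY0.le hY 3) ?_
    rw [← Real.rpow_natCast, ← Real.rpow_mul hN0.le, ← Real.rpow_natCast]
    apply Real.rpow_le_rpow_of_exponent_le (by linarith)
    rw [div_mul_eq_mul_div, div_le_iff₀ (by positivity)]
    push_cast
    linarith
  set v := 100 * (d:ℝ) * ell / N with hv
  have hga : GoodAt U d v := fun T1 T2 h y => good_bound U hg T1 T2 d h y
  have hv0 : 0 < v := by positivity
  have hvY : 100 * v ≤ Y / N := by
    rw [hv, hYd, mul_div_assoc']
    gcongr ?_ / _
    nlinarith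
  have hYN : Y / N ≤ 1 := (div_le_one hN0).2 hB
  have hYN0 : 0 ≤ Y / N := by positivity
  rcases Nat.lt_or_ge m 2 with h2 | h2
  · obtain rfl : m = 1 := by omega
    refine (main_2 hU hga hv0 (by linarith) t ht).trans (Real.sqrt_le_sqrt ?_)
    have e1 : v * d ≤ Y ^ (2:ℝ) / (N:ℝ) ^ 1 := by
      rw [Real.rpow_two, pow_one, sq, mul_div_assoc, mul_comm]
      refine mul_le_mul ?_ ?_ hv0.le hY0.le <;> linarith
    refine e1.trans ?_
    gcongr
    norm_num
  · have hb : 288 * (d:ℝ) ^ 2 * (2 * v) ^ m ≤ Y ^ ((3 * (m:ℝ) + 2) / 2) / (N:ℝ) ^ m := by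
      have e1 : 288 * (d:ℝ) ^ 2 ≤ Y ^ 2 := by nlinarith
      have e2 : (2 * v) ^ m ≤ (Y / N) ^ m := pow_le_pow_left₀ (by positivity) (by linarith) m
      have e3 : Y ^ 2 * (Y / N) ^ m = Y ^ ((m + 2 : ℕ) : ℝ) / (N:ℝ) ^ m := by
        rw [Real.rpow_natCast, div_pow, pow_add]; ring
      refine (mul_le_mul e1 e2 (by positivity) (by positivity)).trans ?_
      rw [e3]
      have hm2 : (2:ℝ) ≤ m := by exact_mod_cast h2
      gcongr
      push_cast; linarith
    have hle1 : Y ^ ((3 * (m:ℝ) + 2) / 2) / (N:ℝ) ^ m ≤ 1 := by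
      rw [div_le_one (by positivity)]; exact hA
    refine (main_ge3 h2 hU hga hv0 (by linarith) (fun _ => hb.trans hle1) ?_ t ht).trans
      (Real.sqrt_le_sqrt hb)
    intro _
    have e1 : (2 * v) ^ 2 ≤ (Y / N) ^ 2 := pow_le_pow_left₀ (by positivity) (by linarith) 2
    have e2 : (Y / N) ^ 2 * Y ≤ 1 := by
      rw [div_pow, div_mul_eq_mul_div, div_le_one (by positivity), ← pow_succ]; exact hC
    calc 6 * (2 * v) ^ 2 * (d:ℝ) = (2 * v) ^ 2 * (6 * d) := by ring
      _ ≤ (Y / N) ^ 2 * Y := mul_le_mul e1 (by linarith) (by positivity) (by positivity)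
      _ ≤ 1 := e2

end

/-- pseudorandomness of `D_{U,k}` against decision trees:
there is a universal constant `C > 0` such that for all `N ≥ 2`, `k ≥ 2`,
every good orthogonal `U ∈ ℝ^{N×N}`, and every `F : {-1,1}^{kN} → {0,1}`
computed by a decision tree of depth at most `d` with
`C·d·ln(kN) ≤ N^{2(k-1)/(3k-1)}`, the advantage of `F` in distinguishing the
uniform distribution from `D_{U,k}` is at most
`√((C·d·ln(kN))^{(3k-1)/2} / N^{k-1})`. -/
theorem hard_distribution_pseudorandom_for_decision_trees :
    ∃ C : ℝ, 0 < C ∧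
      ∀ (N k d : ℕ), 2 ≤ N → 2 ≤ k →
        ∀ U : Fin N → Fin N → ℝ, IsOrthogonal U → IsGood U →
          ∀ (F : ((Fin k × Fin N) → Bool) → ℝ) (T : DTree (Fin k × Fin N)),
            T.depth ≤ d → (∀ x, F x = T.eval x) →
            C * d * Real.log (k * N) ≤
              (N : ℝ) ^ ((2 * ((k : ℝ) - 1)) / (3 * (k : ℝ) - 1)) →
            |uavg F -
                ∫ X, F (fun p => sgnBool (Zfam N k U X p.1 p.2))
                  ∂(stdGaussianFam N (k - 1))| ≤
              Real.sqrt
                ((C * d * Real.log (k * N)) ^ ((3 * (k : ℝ) - 1) / 2) /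
                  (N : ℝ) ^ (k - 1)) := by
  refine ⟨10000, by norm_num, ?_⟩
  intro N k d hN hk U hU hg F T hT hF h
  obtain ⟨m, rfl⟩ : ∃ m, k = m + 1 := ⟨k - 1, by omega⟩
  obtain rfl : F = fun x => T.eval x := funext hF
  exact final_aux N m d hN (by omega) U hU hg T hT h
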